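/- arXiv:2305.05272 — 2 statements merged into one kernel-verified Lean document; each statement's English description precedes it below -/
import Mathlib

section
/- Let m ≥ 3 be an integer and 1 < p < ∞. There is a constant C, independent of m and f, such that for every smooth function f compactly supported in (0,∞)×ℝ: ‖L_m^{-1}(∇̃∇̃ f)‖_{L^p} ≤ C (‖f‖_{L^p} + ‖L_m^{-1}((1/r) ∇̃ f)‖_{L^p}), where ∇̃∇̃ f stands for any of the second derivatives ∂_r² f, ∂_r ∂_z f, ∂_z² f, each estimated separately. -/
open Real MeasureTheory Set

noncomputable section

/-- `F_m(s) = ∫₀^π cos(mθ)/√(s + 2(1 − cos θ)) dθ`. -/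
def Fm (m : ℕ) (s : ℝ) : ℝ :=
  ∫ θ in (0:ℝ)..Real.pi, Real.cos (m * θ) / Real.sqrt (s + 2 * (1 - Real.cos θ))

/-- `ξ² = ((r − r̄)² + (z − z̄)²)/(r r̄)`. -/
def xiSq (r r' z z' : ℝ) : ℝ := ((r - r')^2 + (z - z')^2) / (r * r')

/-- The explicit integral kernel realisation of
`L_m^{-1} = (−(∂_r² + ∂_r/r + ∂_z²) + m²/r²)^{-1}` on axisymmetric functions. -/
def Lminv (m : ℕ) (g : ℝ → ℝ → ℝ) (r z : ℝ) : ℝ :=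
  (1/(2*Real.pi)) * ∫ r' in Set.Ioi (0:ℝ), ∫ z' : ℝ,
    Fm m (xiSq r r' z z') * g r' z' * Real.sqrt (r'/r)

/-- The `L^p(ℝ³)` norm of the axisymmetric function corresponding to `f(r,z)`:
`‖f‖_{L^p}^p = 2π ∫₀^∞ ∫_ℝ |f(r,z)|^p r dz dr`. -/
def cylLp (p : ℝ) (f : ℝ → ℝ → ℝ) : ℝ :=
  (2*Real.pi * ∫ r in Set.Ioi (0:ℝ), ∫ z : ℝ, |f r z| ^ p * r) ^ (1/p)

/-- A smooth function compactly supported in `(0,∞) × ℝ`. -/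
def TestFun (f : ℝ → ℝ → ℝ) : Prop :=
  ContDiff ℝ (⊤ : ℕ∞) (Function.uncurry f) ∧ HasCompactSupport (Function.uncurry f) ∧
    tsupport (Function.uncurry f) ⊆ Set.Ioi (0:ℝ) ×ˢ Set.univ

set_option linter.unusedSectionVars false

/-- The Bellman function `K (|x|^p + |y|^q) + x² (|x|^p + |y|^q)^(1 - 2/p)`. -/
def bellman (p q : ℝ) (v : ℝ × ℝ) : ℝ :=
  (10 * p + 1 / (q * (q - 1))) * (|v.1| ^ p + |v.2| ^ q)
    + v.1 ^ 2 * (|v.1| ^ p + |v.2| ^ q) ^ (1 - 2 / p)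

lemma continuous_bellman {p q : ℝ} (hp : 2 ≤ p) (hq : 0 ≤ q) : Continuous (bellman p q) := by
  have hb : 0 ≤ 1 - 2 / p := by
    rw [sub_nonneg, div_le_one (by linarith)]; exact hp
  unfold bellman
  have h1 : Continuous fun v : ℝ × ℝ => |v.1| ^ p + |v.2| ^ q :=
    (continuous_fst.abs.rpow_const fun _ => Or.inr (by linarith)).add
      (continuous_snd.abs.rpow_const fun _ => Or.inr hq)
  exact (continuous_const.mul h1).add
    ((continuous_fst.pow 2).mul (h1.rpow_const fun _ => Or.inr hb))

lemma sq_mul_rpow_le {p a x : ℝ} (hp : 2 ≤ p) (hx : 0 ≤ x) (h : x ^ p ≤ a) :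
    x ^ 2 * a ^ (1 - 2 / p) ≤ a := by
  have ha : 0 ≤ a := (rpow_nonneg hx p).trans h
  rcases ha.eq_or_lt with rfl | ha
  · have : x = 0 := by
      by_contra hne
      have := rpow_pos_of_pos (lt_of_le_of_ne hx (Ne.symm hne)) p
      linarith
    simp [this]
  have h1 : x ^ 2 ≤ a ^ (2 / p) := by
    have := rpow_le_rpow (rpow_nonneg hx p) h (show 0 ≤ 2 / p by positivity)
    rwa [← rpow_mul hx, mul_div_cancel₀ _ (by linarith), rpow_two] at this
  calc x ^ 2 * a ^ (1 - 2 / p) ≤ a ^ (2 / p) * a ^ (1 - 2 / p) := by gcongr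
    _ = a := by rw [← rpow_add ha]; simp

lemma bellman_nonneg {p q : ℝ} (hp : 2 ≤ p) (hq : 1 < q) (v : ℝ × ℝ) : 0 ≤ bellman p q v := by
  have h1 : 0 < q - 1 := by linarith
  unfold bellman; positivity

lemma bellman_le {p q : ℝ} (hp : 2 ≤ p) (v : ℝ × ℝ) :
    bellman p q v ≤ (10 * p + 1 / (q * (q - 1)) + 1) * (|v.1| ^ p + |v.2| ^ q) := by
  have := sq_mul_rpow_le (a := |v.1| ^ p + |v.2| ^ q) hp (abs_nonneg v.1)
    (le_add_of_nonneg_right (rpow_nonneg (abs_nonneg _) _))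
  rw [sq_abs] at this
  unfold bellman; linarith

set_option maxHeartbeats 1000000 in
/-- The pointwise Hessian inequality. -/
lemma bellman_hessian_nonneg {p q X Y h k σ : ℝ} (hp : 2 ≤ p) (hpq : p.HolderConjugate q)
    (hX : 0 < X) (hY : 0 < Y) (hσ : |σ| ≤ 1) {A A1 A2 S : ℝ}
    (hA : A = X ^ p + Y ^ q) (hA1 : A1 = p * X ^ (p - 1) * h + q * Y ^ (q - 1) * k)
    (hA2 : A2 = p * (p - 1) * X ^ (p - 2) * h ^ 2 + q * (q - 1) * Y ^ (q - 2) * k ^ 2)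
    (hS : S = A ^ (1 - 2 / p)) :
    0 ≤ (10 * p + 1 / (q * (q - 1))) * A2 + 2 * h ^ 2 * S
      + 4 * h * X * (1 - 2 / p) * (S / A) * A1
      + X ^ 2 * (1 - 2 / p) * ((1 - 2 / p - 1) * (S / A ^ 2) * A1 ^ 2 + S / A * A2)
      + 2 * σ * (h * k) := by
  have hq1 : 1 < q := hpq.symm.lt
  have hq2 : q ≤ 2 := by
    have := hpq.inv_add_inv_eq_one
    have h2 : p⁻¹ ≤ 2⁻¹ := inv_anti₀ (by norm_num) hp
    have h3 : 2⁻¹ ≤ q⁻¹ := by linarith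
    exact (inv_le_inv₀ (by norm_num) (by linarith)).1 h3
  have hpq1 : p * (q - 1) = q := by
    have := hpq.mul_eq_add; linarith
  have hXp := rpow_pos_of_pos hX p
  have hYq := rpow_pos_of_pos hY q
  have hApos : 0 < A := by rw [hA]; positivity
  have hSpos : 0 < S := by rw [hS]; positivity
  set u := X ^ (p - 2) * h ^ 2 with hu
  set w := Y ^ (q - 2) * k ^ 2 with hw
  have hu0 : 0 ≤ u := by positivity
  have hw0 : 0 ≤ w := by positivity
  have hA2' : A2 = p * (p - 1) * u + q * (q - 1) * w := by rw [hA2, hu, hw]; ring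
  have hA2n : 0 ≤ A2 := by
    rw [hA2']; have : 0 ≤ p - 1 := by linarith
    have : 0 ≤ q - 1 := by linarith
    positivity
  have hx2 : (X ^ (p - 1) * h) ^ 2 = X ^ p * u := by
    rw [hu, mul_pow, ← rpow_natCast (X ^ (p-1)), ← rpow_mul hX.le, ← mul_assoc, ← rpow_add hX]
    congr 2; push_cast; ring
  have hy2 : (Y ^ (q - 1) * k) ^ 2 = Y ^ q * w := by
    rw [hw, mul_pow, ← rpow_natCast (Y ^ (q-1)), ← rpow_mul hY.le, ← mul_assoc, ← rpow_add hY]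
    congr 2; push_cast; ring
  have hA1sq : A1 ^ 2 ≤ 2 * p * A * A2 := by
    have e1 : A1 ^ 2 ≤ 2 * (p ^ 2 * (X ^ p * u) + q ^ 2 * (Y ^ q * w)) := by
      rw [← hx2, ← hy2, hA1]
      nlinarith [sq_nonneg (p * X ^ (p - 1) * h - q * Y ^ (q - 1) * k)]
    have e2 : X ^ p * u ≤ A * u := by gcongr; rw [hA]; linarith
    have e3 : Y ^ q * w ≤ A * w := by gcongr; rw [hA]; linarith
    have e4 : p ^ 2 * (A * u) ≤ p * A * (p * (p - 1) * u) := by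
      have : 0 ≤ A * u := by positivity
      nlinarith [mul_nonneg (mul_nonneg (sq_nonneg p) this) (show 0 ≤ p - 2 by linarith)]
    have e5 : q ^ 2 * (A * w) = p * A * (q * (q - 1) * w) := by
      linear_combination (-(q * A * w)) * hpq1
    have e6 : p ^ 2 * (X ^ p * u) ≤ p ^ 2 * (A * u) := by gcongr
    have e7 : q ^ 2 * (Y ^ q * w) ≤ q ^ 2 * (A * w) := by gcongr
    rw [hA2']; nlinarith
  have hXS : X ^ 2 * S ≤ A := by
    rw [hS]; exact sq_mul_rpow_le hp hX.le (by rw [hA]; linarith)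
  have hSY : 1 ≤ S * Y ^ (q - 2) := by
    have hb : 0 ≤ 1 - 2 / p := by
      rw [sub_nonneg, div_le_one (by linarith)]; exact hp
    have h1 : (Y ^ q) ^ (1 - 2 / p) ≤ S := by
      rw [hS]; exact rpow_le_rpow hYq.le (by rw [hA]; linarith) hb
    rw [← rpow_mul hY.le] at h1
    have e : q * (1 - 2 / p) = 2 - q := by
      have hp0 : p ≠ 0 := by linarith
      field_simp
      linear_combination hpq1 * 2
    rw [e] at h1
    calc (1:ℝ) = Y ^ (2 - q) * Y ^ (q - 2) := by rw [← rpow_add hY]; simp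
      _ ≤ S * Y ^ (q - 2) := by gcongr
  set β := 1 - 2 / p with hβ
  have hβ0 : 0 ≤ β := by rw [hβ, sub_nonneg, div_le_one (by linarith)]; exact hp
  have hβ1 : β ≤ 1 := by rw [hβ]; have : 0 ≤ 2 / p := by positivity
                         linarith
  have hM : X ^ 2 * S / A ^ 2 * A1 ^ 2 ≤ 2 * p * A2 := by
    rw [div_mul_eq_mul_div, div_le_iff₀ (by positivity)]
    calc X ^ 2 * S * A1 ^ 2 ≤ A * (2 * p * A * A2) := by gcongr
      _ = 2 * p * A2 * A ^ 2 := by ring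
  have hM0 : 0 ≤ X ^ 2 * S / A ^ 2 * A1 ^ 2 := by positivity
  have t1 : -(h ^ 2 * S + 8 * p * A2) ≤ 4 * h * X * β * (S / A) * A1 := by
    have e1 : 0 ≤ S * (h + 2 * β * X * A1 / A) ^ 2 := by positivity
    have e2 : S * (h + 2 * β * X * A1 / A) ^ 2 = h ^ 2 * S + 4 * h * X * β * (S / A) * A1
        + 4 * β ^ 2 * (X ^ 2 * S / A ^ 2 * A1 ^ 2) := by field_simp; ring
    have e3 : β ^ 2 * (X ^ 2 * S / A ^ 2 * A1 ^ 2) ≤ 1 * (2 * p * A2) :=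
      mul_le_mul (pow_le_one₀ hβ0 hβ1) hM hM0 zero_le_one
    rw [e2, mul_assoc 4] at e1
    linarith
  have t2 : -(2 * p * A2) ≤ X ^ 2 * β * ((β - 1) * (S / A ^ 2) * A1 ^ 2 + S / A * A2) := by
    have e1 : X ^ 2 * β * ((β - 1) * (S / A ^ 2) * A1 ^ 2 + S / A * A2)
        = -(β * (1 - β) * (X ^ 2 * S / A ^ 2 * A1 ^ 2)) + X ^ 2 * β * (S / A * A2) := by ring
    have e2 : β * (1 - β) * (X ^ 2 * S / A ^ 2 * A1 ^ 2) ≤ 1 * (2 * p * A2) :=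
      mul_le_mul (mul_le_one₀ hβ1 (by linarith) (by linarith)) hM hM0 zero_le_one
    have e3 : 0 ≤ X ^ 2 * β * (S / A * A2) := by positivity
    linarith
  have t3 : w ≤ 1 / (q * (q - 1)) * A2 := by
    have hq0 : 0 < q * (q - 1) := by have : 0 < q - 1 := by linarith
                                     positivity
    rw [div_mul_eq_mul_div, le_div_iff₀ hq0, hA2']
    have : 0 ≤ p * (p - 1) * u := by have : 0 ≤ p - 1 := by linarith
                                     positivity
    linarith
  have t4 : -(h ^ 2 * S + w) ≤ 2 * σ * (h * k) := by
    have hYpos := rpow_pos_of_pos hY (q - 2)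
    have e1 : |h * k| ^ 2 ≤ (h ^ 2 * S) * w := by
      rw [sq_abs, hw]
      calc (h * k) ^ 2 = (h * k) ^ 2 * 1 := by ring
        _ ≤ (h * k) ^ 2 * (S * Y ^ (q - 2)) := by gcongr
        _ = _ := by ring
    have e2 : 2 * |h * k| ≤ h ^ 2 * S + w := by
      have : 0 ≤ h ^ 2 * S := by positivity
      have h4 : (2 * |h * k|) ^ 2 ≤ (h ^ 2 * S + w) ^ 2 := by
        have h5 := sq_nonneg (h ^ 2 * S - w)
        calc (2 * |h * k|) ^ 2 = 4 * |h * k| ^ 2 := by ring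
          _ ≤ 4 * ((h ^ 2 * S) * w) := by linarith
          _ ≤ (h ^ 2 * S + w) ^ 2 := by linear_combination h5
      exact (abs_le_of_sq_le_sq' h4 (by positivity)).2
    have e3 : |σ * (h * k)| ≤ |h * k| := by
      rw [abs_mul]; exact mul_le_of_le_one_left (abs_nonneg _) hσ
    have := neg_abs_le (σ * (h * k))
    linarith
  linarith

lemma convexOn_bellman_segment {p q σ : ℝ} (hp : 2 ≤ p) (hpq : p.HolderConjugate q)
    (hσ : |σ| ≤ 1) {a b h k : ℝ} (hX : ∀ t ∈ Icc (0:ℝ) 1, 0 < a + t * h)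
    (hY : ∀ t ∈ Icc (0:ℝ) 1, 0 < b + t * k) :
    ConvexOn ℝ (Icc 0 1) fun t : ℝ =>
      bellman p q (a + t * h, b + t * k) + σ * ((a + t * h) * (b + t * k)) := by
  set K := 10 * p + 1 / (q * (q - 1)) with hK
  set β := 1 - 2 / p with hβ
  let X : ℝ → ℝ := fun t => a + t * h
  let Y : ℝ → ℝ := fun t => b + t * k
  let A : ℝ → ℝ := fun t => X t ^ p + Y t ^ q
  let A1 : ℝ → ℝ := fun t => p * X t ^ (p - 1) * h + q * Y t ^ (q - 1) * k
  let A2 : ℝ → ℝ := fun t =>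
    p * (p - 1) * X t ^ (p - 2) * h ^ 2 + q * (q - 1) * Y t ^ (q - 2) * k ^ 2
  let g : ℝ → ℝ := fun t => K * A t + X t ^ 2 * A t ^ β + σ * (X t * Y t)
  let g1 : ℝ → ℝ := fun t => K * A1 t + (2 * X t * h * A t ^ β
    + X t ^ 2 * (β * A t ^ (β - 1) * A1 t)) + σ * (h * Y t + X t * k)
  let g2 : ℝ → ℝ := fun t => K * A2 t + 2 * h ^ 2 * A t ^ β
      + 4 * h * X t * β * (A t ^ β / A t) * A1 t
      + X t ^ 2 * β * ((β - 1) * (A t ^ β / A t ^ 2) * A1 t ^ 2 + A t ^ β / A t * A2 t)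
      + 2 * σ * (h * k)
  have dX : ∀ t, HasDerivAt X h t := fun t => by
    exact (((hasDerivAt_id t).mul_const h).const_add a).congr_deriv (one_mul h)
  have dY : ∀ t, HasDerivAt Y k t := fun t => by
    exact (((hasDerivAt_id t).mul_const k).const_add b).congr_deriv (one_mul k)
  have Apos : ∀ t ∈ Icc (0:ℝ) 1, 0 < A t := fun t ht =>
    add_pos (rpow_pos_of_pos (hX t ht) _) (rpow_pos_of_pos (hY t ht) _)
  have dA : ∀ t ∈ Icc (0:ℝ) 1, HasDerivAt A (A1 t) t := fun t ht => by
    have := ((dX t).rpow_const (p := p) (Or.inl (hX t ht).ne')).add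
      ((dY t).rpow_const (p := q) (Or.inl (hY t ht).ne'))
    refine this.congr_deriv ?_
    simp only [A1]; ring
  have dA1 : ∀ t ∈ Icc (0:ℝ) 1, HasDerivAt A1 (A2 t) t := fun t ht => by
    have := ((((dX t).rpow_const (p := p - 1) (Or.inl (hX t ht).ne')).const_mul p).mul_const h).add
      ((((dY t).rpow_const (p := q - 1) (Or.inl (hY t ht).ne')).const_mul q).mul_const k)
    refine this.congr_deriv ?_
    simp only [A2]
    rw [show p - 1 - 1 = p - 2 by ring, show q - 1 - 1 = q - 2 by ring]; ring
  have dg : ∀ t ∈ Icc (0:ℝ) 1, HasDerivAt g (g1 t) t := fun t ht => by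
    have := (((dA t ht).const_mul K).add (((dX t).pow 2).mul
      ((dA t ht).rpow_const (p := β) (Or.inl (Apos t ht).ne')))).add
      (((dX t).mul (dY t)).const_mul σ)
    refine this.congr_deriv ?_
    simp only [g1, Pi.pow_apply]; push_cast; ring
  have dg1 : ∀ t ∈ Icc (0:ℝ) 1, HasDerivAt g1 (g2 t) t := fun t ht => by
    have hA := Apos t ht
    have dAb := (dA t ht).rpow_const (p := β) (Or.inl hA.ne')
    have dAb1 := (dA t ht).rpow_const (p := β - 1) (Or.inl hA.ne')
    have := (((dA1 t ht).const_mul K).add (((((dX t).const_mul 2).mul_const h).mul dAb).add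
      (((dX t).pow 2).mul ((dAb1.const_mul β).mul (dA1 t ht))))).add
      ((((dY t).const_mul h).add ((dX t).mul_const k)).const_mul σ)
    refine this.congr_deriv ?_
    simp only [g2, Pi.pow_apply, Pi.mul_apply]
    rw [show A t ^ (β - 1 - 1) = A t ^ β / A t ^ 2 by
        rw [rpow_sub hA, rpow_sub hA, rpow_one]; field_simp,
      show A t ^ (β - 1) = A t ^ β / A t by rw [rpow_sub hA, rpow_one]]
    push_cast; ring
  have hconv : ConvexOn ℝ (Icc (0:ℝ) 1) g := by
    refine convexOn_of_hasDerivWithinAt2_nonneg (convex_Icc 0 1)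
      (fun t ht => (dg t ht).continuousAt.continuousWithinAt)
      (fun t ht => (dg t (interior_subset ht)).hasDerivWithinAt)
      (fun t ht => (dg1 t (interior_subset ht)).hasDerivWithinAt) fun t ht => ?_
    have ht' := interior_subset ht
    exact bellman_hessian_nonneg hp hpq (hX t ht') (hY t ht') hσ rfl rfl rfl rfl
  refine hconv.congr fun t ht => ?_
  simp only [g, bellman, A, X, Y]
  rw [abs_of_pos (hX t ht), abs_of_pos (hY t ht)]

lemma convexOn_bellman {p q σ : ℝ} (hp : 2 ≤ p) (hpq : p.HolderConjugate q) (hσ : |σ| ≤ 1) :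
    ConvexOn ℝ (Ici (0:ℝ) ×ˢ Ici (0:ℝ)) fun v => bellman p q v + σ * (v.1 * v.2) := by
  have hcont : Continuous fun v => bellman p q v + σ * (v.1 * v.2) :=
    (continuous_bellman hp hpq.symm.nonneg).add (by fun_prop)
  have hopen : ∀ x ∈ Ioi (0:ℝ) ×ˢ Ioi (0:ℝ), ∀ y ∈ Ioi (0:ℝ) ×ˢ Ioi (0:ℝ), ∀ a b : ℝ, 0 ≤ a →
      0 ≤ b → a + b = 1 → bellman p q (a • x + b • y) + σ * ((a • x + b • y).1 * (a • x + b • y).2)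
        ≤ a * (bellman p q x + σ * (x.1 * x.2)) + b * (bellman p q y + σ * (y.1 * y.2)) := by
    rintro ⟨x1, x2⟩ ⟨hx1, hx2⟩ ⟨y1, y2⟩ ⟨hy1, hy2⟩ a b ha hb hab
    simp only [mem_Ioi] at hx1 hx2 hy1 hy2
    have key : ∀ c d : ℝ, 0 < c → 0 < d → ∀ t ∈ Icc (0:ℝ) 1, 0 < c + t * (d - c) := by
      rintro c d hc hd t ⟨h0, h1⟩
      rcases h0.eq_or_lt with rfl | h0
      · simpa using hc
      · nlinarith [mul_pos h0 hd, mul_nonneg hc.le (sub_nonneg.2 h1)]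
    have := (convexOn_bellman_segment hp hpq hσ (key x1 y1 hx1 hy1) (key x2 y2 hx2 hy2)).2
      (left_mem_Icc.2 zero_le_one) (right_mem_Icc.2 zero_le_one) ha hb hab
    simp only [smul_eq_mul, mul_zero, mul_one, zero_add, zero_mul, add_zero, one_mul,
      add_sub_cancel] at this
    have e : ∀ c d : ℝ, c + b * (d - c) = a * c + b * d := fun c d => by
      rw [show a = 1 - b by linarith]; ring
    simpa [e] using this
  refine ⟨(convex_Ici 0).prod (convex_Ici 0), fun x hx y hy a b ha hb hab => ?_⟩
  have lim : ∀ (w : ℝ × ℝ), Filter.Tendsto (fun ε : ℝ => w + ε • ((1, 1) : ℝ × ℝ))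
      (nhdsWithin 0 (Ioi 0)) (nhds w) := fun w => by
    have : Continuous fun ε : ℝ => w + ε • ((1, 1) : ℝ × ℝ) := by fun_prop
    simpa using (this.tendsto 0).mono_left nhdsWithin_le_nhds
  refine le_of_tendsto_of_tendsto ((hcont.tendsto _).comp (lim (a • x + b • y)))
    ((((hcont.tendsto _).comp (lim x)).const_mul a).add
      (((hcont.tendsto _).comp (lim y)).const_mul b)) ?_
  filter_upwards [self_mem_nhdsWithin] with ε hε
  have hmem : ∀ w ∈ Ici (0:ℝ) ×ˢ Ici (0:ℝ), w + ε • ((1, 1) : ℝ × ℝ) ∈ Ioi (0:ℝ) ×ˢ Ioi (0:ℝ) := by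
    rintro ⟨w1, w2⟩ ⟨h1, h2⟩
    simp only [mem_Ici, mem_Ioi] at h1 h2 hε
    exact ⟨by simpa using by linarith, by simpa using by linarith⟩
  have := hopen _ (hmem x hx) _ (hmem y hy) a b ha hb hab
  have e : a • (x + ε • ((1, 1) : ℝ × ℝ)) + b • (y + ε • ((1, 1) : ℝ × ℝ))
      = a • x + b • y + ε • ((1, 1) : ℝ × ℝ) := by
    rw [smul_add, smul_add, add_add_add_comm, ← add_smul, hab, one_smul]
  rw [e] at this
  exact this

section Averages

variable {E : Type*} [NormedAddCommGroup E] [InnerProductSpace ℝ E] [FiniteDimensional ℝ E]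
  [MeasurableSpace E] [BorelSpace E]

/-- The average of `u` over the translates distributed according to `μ`. -/
def avg (μ : Measure E) (u : E → ℝ) (x : E) : ℝ := ∫ y, u (x + y) ∂μ

/-- Bounded, measurable and integrable functions. -/
structure Nice (u : E → ℝ) : Prop where
  meas : Measurable u
  int : Integrable u
  bdd : ∃ M, ∀ x, |u x| ≤ M

lemma Nice.add {u v : E → ℝ} (hu : Nice u) (hv : Nice v) : Nice fun x => u x + v x := by
  obtain ⟨M, hM⟩ := hu.bdd
  obtain ⟨N, hN⟩ := hv.bdd
  exact ⟨hu.meas.add hv.meas, hu.int.add hv.int, M + N, fun x =>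
    (abs_add_le _ _).trans (add_le_add (hM x) (hN x))⟩

lemma Nice.const_mul {u : E → ℝ} (hu : Nice u) (c : ℝ) : Nice fun x => c * u x := by
  obtain ⟨M, hM⟩ := hu.bdd
  exact ⟨hu.meas.const_mul c, hu.int.const_mul c, |c| * M, fun x => by
    rw [abs_mul]; gcongr; exact hM x⟩

lemma Nice.sub {u v : E → ℝ} (hu : Nice u) (hv : Nice v) : Nice fun x => u x - v x := by
  simpa [sub_eq_add_neg] using hu.add (hv.const_mul (-1))

lemma Nice.posPart {u : E → ℝ} (hu : Nice u) : Nice fun x => max (u x) 0 := by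
  obtain ⟨M, hM⟩ := hu.bdd
  exact ⟨hu.meas.max measurable_const, hu.int.pos_part, M, fun x =>
    (abs_max_le_max_abs_abs).trans (by simpa using hM x)⟩

lemma Nice.negPart {u : E → ℝ} (hu : Nice u) : Nice fun x => max (-u x) 0 := by
  simpa using (hu.const_mul (-1)).posPart

/-- Functions of two nice functions that are dominated by `|u| + |v|`. -/
lemma Nice.mul {u v : E → ℝ} (hu : Nice u) (hv : Nice v) : Nice fun x => u x * v x := by
  obtain ⟨M, hM⟩ := hu.bdd
  obtain ⟨N, hN⟩ := hv.bdd
  refine ⟨hu.meas.mul hv.meas, hv.int.bdd_mul hu.meas.aestronglyMeasurable (c := M)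
    (.of_forall hM), M * N, fun x => ?_⟩
  rw [abs_mul]
  exact mul_le_mul (hM x) (hN x) (abs_nonneg _) ((abs_nonneg _).trans (hM x))

lemma Nice.abs_rpow {u : E → ℝ} (hu : Nice u) {p : ℝ} (hp : 1 ≤ p) : Nice fun x => |u x| ^ p := by
  obtain ⟨M, hM⟩ := hu.bdd
  have hM0 : 0 ≤ M := (abs_nonneg _).trans (hM 0)
  have hle : ∀ x, |u x| ^ p ≤ M ^ (p - 1) * |u x| := fun x => by
    rcases (abs_nonneg (u x)).eq_or_lt with h | h
    · rw [← h, zero_rpow (by linarith)]; simp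
    · calc |u x| ^ p = |u x| ^ (p - 1) * |u x| := by
            rw [← rpow_add_one h.ne']; simp
        _ ≤ M ^ (p - 1) * |u x| := by
            exact mul_le_mul_of_nonneg_right
              (rpow_le_rpow (abs_nonneg _) (hM x) (by linarith)) (abs_nonneg _)
  have hm : Measurable fun x => |u x| ^ p := hu.meas.abs.pow_const p
  have h0 : ∀ x, |(|u x| ^ p)| = |u x| ^ p := fun x => abs_of_nonneg (by positivity)
  refine ⟨hm, (hu.int.abs.const_mul (M ^ (p - 1))).mono' hm.aestronglyMeasurable
    (.of_forall fun x => ?_), M ^ p, fun x => ?_⟩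
  · rw [norm_eq_abs, h0]; exact hle x
  · rw [h0]; exact rpow_le_rpow (abs_nonneg _) (hM x) (by linarith)

lemma Nice.translate_integrable {u : E → ℝ} (hu : Nice u) (μ : Measure E) [IsFiniteMeasure μ]
    (x : E) : Integrable (fun y => u (x + y)) μ := by
  obtain ⟨M, hM⟩ := hu.bdd
  exact Integrable.of_bound (hu.meas.comp (measurable_const_add x)).aestronglyMeasurable M
    (.of_forall fun y => hM _)

lemma Nice.integrable_prod {u : E → ℝ} (hu : Nice u) (μ : Measure E) [IsFiniteMeasure μ] :
    Integrable (fun z : E × E => u (z.1 + z.2)) ((volume : Measure E).prod μ) := by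
  have h1 : Integrable (fun z : E × E => u z.2) (μ.prod volume) := hu.int.comp_snd μ
  have h2 := (measurePreserving_prod_add μ (volume : Measure E)).integrable_comp_of_integrable h1
  have h3 := h2.swap
  refine h3.congr (.of_forall fun z => ?_)
  simp [add_comm]

lemma Nice.avg {u : E → ℝ} (hu : Nice u) (μ : Measure E) [IsProbabilityMeasure μ] :
    Nice (avg μ u) := by
  obtain ⟨M, hM⟩ := hu.bdd
  have hm : Measurable fun z : E × E => u (z.1 + z.2) := hu.meas.comp measurable_add
  refine ⟨(hm.stronglyMeasurable.integral_prod_right (ν := μ)).measurable,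
    (hu.integrable_prod μ).integral_prod_left, M, fun x => ?_⟩
  have := norm_integral_le_of_norm_le_const (μ := μ) (f := fun y => u (x + y)) (C := M)
    (.of_forall fun y => hM _)
  simpa [_root_.avg] using this

lemma integral_avg {u : E → ℝ} (hu : Nice u) (μ : Measure E) [IsProbabilityMeasure μ] :
    ∫ x, avg μ u x = ∫ x, u x := by
  unfold avg
  rw [integral_integral_swap (hu.integrable_prod μ)]
  simp [integral_add_right_eq_self]

lemma avg_sub {u v : E → ℝ} (hu : Nice u) (hv : Nice v) (μ : Measure E) [IsProbabilityMeasure μ] :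
    avg μ (fun x => u x - v x) = fun x => avg μ u x - avg μ v x := by
  ext x
  exact integral_sub (hu.translate_integrable μ x) (hv.translate_integrable μ x)

lemma avg_avg {u : E → ℝ} (hu : Nice u) (μ ν : Measure E) [IsProbabilityMeasure μ]
    [IsProbabilityMeasure ν] : avg μ (avg ν u) = avg (μ.conv ν) u := by
  ext x
  have : Integrable (fun y => u (x + y)) (μ.conv ν) := hu.translate_integrable _ x
  unfold avg
  rw [integral_conv this]
  simp [add_assoc]

lemma avg_comm {u : E → ℝ} (hu : Nice u) (μ ν : Measure E) [IsProbabilityMeasure μ]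
    [IsProbabilityMeasure ν] : avg μ (avg ν u) = avg ν (avg μ u) := by
  rw [avg_avg hu, avg_avg hu, Measure.conv_comm]

/-- Averaging against a symmetric measure is self-adjoint. -/
lemma integral_avg_mul {u v : E → ℝ} (hu : Nice u) (hv : Nice v) (μ : Measure E)
    [IsProbabilityMeasure μ] [μ.IsNegInvariant] :
    ∫ x, avg μ u x * v x = ∫ x, u x * avg μ v x := by
  obtain ⟨M, hM⟩ := hu.bdd
  obtain ⟨N, hN⟩ := hv.bdd
  have i1 : Integrable (fun z : E × E => u (z.1 + z.2) * v z.1) ((volume : Measure E).prod μ) :=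
    (hu.integrable_prod μ).mul_bdd (c := N)
      (hv.meas.comp measurable_fst).aestronglyMeasurable (.of_forall fun z => hN _)
  have i2 : Integrable (fun z : E × E => u z.1 * v (z.1 + z.2)) ((volume : Measure E).prod μ) :=
    (hv.integrable_prod μ).bdd_mul (c := M)
      (hu.meas.comp measurable_fst).aestronglyMeasurable (.of_forall fun z => hM _)
  calc ∫ x, avg μ u x * v x = ∫ x, ∫ y, u (x + y) * v x ∂μ := by
        simp [avg, integral_mul_const]
    _ = ∫ y, (∫ x, u (x + y) * v x) ∂μ := integral_integral_swap i1
    _ = ∫ y, (∫ x, u x * v (x + -y)) ∂μ := by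
        congr 1; ext y
        rw [← integral_add_right_eq_self _ (-y)]
        simp
    _ = ∫ y, (∫ x, u x * v (x + y)) ∂μ :=
        integral_neg_eq_self (fun y => ∫ x, u x * v (x + y)) μ
    _ = ∫ x, ∫ y, u x * v (x + y) ∂μ := (integral_integral_swap i2).symm
    _ = ∫ x, u x * avg μ v x := by simp [avg, integral_const_mul]

lemma avg_nonneg {u : E → ℝ} (hu : ∀ x, 0 ≤ u x) (μ : Measure E) (x : E) : 0 ≤ avg μ u x :=
  integral_nonneg fun _ => hu _

lemma abs_avg_le {u : E → ℝ} {M : ℝ} (hM : ∀ x, |u x| ≤ M) (μ : Measure E)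
    [IsProbabilityMeasure μ] (x : E) : |avg μ u x| ≤ M := by
  have := norm_integral_le_of_norm_le_const (μ := μ) (f := fun y => u (x + y)) (C := M)
    (.of_forall fun y => hM _)
  simpa [avg] using this

/-- The integrated Bellman function. -/
def bellmanInt (p q : ℝ) (u v : E → ℝ) : ℝ := ∫ x, bellman p q (u x, v x)

lemma Nice.bellman {p q : ℝ} (hp : 2 ≤ p) (hq : 1 < q) {u v : E → ℝ} (hu : Nice u) (hv : Nice v) :
    Nice fun x => bellman p q (u x, v x) := by
  have h1 := ((hu.abs_rpow (p := p) (by linarith)).add (hv.abs_rpow hq.le)).const_mul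
    (10 * p + 1 / (q * (q - 1)) + 1)
  have hle := fun x => bellman_le (q := q) hp (u x, v x)
  have h0 := fun x => bellman_nonneg hp hq (u x, v x)
  have hm : Measurable fun x => _root_.bellman p q (u x, v x) :=
    (continuous_bellman hp (by linarith)).measurable.comp (hu.meas.prodMk hv.meas)
  obtain ⟨M, hM⟩ := h1.bdd
  refine ⟨hm, h1.int.mono' hm.aestronglyMeasurable (.of_forall fun x => ?_), M, fun x => ?_⟩
  · rw [norm_eq_abs, abs_of_nonneg (h0 x)]; exact hle x
  · rw [abs_of_nonneg (h0 x)]; exact (hle x).trans ((le_abs_self _).trans (hM x))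

/-- One step of the Bellman function argument. -/
lemma bellmanInt_avg_le {p q σ : ℝ} (hp : 2 ≤ p) (hpq : p.HolderConjugate q) (hσ : |σ| ≤ 1)
    {u v : E → ℝ} (hu : Nice u) (hv : Nice v) (hu0 : ∀ x, 0 ≤ u x) (hv0 : ∀ x, 0 ≤ v x)
    (μ : Measure E) [IsProbabilityMeasure μ] :
    bellmanInt p q (avg μ u) (avg μ v) + σ * ∫ x, avg μ u x * avg μ v x
      ≤ bellmanInt p q u v + σ * ∫ x, u x * v x := by
  have hq : 1 < q := hpq.symm.lt
  set F : ℝ × ℝ → ℝ := fun w => bellman p q w + σ * (w.1 * w.2) with hF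
  have hFn : ∀ {a b : E → ℝ}, Nice a → Nice b → Nice fun x => F (a x, b x) := fun ha hb =>
    (ha.bellman hp hq hb).add ((ha.mul hb).const_mul σ)
  have hFi : ∀ {a b : E → ℝ}, Nice a → Nice b →
      ∫ x, F (a x, b x) = bellmanInt p q a b + σ * ∫ x, a x * b x := fun ha hb => by
    simp only [hF]
    rw [integral_add (ha.bellman hp hq hb).int ((ha.mul hb).const_mul σ).int, integral_const_mul]
    rfl
  rw [← hFi (hu.avg μ) (hv.avg μ), ← hFi hu hv, ← integral_avg (hFn hu hv) μ]
  refine integral_mono (hFn (hu.avg μ) (hv.avg μ)).int ((hFn hu hv).avg μ).int fun x => ?_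
  have hc : Continuous F := (continuous_bellman hp (by linarith)).add (by fun_prop)
  have := (convexOn_bellman hp hpq hσ).map_integral_le (μ := μ) (f := fun y => (u (x + y), v (x + y)))
    hc.continuousOn (isClosed_Ici.prod isClosed_Ici) (.of_forall fun y => ⟨hu0 _, hv0 _⟩)
    ((hu.translate_integrable μ x).prodMk (hv.translate_integrable μ x))
    ((hFn hu hv).translate_integrable μ x)
  rw [integral_pair (hu.translate_integrable μ x) (hv.translate_integrable μ x)] at this
  exact this

lemma bellmanInt_nonneg {p q : ℝ} (hp : 2 ≤ p) (hq : 1 < q) (u v : E → ℝ) :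
    0 ≤ bellmanInt p q u v := integral_nonneg fun _ => bellman_nonneg hp hq _

/-- The defect of the pairing is controlled by the decrease of the Bellman functional. -/
lemma abs_pairing_defect_le {p q : ℝ} (hp : 2 ≤ p) (hpq : p.HolderConjugate q)
    {u v : E → ℝ} (hu : Nice u) (hv : Nice v) (hu0 : ∀ x, 0 ≤ u x) (hv0 : ∀ x, 0 ≤ v x)
    (ν ρ : Measure E) [IsProbabilityMeasure ν] [IsProbabilityMeasure ρ] :
    |(∫ x, u x * v x) - ∫ x, avg ν u x * avg ν v x| ≤ bellmanInt p q u v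
      - bellmanInt p q (avg (ρ.conv ν) u) (avg (ρ.conv ν) v) := by
  have h1 := bellmanInt_avg_le (σ := 1) hp hpq (by simp) hu hv hu0 hv0 ν
  have h2 := bellmanInt_avg_le (σ := -1) hp hpq (by simp) hu hv hu0 hv0 ν
  have h3 := bellmanInt_avg_le (σ := 0) hp hpq (by simp) (hu.avg ν) (hv.avg ν)
    (avg_nonneg hu0 ν) (avg_nonneg hv0 ν) ρ
  rw [avg_avg hu, avg_avg hv] at h3
  rw [abs_le]
  constructor <;> linarith

end Averages

section Gaussians

open ProbabilityTheory

variable {E : Type*} [NormedAddCommGroup E] [InnerProductSpace ℝ E] [FiniteDimensional ℝ E]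
  [MeasurableSpace E] [BorelSpace E]

/-- The heat kernel measure with covariance `s • id`. -/
def heat (E : Type*) [NormedAddCommGroup E] [InnerProductSpace ℝ E] [FiniteDimensional ℝ E]
    [MeasurableSpace E] [BorelSpace E] (s : ℝ) : Measure E :=
  (stdGaussian E).map fun x => √s • x

/-- The Gaussian measure with covariance `s • (e ⊗ e)`. -/
def dirHeat (e : E) (s : ℝ) : Measure E := (gaussianReal 0 1).map fun y => (√s * y) • e

/-- The Gaussian measure with covariance `s • (id - e ⊗ e)`, for `‖e‖ ≤ 1`. -/
def coHeat (e : E) (s : ℝ) : Measure E :=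
  (stdGaussian E).map fun x =>
    √s • (x - ((1 + √(1 - ‖e‖ ^ 2))⁻¹ * inner ℝ e x) • e)

instance (s : ℝ) : IsProbabilityMeasure (heat E s) :=
  Measure.isProbabilityMeasure_map (by fun_prop)

instance (e : E) (s : ℝ) : IsProbabilityMeasure (dirHeat e s) :=
  Measure.isProbabilityMeasure_map (by fun_prop)

instance (e : E) (s : ℝ) : IsProbabilityMeasure (coHeat e s) :=
  Measure.isProbabilityMeasure_map (by fun_prop)

lemma charFun_map_of_adjoint {F : Type*} [NormedAddCommGroup F] [InnerProductSpace ℝ F]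
    [MeasurableSpace F] [BorelSpace F] (μ : Measure F) {L : F → E} {t : E} {t' : F}
    (hL : Continuous L) (h : ∀ x, inner ℝ (L x) t = inner ℝ x t') :
    charFun (μ.map L) t = charFun μ t' := by
  rw [charFun_apply, charFun_apply, integral_map hL.measurable.aemeasurable (by fun_prop)]
  simp_rw [h]

lemma charFun_heat {s : ℝ} (hs : 0 ≤ s) (t : E) :
    charFun (heat E s) t = Complex.exp (-(s * ‖t‖ ^ 2 / 2 : ℝ)) := by
  rw [heat, charFun_map_of_adjoint (t' := √s • t) _ (by fun_prop) (fun x => by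
    rw [real_inner_smul_left, real_inner_smul_right]), charFun_stdGaussian, norm_smul, norm_eq_abs,
    abs_of_nonneg (sqrt_nonneg s)]
  congr 1
  push_cast
  rw [mul_pow, ← Complex.ofReal_pow, sq_sqrt hs]
  ring

lemma charFun_dirHeat (e : E) {s : ℝ} (hs : 0 ≤ s) (t : E) :
    charFun (dirHeat e s) t = Complex.exp (-(s * inner ℝ e t ^ 2 / 2 : ℝ)) := by
  rw [dirHeat, charFun_map_of_adjoint (t' := √s * inner ℝ e t) _ (by fun_prop) (fun x => by
    rw [real_inner_smul_left]; simp; ring), charFun_gaussianReal]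
  congr 1
  push_cast
  rw [mul_pow, ← Complex.ofReal_pow, sq_sqrt hs]
  simp

lemma charFun_coHeat {e : E} (he : ‖e‖ ≤ 1) {s : ℝ} (hs : 0 ≤ s) (t : E) :
    charFun (coHeat e s) t = Complex.exp (-(s * (‖t‖ ^ 2 - inner ℝ e t ^ 2) / 2 : ℝ)) := by
  set c := (1 + √(1 - ‖e‖ ^ 2))⁻¹ with hc
  have he2 : 0 ≤ 1 - ‖e‖ ^ 2 := by nlinarith [norm_nonneg e]
  have hc2 : 2 * c - c ^ 2 * ‖e‖ ^ 2 = 1 := by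
    have h1 := sq_sqrt he2
    have h2 : 0 < 1 + √(1 - ‖e‖ ^ 2) := by positivity
    rw [hc]
    field_simp
    linear_combination -h1
  rw [coHeat, charFun_map_of_adjoint (t' := √s • (t - (c * inner ℝ e t) • e)) _ (by fun_prop)
    (fun x => by
      simp only [real_inner_smul_left, real_inner_smul_right, inner_sub_left, inner_sub_right,
        ← hc, real_inner_comm e x]; ring), charFun_stdGaussian, ← Complex.ofReal_pow]
  have hn := real_inner_self_eq_norm_sq (√s • (t - (c * inner ℝ e t) • e))
  simp only [real_inner_smul_left, real_inner_smul_right, inner_sub_left, inner_sub_right,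
    real_inner_comm e t, real_inner_self_eq_norm_sq e, real_inner_self_eq_norm_sq t] at hn
  rw [← Complex.ofReal_neg, ← Complex.ofReal_neg]
  norm_cast
  congr 2
  rw [← hn]
  have h3 := sq_sqrt hs
  linear_combination (-(‖t‖ ^ 2 - 2 * c * inner ℝ e t ^ 2 + c ^ 2 * inner ℝ e t ^ 2 * ‖e‖ ^ 2) / 2) * h3
    + s * (inner ℝ e t ^ 2) / 2 * hc2

lemma heat_conv_heat {s t : ℝ} (hs : 0 ≤ s) (ht : 0 ≤ t) :
    (heat E s).conv (heat E t) = heat E (s + t) := by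
  refine Measure.ext_of_charFun ?_
  ext x
  rw [charFun_conv, charFun_heat hs, charFun_heat ht, charFun_heat (add_nonneg hs ht),
    ← Complex.exp_add]
  congr 1; push_cast; ring

lemma dirHeat_conv_dirHeat (e : E) {s t : ℝ} (hs : 0 ≤ s) (ht : 0 ≤ t) :
    (dirHeat e s).conv (dirHeat e t) = dirHeat e (s + t) := by
  refine Measure.ext_of_charFun ?_
  ext x
  rw [charFun_conv, charFun_dirHeat e hs, charFun_dirHeat e ht,
    charFun_dirHeat e (add_nonneg hs ht), ← Complex.exp_add]
  congr 1; push_cast; ring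

lemma coHeat_conv_dirHeat {e : E} (he : ‖e‖ ≤ 1) {s : ℝ} (hs : 0 ≤ s) :
    (coHeat e s).conv (dirHeat e s) = heat E s := by
  refine Measure.ext_of_charFun ?_
  ext x
  rw [charFun_conv, charFun_dirHeat e hs, charFun_coHeat he hs, charFun_heat hs,
    ← Complex.exp_add]
  congr 1; push_cast; ring

lemma heat_zero : heat E 0 = Measure.dirac 0 := by
  simp [heat, Measure.map_const]

lemma isNegInvariant_of_charFun {μ : Measure E} [IsProbabilityMeasure μ]
    (h : ∀ t, charFun μ (-t) = charFun μ t) : μ.IsNegInvariant := by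
  refine ⟨?_⟩
  have : IsProbabilityMeasure μ.neg := Measure.isProbabilityMeasure_map (by fun_prop)
  refine Measure.ext_of_charFun ?_
  ext t
  rw [← h t, Measure.neg, charFun_map_of_adjoint (t' := -t) _ continuous_neg (fun x => by simp)]

lemma isNegInvariant_heat {s : ℝ} (hs : 0 ≤ s) : (heat E s).IsNegInvariant :=
  isNegInvariant_of_charFun fun t => by rw [charFun_heat hs, charFun_heat hs, norm_neg]

lemma isNegInvariant_dirHeat (e : E) {s : ℝ} (hs : 0 ≤ s) : (dirHeat e s).IsNegInvariant :=
  isNegInvariant_of_charFun fun t => by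
    rw [charFun_dirHeat e hs, charFun_dirHeat e hs, inner_neg_right, neg_sq]

lemma avg_heat_zero (u : E → ℝ) : avg (heat E 0) u = u := by
  ext x; simp [avg, heat_zero]

/-- The discretised heat-flow bilinear form. -/
def heatSum (e : E) (h : ℝ) (n : ℕ) (u v : E → ℝ) : ℝ :=
  ∑ k ∈ Finset.range n,
    ∫ x, avg (heat E (2 * (k * h))) (fun x => u x - avg (dirHeat e (2 * h)) u x) x * v x

lemma heatSum_term {e : E} {h : ℝ} (hh : 0 ≤ h) (k : ℕ) {u v : E → ℝ} (hu : Nice u)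
    (hv : Nice v) :
    ∫ x, avg (heat E (2 * (k * h))) (fun x => u x - avg (dirHeat e (2 * h)) u x) x * v x =
      (∫ x, avg (heat E (k * h)) u x * avg (heat E (k * h)) v x)
        - ∫ x, avg (dirHeat e h) (avg (heat E (k * h)) u) x *
            avg (dirHeat e h) (avg (heat E (k * h)) v) x := by
  have hk : 0 ≤ k * h := by positivity
  have := isNegInvariant_heat (E := E) hk
  have := isNegInvariant_dirHeat e hh
  set P := heat E (k * h) with hP
  have hPP : heat E (2 * (k * h)) = P.conv P := by rw [hP, heat_conv_heat hk hk]; ring_nf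
  have hνν : dirHeat e (2 * h) = (dirHeat e h).conv (dirHeat e h) := by
    rw [dirHeat_conv_dirHeat e hh hh]; ring_nf
  have e1 : ∫ x, avg P u x * avg P v x = ∫ x, avg (P.conv P) u x * v x := by
    rw [← integral_avg_mul (hu.avg P) hv P, avg_avg hu]
  have e2 : ∫ x, avg (dirHeat e h) (avg P u) x * avg (dirHeat e h) (avg P v) x
      = ∫ x, avg (P.conv P) (avg (dirHeat e (2 * h)) u) x * v x := by
    rw [← integral_avg_mul ((hu.avg P).avg _) (hv.avg P), ← integral_avg_mul
      (((hu.avg P).avg _).avg _) hv, avg_avg (hu.avg P), ← hνν, avg_comm hu,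
      avg_avg (hu.avg _)]
  rw [e1, e2, hPP, avg_sub hu (hu.avg _), ← integral_sub (((hu.avg _).mul hv).int)
    (((hu.avg _).avg _).mul hv).int]
  simp only [sub_mul]

lemma abs_heatSum_le_bellmanInt {p q : ℝ} (hp : 2 ≤ p) (hpq : p.HolderConjugate q) {e : E}
    (he : ‖e‖ ≤ 1) {h : ℝ} (hh : 0 ≤ h) (n : ℕ) {u v : E → ℝ} (hu : Nice u) (hv : Nice v)
    (hu0 : ∀ x, 0 ≤ u x) (hv0 : ∀ x, 0 ≤ v x) :
    |heatSum e h n u v| ≤ bellmanInt p q u v := by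
  set b : ℕ → ℝ := fun k => bellmanInt p q (avg (heat E (k * h)) u) (avg (heat E (k * h)) v) with hb
  have hstep : ∀ k : ℕ, |∫ x, avg (heat E (2 * (k * h)))
      (fun x => u x - avg (dirHeat e (2 * h)) u x) x * v x| ≤ b k - b (k + 1) := fun k => by
    have hk : 0 ≤ k * h := by positivity
    rw [heatSum_term hh k hu hv]
    have := abs_pairing_defect_le hp hpq (hu.avg (heat E (k * h))) (hv.avg (heat E (k * h)))
      (avg_nonneg hu0 _) (avg_nonneg hv0 _) (dirHeat e h) (coHeat e h)
    rw [coHeat_conv_dirHeat he hh, avg_avg hu (heat E h), avg_avg hv (heat E h), heat_conv_heat hh hk,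
      show h + k * h = ((k + 1 : ℕ) : ℝ) * h by push_cast; ring] at this
    exact this
  calc |heatSum e h n u v| ≤ ∑ k ∈ Finset.range n, (b k - b (k + 1)) :=
        (Finset.abs_sum_le_sum_abs _ _).trans (Finset.sum_le_sum fun k _ => hstep k)
    _ = b 0 - b n := Finset.sum_range_sub' b n
    _ ≤ b 0 := sub_le_self _ (bellmanInt_nonneg hp hpq.symm.lt _ _)
    _ = bellmanInt p q u v := by simp [hb, avg_heat_zero]

lemma heatSum_symm {e : E} {h : ℝ} (hh : 0 ≤ h) (n : ℕ) {u v : E → ℝ} (hu : Nice u)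
    (hv : Nice v) : heatSum e h n u v = heatSum e h n v u := by
  unfold heatSum
  refine Finset.sum_congr rfl fun k _ => ?_
  rw [heatSum_term hh k hu hv, heatSum_term hh k hv hu]
  simp only [mul_comm]

lemma heatSum_sub_left {e : E} {h : ℝ} (n : ℕ) {u u' v : E → ℝ} (hu : Nice u)
    (hu' : Nice u') (hv : Nice v) :
    heatSum e h n (fun x => u x - u' x) v = heatSum e h n u v - heatSum e h n u' v := by
  unfold heatSum
  rw [← Finset.sum_sub_distrib]
  refine Finset.sum_congr rfl fun k _ => ?_
  have h1 := hu.sub (hu.avg (dirHeat e (2 * h)))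
  have h2 := hu'.sub (hu'.avg (dirHeat e (2 * h)))
  rw [← integral_sub ((h1.avg _).mul hv).int ((h2.avg _).mul hv).int, avg_sub hu hu']
  congr 1
  ext x
  rw [← sub_mul, show (fun x => u x - u' x - (avg (dirHeat e (2 * h)) u x
    - avg (dirHeat e (2 * h)) u' x)) = fun x => (u x - avg (dirHeat e (2 * h)) u x)
      - (u' x - avg (dirHeat e (2 * h)) u' x) by ext; ring, avg_sub h1 h2]

lemma bellmanInt_le {p q : ℝ} (hp : 2 ≤ p) (hpq : p.HolderConjugate q) {u v a b : E → ℝ}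
    (ha : Nice a) (hb : Nice b) (hu : Nice u) (hv : Nice v) (hua : ∀ x, |u x| ≤ |a x|)
    (hvb : ∀ x, |v x| ≤ |b x|) :
    bellmanInt p q u v ≤ (10 * p + 1 / (q * (q - 1)) + 1) *
      ((∫ x, |a x| ^ p) + ∫ x, |b x| ^ q) := by
  have hq := hpq.symm.lt
  have hq' : 0 < q - 1 := by linarith
  have i1 := ha.abs_rpow (p := p) (by linarith)
  have i2 := hb.abs_rpow (p := q) (by linarith)
  rw [← integral_add i1.int i2.int, ← integral_const_mul]
  refine integral_mono (hu.bellman hp hq hv).int ((i1.add i2).const_mul _).int fun x => ?_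
  refine (bellman_le hp _).trans ?_
  have h1 : |u x| ^ p ≤ |a x| ^ p := rpow_le_rpow (abs_nonneg _) (hua x) (by linarith)
  have h2 : |v x| ^ q ≤ |b x| ^ q := rpow_le_rpow (abs_nonneg _) (hvb x) (by linarith)
  simp only
  gcongr

lemma abs_heatSum_le_of_two_le {p q : ℝ} (hp : 2 ≤ p) (hpq : p.HolderConjugate q) {e : E}
    (he : ‖e‖ ≤ 1) {h : ℝ} (hh : 0 ≤ h) (n : ℕ) {u v : E → ℝ} (hu : Nice u) (hv : Nice v) :
    |heatSum e h n u v| ≤ 4 * (10 * p + 1 / (q * (q - 1)) + 1) *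
      ((∫ x, |u x| ^ p) + ∫ x, |v x| ^ q) := by
  have dec : ∀ w : E → ℝ, w = fun x => max (w x) 0 - max (-w x) 0 := fun w => by
    ext x; exact (max_zero_sub_eq_self (w x)).symm
  have hpos : ∀ (w : E → ℝ) x, |max (w x) 0| ≤ |w x| := fun w x => by
    simpa using (abs_max_le_max_abs_abs (a := w x) (b := 0))
  have hneg : ∀ (w : E → ℝ) x, |max (-w x) 0| ≤ |w x| := fun w x => by
    simpa using (abs_max_le_max_abs_abs (a := -w x) (b := 0))
  set B := (10 * p + 1 / (q * (q - 1)) + 1) * ((∫ x, |u x| ^ p) + ∫ x, |v x| ^ q) with hB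
  have key : ∀ a b : E → ℝ, Nice a → Nice b → (∀ x, 0 ≤ a x) → (∀ x, 0 ≤ b x) →
      (∀ x, |a x| ≤ |u x|) → (∀ x, |b x| ≤ |v x|) → |heatSum e h n a b| ≤ B :=
    fun a b ha hb ha0 hb0 hau hbv => (abs_heatSum_le_bellmanInt hp hpq he hh n ha hb ha0 hb0).trans
      (bellmanInt_le hp hpq hu hv ha hb hau hbv)
  have hleft : ∀ b : E → ℝ, Nice b → (∀ x, 0 ≤ b x) → (∀ x, |b x| ≤ |v x|) →
      |heatSum e h n u b| ≤ 2 * B := fun b hb hb0 hbv => by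
    rw [dec u, heatSum_sub_left n hu.posPart hu.negPart hb]
    have h1 := key _ b hu.posPart hb (fun x => le_max_right _ _) hb0 (hpos u) hbv
    have h2 := key _ b hu.negPart hb (fun x => le_max_right _ _) hb0 (hneg u) hbv
    linarith [abs_sub (heatSum e h n (fun x => max (u x) 0) b)
      (heatSum e h n (fun x => max (-u x) 0) b)]
  have h1 := hleft _ hv.posPart (fun x => le_max_right _ _) (hpos v)
  have h2 := hleft _ hv.negPart (fun x => le_max_right _ _) (hneg v)
  have h3 : heatSum e h n u v = heatSum e h n u (fun x => max (v x) 0)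
      - heatSum e h n u (fun x => max (-v x) 0) := by
    rw [heatSum_symm hh n hu hv, heatSum_symm hh n hu hv.posPart, heatSum_symm hh n hu hv.negPart,
      ← heatSum_sub_left n hv.posPart hv.negPart hu, ← dec v]
  rw [h3, mul_assoc, ← hB]
  linarith [abs_sub (heatSum e h n u (fun x => max (v x) 0))
      (heatSum e h n u (fun x => max (-v x) 0))]

/-- The dimension-free bound for the discretised heat-flow form. -/
lemma exists_abs_heatSum_le {p q : ℝ} (hpq : p.HolderConjugate q) :
    ∃ C, 0 < C ∧ ∀ {E : Type} [NormedAddCommGroup E] [InnerProductSpace ℝ E]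
      [FiniteDimensional ℝ E] [MeasurableSpace E] [BorelSpace E] {e : E}, ‖e‖ ≤ 1 → ∀ {h : ℝ},
      0 ≤ h → ∀ (n : ℕ) {u v : E → ℝ}, Nice u → Nice v →
      |heatSum e h n u v| ≤ C * ((∫ x, |u x| ^ p) + ∫ x, |v x| ^ q) := by
  have hp1 := hpq.lt
  have hq1 := hpq.symm.lt
  have hp1' : 0 < p - 1 := by linarith
  have hq1' : 0 < q - 1 := by linarith
  rcases le_total 2 p with hp | hp
  · refine ⟨4 * (10 * p + 1 / (q * (q - 1)) + 1), by positivity, ?_⟩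
    intro E _ _ _ _ _ e he h hh n u v hu hv
    exact abs_heatSum_le_of_two_le hp hpq he hh n hu hv
  · have hq : 2 ≤ q := by
      have := hpq.mul_eq_add
      nlinarith
    refine ⟨4 * (10 * q + 1 / (p * (p - 1)) + 1), by positivity, ?_⟩
    intro E _ _ _ _ _ e he h hh n u v hu hv
    rw [heatSum_symm hh n hu hv, add_comm (∫ x, |u x| ^ p)]
    exact abs_heatSum_le_of_two_le hq hpq.symm he hh n hv hu

end Gaussians

section HeatLimit

open ProbabilityTheory

variable {E : Type*} [NormedAddCommGroup E] [InnerProductSpace ℝ E] [FiniteDimensional ℝ E]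
  [MeasurableSpace E] [BorelSpace E]

lemma integrable_abs_pow_gaussianReal (n : ℕ) (hn : n ≠ 0) :
    Integrable (fun y : ℝ => |y| ^ n) (gaussianReal 0 1) :=
  (memLp_id_gaussianReal (μ := 0) (v := 1) (n : NNReal)).integrable_norm_pow hn

lemma integral_sq_gaussianReal : ∫ y, y ^ 2 ∂(gaussianReal 0 1) = 1 := by
  have h := variance_eq_sub (memLp_id_gaussianReal (μ := 0) (v := 1) 2)
  simpa [variance_id_gaussianReal] using h.symm

/-- Second order Taylor expansion, integrated against a one-dimensional Gaussian. -/
lemma abs_sub_avg_dirHeat_le {e : E} {Φ χ θ : E → ℝ} {K : ℝ} (hΦ : Nice Φ)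
    (hT : ∀ x t, |Φ (x + t • e) - Φ x - t * θ x - t ^ 2 / 2 * χ x| ≤ K * |t| ^ 3)
    {s : ℝ} (hs : 0 ≤ s) (x : E) :
    |Φ x - avg (dirHeat e s) Φ x + s / 2 * χ x|
      ≤ (K * ∫ y, |y| ^ 3 ∂(gaussianReal 0 1)) * √s ^ 3 := by
  have hm : Measurable fun y : ℝ => (√s * y) • e := by fun_prop
  have e1 : avg (dirHeat e s) Φ x = ∫ y, Φ (x + (√s * y) • e) ∂(gaussianReal 0 1) := by
    unfold avg dirHeat
    exact integral_map hm.aemeasurable (hΦ.meas.comp (measurable_const_add x)).aestronglyMeasurable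
  have i1 : Integrable (fun y => Φ (x + (√s * y) • e)) (gaussianReal 0 1) := by
    obtain ⟨M, hM⟩ := hΦ.bdd
    exact Integrable.of_bound (hΦ.meas.comp ((measurable_const_add x).comp hm)).aestronglyMeasurable
      M (.of_forall fun y => hM _)
  have i2 : Integrable (fun y : ℝ => y) (gaussianReal 0 1) :=
    (memLp_id_gaussianReal 1).integrable (by simp)
  have i3 : Integrable (fun y : ℝ => y ^ 2) (gaussianReal 0 1) := by
    simpa using integrable_abs_pow_gaussianReal 2 (by norm_num)
  have i4 := integrable_abs_pow_gaussianReal 3 (by norm_num)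
  have e2 : ∫ y, (Φ (x + (√s * y) • e) - Φ x - (√s * θ x) * y - (s / 2 * χ x) * y ^ 2)
      ∂(gaussianReal 0 1) = avg (dirHeat e s) Φ x - Φ x - s / 2 * χ x := by
    rw [integral_sub, integral_sub, integral_sub, ← e1, integral_const_mul, integral_const_mul,
      integral_id_gaussianReal, integral_sq_gaussianReal]
    · simp
    · exact i1
    · exact integrable_const _
    · exact i1.sub (integrable_const _)
    · exact i2.const_mul _
    · exact (i1.sub (integrable_const _)).sub (i2.const_mul _)
    · exact i3.const_mul _
  have e3 : Φ x - avg (dirHeat e s) Φ x + s / 2 * χ x =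
      -∫ y, (Φ (x + (√s * y) • e) - Φ x - (√s * θ x) * y - (s / 2 * χ x) * y ^ 2)
      ∂(gaussianReal 0 1) := by rw [e2]; ring
  rw [e3, abs_neg, mul_right_comm, ← integral_const_mul]
  rw [← norm_eq_abs]
  refine norm_integral_le_of_norm_le (i4.const_mul _) (.of_forall fun y => ?_)
  have := hT x (√s * y)
  rw [abs_mul, abs_of_nonneg (sqrt_nonneg s), mul_pow, mul_pow, sq_sqrt hs] at this
  rw [norm_eq_abs]
  convert this using 1
  · congr 1; ring
  · ring

lemma abs_avg_heat_sub_le {χ : E → ℝ} {L : ℝ} (hχ : Nice χ)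
    (hL : ∀ x y, |χ x - χ y| ≤ L * ‖x - y‖) (s : ℝ) (x : E) :
    |avg (heat E s) χ x - χ x| ≤ (L * ∫ y, ‖y‖ ∂(stdGaussian E)) * √s := by
  have hm : Measurable fun y : E => √s • y := by fun_prop
  have e1 : avg (heat E s) χ x = ∫ y, χ (x + √s • y) ∂(stdGaussian E) := by
    unfold avg heat
    exact integral_map hm.aemeasurable (hχ.meas.comp (measurable_const_add x)).aestronglyMeasurable
  have i1 : Integrable (fun y => χ (x + √s • y)) (stdGaussian E) := by
    obtain ⟨M, hM⟩ := hχ.bdd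
    exact Integrable.of_bound (hχ.meas.comp ((measurable_const_add x).comp hm)).aestronglyMeasurable
      M (.of_forall fun y => hM _)
  have i2 : Integrable (fun y : E => ‖y‖) (stdGaussian E) :=
    (IsGaussian.integrable_id (μ := stdGaussian E)).norm
  have e2 : avg (heat E s) χ x - χ x = ∫ y, (χ (x + √s • y) - χ x) ∂(stdGaussian E) := by
    rw [integral_sub i1 (integrable_const _), e1]; simp
  rw [e2, mul_right_comm, ← integral_const_mul]
  rw [← norm_eq_abs]
  refine norm_integral_le_of_norm_le (i2.const_mul _) (.of_forall fun y => ?_)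
  have := hL (x + √s • y) x
  rw [add_sub_cancel_left, norm_smul, norm_eq_abs, abs_of_nonneg (sqrt_nonneg s)] at this
  rw [norm_eq_abs, mul_assoc]
  exact this

/-- The heat-flow pairing of two functions. -/
def heatPair (χ Ψ : E → ℝ) (s : ℝ) : ℝ := ∫ x, avg (heat E s) χ x * Ψ x

lemma abs_integral_mul_le {a Ψ : E → ℝ} {M : ℝ} (hΨ : Nice Ψ) (hM : ∀ x, |a x| ≤ M) :
    |∫ x, a x * Ψ x| ≤ M * ∫ x, |Ψ x| := by
  rw [← integral_const_mul]
  rw [← norm_eq_abs]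
  refine norm_integral_le_of_norm_le (hΨ.int.abs.const_mul _) (.of_forall fun x => ?_)
  rw [norm_eq_abs, abs_mul]
  exact mul_le_mul_of_nonneg_right (hM x) (abs_nonneg _)

lemma abs_heatPair_sub_le {χ Ψ : E → ℝ} {L : ℝ} (hχ : Nice χ) (hΨ : Nice Ψ)
    (hL : ∀ x y, |χ x - χ y| ≤ L * ‖x - y‖) {s t : ℝ} (hs : 0 ≤ s) (hst : s ≤ t) :
    |heatPair χ Ψ t - heatPair χ Ψ s|
      ≤ ((L * ∫ y, ‖y‖ ∂(stdGaussian E)) * ∫ x, |Ψ x|) * √(t - s) := by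
  have e1 : heat E t = (heat E s).conv (heat E (t - s)) := by
    rw [heat_conv_heat hs (sub_nonneg.2 hst)]; ring_nf
  unfold heatPair
  rw [← integral_sub ((hχ.avg _).mul hΨ).int ((hχ.avg _).mul hΨ).int, e1, ← avg_avg hχ]
  simp_rw [← sub_mul]
  rw [mul_right_comm]
  refine abs_integral_mul_le hΨ fun x => ?_
  have h2 := congrFun (avg_sub (hχ.avg (heat E (t - s))) hχ (heat E s)) x
  rw [← h2]
  exact abs_avg_le (abs_avg_heat_sub_le hχ hL (t - s)) _ x

lemma continuousOn_heatPair {χ Ψ : E → ℝ} {L : ℝ} (hχ : Nice χ) (hΨ : Nice Ψ)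
    (hL : ∀ x y, |χ x - χ y| ≤ L * ‖x - y‖) : ContinuousOn (heatPair χ Ψ) (Ici 0) := by
  set M := (L * ∫ y, ‖y‖ ∂(stdGaussian E)) * ∫ x, |Ψ x|
  have key : ∀ s ∈ Ici (0:ℝ), ∀ t ∈ Ici (0:ℝ),
      |heatPair χ Ψ t - heatPair χ Ψ s| ≤ M * √|t - s| := fun s hs t ht => by
    rcases le_total s t with h | h
    · rw [abs_of_nonneg (sub_nonneg.2 h)]; exact abs_heatPair_sub_le hχ hΨ hL hs h
    · rw [abs_sub_comm, abs_sub_comm t, abs_of_nonneg (sub_nonneg.2 h)]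
      exact abs_heatPair_sub_le hχ hΨ hL ht h
  intro s hs
  have h0 : Filter.Tendsto (fun t => M * √|t - s|) (nhdsWithin s (Ici 0)) (nhds 0) := by
    have : Continuous fun t => M * √|t - s| := by fun_prop
    simpa using (this.tendsto s).mono_left (nhdsWithin_le_nhds (s := Ici 0))
  refine tendsto_iff_dist_tendsto_zero.2 (squeeze_zero' (.of_forall fun _ => dist_nonneg) ?_ h0)
  filter_upwards [self_mem_nhdsWithin] with t ht
  exact key s hs t ht

/-- The discretised form differs little from the integral of the heat-flow pairing. -/
lemma abs_heatSum_add_integral_le {e : E} {Φ χ θ Ψ : E → ℝ} {K L : ℝ} (hΦ : Nice Φ)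
    (hχ : Nice χ) (hΨ : Nice Ψ)
    (hT : ∀ x t, |Φ (x + t • e) - Φ x - t * θ x - t ^ 2 / 2 * χ x| ≤ K * |t| ^ 3)
    (hL : ∀ x y, |χ x - χ y| ≤ L * ‖x - y‖) {h : ℝ} (hh : 0 ≤ h) (n : ℕ) :
    |heatSum e h n Φ Ψ + 1 / 2 * ∫ s in (0:ℝ)..(2 * (n * h)), heatPair χ Ψ s| ≤
      n * h * (2 * (K * ∫ y, |y| ^ 3 ∂(gaussianReal 0 1)) * (∫ x, |Ψ x|)
        + (L * ∫ y, ‖y‖ ∂(stdGaussian E)) * ∫ x, |Ψ x|) * √(2 * h) := by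
  set K' := K * ∫ y, |y| ^ 3 ∂(gaussianReal 0 1)
  set L' := L * ∫ y, ‖y‖ ∂(stdGaussian E)
  set N := ∫ x, |Ψ x|
  have hcont := continuousOn_heatPair hχ hΨ hL
  have hint : ∀ a b : ℝ, 0 ≤ a → 0 ≤ b → IntervalIntegrable (heatPair χ Ψ) volume a b :=
    fun a b ha hb => (hcont.mono fun x hx => (le_min ha hb).trans hx.1).intervalIntegrable
  have hsum : ∑ k ∈ Finset.range n, ∫ s in (2 * (k * h))..(2 * ((k + 1 : ℕ) * h)), heatPair χ Ψ s
      = ∫ s in (0:ℝ)..(2 * (n * h)), heatPair χ Ψ s := by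
    have := intervalIntegral.sum_integral_adjacent_intervals (f := heatPair χ Ψ) (μ := volume)
      (a := fun k : ℕ => 2 * (k * h)) (n := n)
      fun k _ => hint _ _ (by positivity) (by positivity)
    simpa using this
  rw [← hsum, heatSum, Finset.mul_sum, ← Finset.sum_add_distrib]
  have hterm : ∀ k ∈ Finset.range n,
      |(∫ x, avg (heat E (2 * (k * h))) (fun x => Φ x - avg (dirHeat e (2 * h)) Φ x) x * Ψ x)
        + 1 / 2 * ∫ s in (2 * (k * h))..(2 * ((k + 1 : ℕ) * h)), heatPair χ Ψ s| ≤
      h * (2 * K' * N + L' * N) * √(2 * h) := fun k _ => by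
    have hk : 0 ≤ 2 * (k * h) := by positivity
    have hR := hΦ.sub (hΦ.avg (dirHeat e (2 * h)))
    have hR' := hR.add (hχ.const_mul h)
    set P := heat E (2 * (k * h))
    have d1 : ∫ x, avg P (fun x => Φ x - avg (dirHeat e (2 * h)) Φ x) x * Ψ x =
        (∫ x, avg P (fun x => Φ x - avg (dirHeat e (2 * h)) Φ x + h * χ x) x * Ψ x)
          - h * heatPair χ Ψ (2 * (k * h)) := by
      rw [heatPair, ← integral_const_mul, ← integral_sub ((hR'.avg P).mul hΨ).int
        (((hχ.avg P).mul hΨ).const_mul h).int]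
      congr 1; ext x
      rw [← mul_assoc, ← sub_mul]
      congr 1
      have a1 := congrFun (avg_sub hR' (hχ.const_mul h) P) x
      have a2 : avg P (fun x => h * χ x) x = h * avg P χ x := by simp [avg, integral_const_mul]
      simp only [add_sub_cancel_right, a2] at a1
      exact a1
    have d2 : |∫ x, avg P (fun x => Φ x - avg (dirHeat e (2 * h)) Φ x + h * χ x) x * Ψ x|
        ≤ (K' * √(2 * h) ^ 3) * N := by
      refine abs_integral_mul_le hΨ fun x => abs_avg_le (fun x => ?_) _ _
      have := abs_sub_avg_dirHeat_le hΦ hT (show 0 ≤ 2 * h by positivity) x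
      rwa [mul_div_cancel_left₀ _ (two_ne_zero)] at this
    have d3 : |(∫ s in (2 * (k * h))..(2 * ((k + 1 : ℕ) * h)), heatPair χ Ψ s)
        - 2 * h * heatPair χ Ψ (2 * (k * h))| ≤ (L' * N * √(2 * h)) * (2 * h) := by
      have b1 : 2 * ((k + 1 : ℕ) * h) - 2 * (k * h) = 2 * h := by push_cast; ring
      have b2 : 2 * (k * h) ≤ 2 * ((k + 1 : ℕ) * h) := by linarith
      have b3 : (∫ s in (2 * (k * h))..(2 * ((k + 1 : ℕ) * h)), heatPair χ Ψ s)
        - 2 * h * heatPair χ Ψ (2 * (k * h)) = ∫ s in (2 * (k * h))..(2 * ((k + 1 : ℕ) * h)),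
          (heatPair χ Ψ s - heatPair χ Ψ (2 * (k * h))) := by
        rw [intervalIntegral.integral_sub (hint _ _ (by positivity) (by positivity))
          intervalIntegrable_const, intervalIntegral.integral_const, b1, smul_eq_mul]
      rw [b3]
      have := intervalIntegral.norm_integral_le_of_norm_le_const (a := 2 * (k * h))
        (b := 2 * ((k + 1 : ℕ) * h)) (C := L' * N * √(2 * h))
        (f := fun s => heatPair χ Ψ s - heatPair χ Ψ (2 * (k * h))) fun s hs => by
          rw [uIoc_of_le b2] at hs
          refine (abs_heatPair_sub_le hχ hΨ hL hk hs.1.le).trans ?_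
          have hLN : 0 ≤ L' * N := by
            have h1 := abs_heatPair_sub_le hχ hΨ hL (le_refl 0) zero_le_one
            rw [sub_zero, sqrt_one, mul_one] at h1
            exact (abs_nonneg _).trans h1
          exact mul_le_mul_of_nonneg_left (sqrt_le_sqrt (by linarith [hs.2])) hLN
      rwa [b1, abs_of_nonneg (by positivity : 0 ≤ 2 * h)] at this
    have h3 : √(2 * h) ^ 3 = 2 * h * √(2 * h) := by
      rw [pow_succ, sq_sqrt (by positivity)]
    rw [d1]
    rw [h3] at d2
    rw [abs_le] at d2 d3 ⊢
    constructor <;> linarith [d2.1, d2.2, d3.1, d3.2]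
  calc _ ≤ ∑ k ∈ Finset.range n, h * (2 * K' * N + L' * N) * √(2 * h) :=
        (Finset.abs_sum_le_sum_abs _ _).trans (Finset.sum_le_sum hterm)
    _ = _ := by rw [Finset.sum_const, Finset.card_range, nsmul_eq_mul]; ring

/-- Bound for the integrated heat-flow pairing with a second directional derivative. -/
lemma exists_abs_integral_heatPair_le {p q : ℝ} (hpq : p.HolderConjugate q) :
    ∃ C, 0 < C ∧ ∀ {E : Type} [NormedAddCommGroup E] [InnerProductSpace ℝ E]
      [FiniteDimensional ℝ E] [MeasurableSpace E] [BorelSpace E] {e : E}, ‖e‖ ≤ 1 →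
      ∀ {Φ χ θ Ψ : E → ℝ} {K L : ℝ}, Nice Φ → Nice χ → Nice Ψ →
      (∀ x t, |Φ (x + t • e) - Φ x - t * θ x - t ^ 2 / 2 * χ x| ≤ K * |t| ^ 3) →
      (∀ x y, |χ x - χ y| ≤ L * ‖x - y‖) → ∀ {T : ℝ}, 0 ≤ T →
      |∫ s in (0:ℝ)..T, heatPair χ Ψ s| ≤ C * ((∫ x, |Φ x| ^ p) + ∫ x, |Ψ x| ^ q) := by
  obtain ⟨C, hC0, hC⟩ := exists_abs_heatSum_le hpq
  refine ⟨2 * C, by positivity, ?_⟩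
  intro E _ _ _ _ _ e he Φ χ θ Ψ K L hΦ hχ hΨ hT hL T hT0
  set B := (∫ x, |Φ x| ^ p) + ∫ x, |Ψ x| ^ q
  set M := 2 * (K * ∫ y, |y| ^ 3 ∂(gaussianReal 0 1)) * (∫ x, |Ψ x|)
        + (L * ∫ y, ‖y‖ ∂(stdGaussian E)) * ∫ x, |Ψ x|
  have hn : ∀ n : ℕ, |∫ s in (0:ℝ)..T, heatPair χ Ψ s| ≤
      2 * C * B + T * M * √(T / ((n : ℝ) + 1)) := fun n => by
    have hh : 0 ≤ T / 2 / ((n : ℝ) + 1) := by positivity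
    have h1 := abs_heatSum_add_integral_le hΦ hχ hΨ hT hL hh (n + 1)
    have h2 := hC he hh (n + 1) hΦ hΨ
    have h3 : ((n + 1 : ℕ) : ℝ) * (T / 2 / ((n : ℝ) + 1)) = T / 2 := by
      push_cast; field_simp
    rw [h3, show 2 * (T / 2) = T by ring, show 2 * (T / 2 / ((n : ℝ) + 1)) = T / ((n : ℝ) + 1) by
      field_simp] at h1
    rw [abs_le] at h1 h2 ⊢
    constructor <;> linarith [h1.1, h1.2, h2.1, h2.2]
  have hlim : Filter.Tendsto (fun n : ℕ => 2 * C * B + T * M * √(T / ((n : ℝ) + 1)))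
      Filter.atTop (nhds (2 * C * B + T * M * √0)) := by
    refine Filter.Tendsto.const_add _ (Filter.Tendsto.const_mul _ (Filter.Tendsto.sqrt ?_))
    have := (tendsto_one_div_add_atTop_nhds_zero_nat (𝕜 := ℝ)).const_mul T
    simpa [div_eq_mul_inv] using this
  have := ge_of_tendsto' hlim hn
  simpa using this

end HeatLimit

section Newton

open ProbabilityTheory

variable {E : Type*} [NormedAddCommGroup E] [InnerProductSpace ℝ E] [FiniteDimensional ℝ E]
  [MeasurableSpace E] [BorelSpace E]

/-- The three-dimensional heat kernel profile. -/
def heatKer (s r : ℝ) : ℝ := ((2 * π * s) ^ (3 / 2 : ℝ))⁻¹ * exp (-(r ^ 2 / (2 * s)))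

lemma measurable_heatKer : Measurable fun z : ℝ × ℝ => heatKer z.1 z.2 := by
  unfold heatKer
  fun_prop

lemma heatKer_nonneg {s : ℝ} (hs : 0 ≤ s) (r : ℝ) : 0 ≤ heatKer s r := by
  unfold heatKer; positivity

lemma heatKer_le {s : ℝ} (hs : 0 < s) (r : ℝ) : heatKer s r ≤ ((2 * π * s) ^ (3 / 2 : ℝ))⁻¹ := by
  unfold heatKer
  refine mul_le_of_le_one_right (by positivity) (exp_le_one_iff.2 ?_)
  rw [neg_nonpos]; positivity

lemma integral_heatKer {r : ℝ} (hr : 0 < r) : ∫ s in Ioi (0:ℝ), heatKer s r = 1 / (2 * π * r) := by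
  have h := integral_comp_rpow_Ioi (fun s => heatKer s r) (p := -2) (by norm_num)
  rw [← h]
  have e : ∀ x ∈ Ioi (0:ℝ), (|(-2:ℝ)| * x ^ ((-2:ℝ) - 1)) • heatKer (x ^ (-2:ℝ)) r
      = (2 * ((2 * π) ^ (3 / 2 : ℝ))⁻¹) * exp (-(r ^ 2 / 2) * x ^ 2) := fun x hx => by
    have hx : 0 < x := hx
    have h1 : (2 * π * x ^ (-2:ℝ)) ^ (3 / 2 : ℝ) = (2 * π) ^ (3 / 2 : ℝ) * x ^ (-3:ℝ) := by
      rw [mul_rpow (by positivity) (by positivity), ← rpow_mul hx.le]; norm_num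
    have h2 : x ^ (-2:ℝ) = (x ^ 2)⁻¹ := by rw [rpow_neg hx.le, rpow_two]
    have h3 : (x ^ (-3:ℝ)) ≠ 0 := (rpow_pos_of_pos hx _).ne'
    rw [heatKer, h1, h2, show (-2:ℝ) - 1 = -3 by norm_num, smul_eq_mul, mul_inv,
      show -(r ^ 2 / (2 * (x ^ 2)⁻¹)) = -(r ^ 2 / 2) * x ^ 2 by field_simp]
    have h4 : x ^ (-3:ℝ) * (x ^ (-3:ℝ))⁻¹ = 1 := mul_inv_cancel₀ h3
    rw [abs_of_neg (by norm_num : (-2:ℝ) < 0)]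
    linear_combination (2 * ((2 * π) ^ (3 / 2 : ℝ))⁻¹ * exp (-(r ^ 2 / 2) * x ^ 2)) * h4
  rw [setIntegral_congr_fun measurableSet_Ioi e, integral_const_mul, integral_gaussian_Ioi,
    show (3 / 2 : ℝ) = 1 + 1 / 2 by norm_num, rpow_add (by positivity), rpow_one, ← sqrt_eq_rpow,
    show π / (r ^ 2 / 2) = (2 * π) / r ^ 2 by field_simp, sqrt_div (by positivity), sqrt_sq hr.le]
  have : √(2 * π) ≠ 0 := by positivity
  field_simp

lemma heat_eq_withDensity (hE : Module.finrank ℝ E = 3) {s : ℝ} (hs : 0 < s) :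
    heat E s = (volume : Measure E).withDensity fun x => ENNReal.ofReal (heatKer s ‖x‖) := by
  have hb : 0 < ((1 / (2 * s) : ℝ) : ℂ).re := by rw [Complex.ofReal_re]; positivity
  have hm : Measurable fun x : E => heatKer s ‖x‖ :=
    measurable_heatKer.comp (measurable_const.prodMk measurable_norm)
  have key : ∀ t : E, ∫ x, Complex.exp (inner ℝ x t * Complex.I) * heatKer s ‖x‖
      = Complex.exp (-(s * ‖t‖ ^ 2 / 2 : ℝ)) := fun t => by
    have h1 := GaussianFourier.integral_cexp_neg_mul_sq_norm_add hb Complex.I t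
    have h2 : ∀ x : E, Complex.exp (inner ℝ x t * Complex.I) * heatKer s ‖x‖
      = (((2 * π * s) ^ (3 / 2 : ℝ))⁻¹ : ℝ) *
        Complex.exp (-((1 / (2 * s) : ℝ) : ℂ) * ‖x‖ ^ 2 + Complex.I * inner ℝ t x) := fun x => by
      have h4 : ((exp (-(‖x‖ ^ 2 / (2 * s))) : ℝ) : ℂ)
          = Complex.exp (-((1 / (2 * s) : ℝ) : ℂ) * ‖x‖ ^ 2) := by
        rw [Complex.ofReal_exp]
        congr 1
        push_cast
        ring
      rw [heatKer, Complex.exp_add, real_inner_comm, mul_comm Complex.I, Complex.ofReal_mul, h4]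
      ring
    simp_rw [h2]
    rw [integral_const_mul, h1, hE]
    have h3 : ((π : ℂ) / ((1 / (2 * s) : ℝ) : ℂ)) ^ (((3:ℕ) : ℂ) / 2)
        = (((2 * π * s) ^ (3 / 2 : ℝ) : ℝ) : ℂ) := by
      rw [← Complex.ofReal_div, show π / (1 / (2 * s)) = 2 * π * s by field_simp,
        Complex.ofReal_cpow (by positivity)]
      push_cast; rfl
    rw [h3, ← mul_assoc, ← Complex.ofReal_mul, inv_mul_cancel₀ (by positivity), Complex.ofReal_one,
      one_mul, Complex.I_sq]
    congr 1
    push_cast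
    have : (s : ℂ) ≠ 0 := by exact_mod_cast hs.ne'
    field_simp
    norm_num
  have hint : Integrable fun x : E => heatKer s ‖x‖ := by
    by_contra hcon
    have h0 := key 0
    simp only [inner_zero_right, Complex.ofReal_zero, zero_mul, Complex.exp_zero, one_mul] at h0
    rw [integral_complex_ofReal, integral_undef hcon] at h0
    simp at h0
  have hfin : IsFiniteMeasure
      ((volume : Measure E).withDensity fun x => ENNReal.ofReal (heatKer s ‖x‖)) :=
    isFiniteMeasure_withDensity_ofReal hint.2
  refine Measure.ext_of_charFun ?_
  ext t
  rw [charFun_heat hs.le, charFun_apply, integral_withDensity_eq_integral_toReal_smul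
    hm.ennreal_ofReal (.of_forall fun _ => ENNReal.ofReal_lt_top), ← key t]
  congr 1; ext x
  rw [ENNReal.toReal_ofReal (heatKer_nonneg hs.le _), Complex.real_smul, mul_comm]

lemma avg_heat_eq (hE : Module.finrank ℝ E = 3) {s : ℝ} (hs : 0 < s) (χ : E → ℝ) (x : E) :
    avg (heat E s) χ x = ∫ y, heatKer s ‖y - x‖ * χ y := by
  have hm : Measurable fun x : E => heatKer s ‖x‖ :=
    measurable_heatKer.comp (measurable_const.prodMk measurable_norm)
  rw [avg, heat_eq_withDensity hE hs, integral_withDensity_eq_integral_toReal_smul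
    hm.ennreal_ofReal (.of_forall fun _ => ENNReal.ofReal_lt_top),
    ← integral_add_left_eq_self (fun y => heatKer s ‖y - x‖ * χ y) x]
  congr 1; ext y
  rw [ENNReal.toReal_ofReal (heatKer_nonneg hs.le _), smul_eq_mul, add_sub_cancel_left]

lemma heatPair_eq (hE : Module.finrank ℝ E = 3) {s : ℝ} (hs : 0 < s) {χ Ψ : E → ℝ} (hχ : Nice χ)
    (hΨ : Nice Ψ) :
    Integrable (fun z : E × E => heatKer s ‖z.2 - z.1‖ * (χ z.2 * Ψ z.1)) ∧
    heatPair χ Ψ s = ∫ z : E × E, heatKer s ‖z.2 - z.1‖ * (χ z.2 * Ψ z.1) := by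
  have i0 : Integrable (fun z : E × E => χ z.2 * Ψ z.1) := by
    rw [Measure.volume_eq_prod]
    simpa [mul_comm] using hΨ.int.mul_prod hχ.int
  have hm : Measurable fun z : E × E => heatKer s ‖z.2 - z.1‖ :=
    measurable_heatKer.comp (measurable_const.prodMk (by fun_prop))
  have i1 : Integrable (fun z : E × E => heatKer s ‖z.2 - z.1‖ * (χ z.2 * Ψ z.1)) :=
    i0.bdd_mul hm.aestronglyMeasurable (c := ((2 * π * s) ^ (3 / 2 : ℝ))⁻¹)
      (.of_forall fun z => by
        rw [norm_eq_abs, abs_of_nonneg (heatKer_nonneg hs.le _)]; exact heatKer_le hs _)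
  refine ⟨i1, ?_⟩
  rw [Measure.volume_eq_prod, integral_prod _ i1, heatPair]
  congr 1; ext x
  rw [avg_heat_eq hE hs, ← integral_mul_const]
  simp only [mul_assoc]

lemma integrable_heatKer_prod (hE : Module.finrank ℝ E = 3) {χ Ψ : E → ℝ} (hχ : Nice χ)
    (hΨ : Nice Ψ) :
    Integrable (fun w : ℝ × (E × E) => heatKer w.1 ‖w.2.2 - w.2.1‖ * (χ w.2.2 * Ψ w.2.1))
      ((volume.restrict (Ioi 0)).prod (volume : Measure (E × E))) := by
  have hχa : Nice fun x => |χ x| := by simpa using hχ.abs_rpow le_rfl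
  have hΨa : Nice fun x => |Ψ x| := by simpa using hΨ.abs_rpow le_rfl
  have hm : Measurable fun w : ℝ × (E × E) =>
      heatKer w.1 ‖w.2.2 - w.2.1‖ * (χ w.2.2 * Ψ w.2.1) :=
    (measurable_heatKer.comp (measurable_fst.prodMk (by fun_prop))).mul
      ((hχ.meas.comp (by fun_prop)).mul (hΨ.meas.comp (by fun_prop)))
  refine (integrable_prod_iff hm.aestronglyMeasurable).2 ⟨?_, ?_⟩
  · filter_upwards [ae_restrict_mem measurableSet_Ioi] with s hs
    exact (heatPair_eq hE hs hχ hΨ).1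
  have hms : Measurable fun s => ∫ z : E × E, ‖heatKer s ‖z.2 - z.1‖ * (χ z.2 * Ψ z.1)‖ :=
    (hm.norm.stronglyMeasurable.integral_prod_right (ν := (volume : Measure (E × E)))).measurable
  have heq : ∀ s ∈ Ioi (0:ℝ), ∫ z : E × E, ‖heatKer s ‖z.2 - z.1‖ * (χ z.2 * Ψ z.1)‖
      = heatPair (fun x => |χ x|) (fun x => |Ψ x|) s := fun s hs => by
    rw [(heatPair_eq hE hs hχa hΨa).2]
    congr 1; ext z
    rw [norm_mul, norm_mul, norm_eq_abs, abs_of_nonneg (heatKer_nonneg (le_of_lt hs) _)]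
    rfl
  obtain ⟨M, hM⟩ := hχa.bdd
  set N := ∫ x, |Ψ x|
  have b1 : ∀ s ∈ Ioi (0:ℝ), ‖∫ z : E × E, ‖heatKer s ‖z.2 - z.1‖ * (χ z.2 * Ψ z.1)‖‖ ≤ M * N :=
    fun s hs => by
      rw [heq s hs]
      simpa [N, heatPair] using abs_integral_mul_le hΨa (abs_avg_le hM (heat E s))
  have b2 : ∀ s ∈ Ioi (0:ℝ), ‖∫ z : E × E, ‖heatKer s ‖z.2 - z.1‖ * (χ z.2 * Ψ z.1)‖‖ ≤
      ((2 * π) ^ (3 / 2 : ℝ))⁻¹ * (∫ z : E × E, |χ z.2 * Ψ z.1|) * s ^ (-(3 / 2) : ℝ) :=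
    fun s hs => by
      have hs : 0 < s := hs
      rw [norm_eq_abs, abs_of_nonneg (integral_nonneg fun _ => norm_nonneg _), mul_right_comm,
        ← integral_const_mul]
      have i0 : Integrable (fun z : E × E => χ z.2 * Ψ z.1) := by
        rw [Measure.volume_eq_prod]
        simpa [mul_comm] using hΨ.int.mul_prod hχ.int
      refine integral_mono (heatPair_eq hE hs hχ hΨ).1.norm (i0.abs.const_mul _) fun z => ?_
      simp only [norm_mul, abs_mul]
      rw [norm_eq_abs (heatKer _ _), abs_of_nonneg (heatKer_nonneg hs.le _)]
      refine mul_le_mul_of_nonneg_right ((heatKer_le hs _).trans_eq ?_) (by positivity)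
      rw [mul_rpow (by positivity) hs.le, mul_inv, rpow_neg hs.le]
  have hsplit : Ioi (0:ℝ) = Ioc 0 1 ∪ Ioi 1 := (Ioc_union_Ioi_eq_Ioi zero_le_one).symm
  change IntegrableOn _ (Ioi (0:ℝ)) volume
  rw [hsplit]
  refine IntegrableOn.union ?_ ?_
  · refine Measure.integrableOn_of_bounded (s := Ioc (0:ℝ) 1) (μ := volume) (M := M * N) (by simp)
      hms.aestronglyMeasurable ?_
    filter_upwards [ae_restrict_mem measurableSet_Ioc] with s hs
    exact b1 s hs.1
  · refine ((integrableOn_Ioi_rpow_of_lt (a := -(3 / 2)) (by norm_num)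
      (zero_lt_one)).const_mul
      (((2 * π) ^ (3 / 2 : ℝ))⁻¹ * (∫ z : E × E, |χ z.2 * Ψ z.1|))).mono' hms.aestronglyMeasurable ?_
    filter_upwards [ae_restrict_mem measurableSet_Ioi] with s hs
    exact b2 s (mem_Ioi.2 (zero_lt_one.trans (mem_Ioi.1 hs)))

lemma newton_eq_integral_heatPair (hE : Module.finrank ℝ E = 3) {χ Ψ : E → ℝ} (hχ : Nice χ)
    (hΨ : Nice Ψ) :
    Integrable (fun z : E × E => χ z.2 * Ψ z.1 / (2 * π * ‖z.2 - z.1‖)) ∧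
    IntegrableOn (heatPair χ Ψ) (Ioi 0) ∧
    ∫ s in Ioi (0:ℝ), heatPair χ Ψ s =
      ∫ z : E × E, χ z.2 * Ψ z.1 / (2 * π * ‖z.2 - z.1‖) := by
  have hint := integrable_heatKer_prod hE hχ hΨ
  have hne : ∀ᵐ z : E × E, z.2 ≠ z.1 := by
    have : Nontrivial E := Module.nontrivial_of_finrank_pos (R := ℝ) (by omega)
    rw [Measure.volume_eq_prod]
    have hms : MeasurableSet {z : E × E | z.2 ≠ z.1} :=
      (measurableSet_eq_fun measurable_snd measurable_fst).compl
    refine (Measure.ae_prod_iff_ae_ae hms).2 (.of_forall fun x => ?_)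
    exact Measure.ae_ne volume x
  have e1 : (fun z : E × E => ∫ s in Ioi (0:ℝ), heatKer s ‖z.2 - z.1‖ * (χ z.2 * Ψ z.1))
      =ᵐ[volume] fun z => χ z.2 * Ψ z.1 / (2 * π * ‖z.2 - z.1‖) := by
    filter_upwards [hne] with z hz
    rw [integral_mul_const, integral_heatKer (norm_pos_iff.2 (sub_ne_zero.2 hz))]
    ring
  have e2 : ∀ s ∈ Ioi (0:ℝ), heatPair χ Ψ s =
      ∫ z : E × E, heatKer s ‖z.2 - z.1‖ * (χ z.2 * Ψ z.1) := fun s hs => (heatPair_eq hE hs hχ hΨ).2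
  refine ⟨hint.integral_prod_right.congr e1, ?_, ?_⟩
  · refine IntegrableOn.congr_fun hint.integral_prod_left (fun s hs => (e2 s hs).symm)
      measurableSet_Ioi
  · rw [setIntegral_congr_fun measurableSet_Ioi e2, integral_integral_swap hint]
    exact integral_congr_ae e1

/-- The bound for the Newtonian potential of a second directional derivative, in weak form. -/
lemma exists_abs_newton_le {p q : ℝ} (hpq : p.HolderConjugate q) :
    ∃ C, 0 < C ∧ ∀ {E : Type} [NormedAddCommGroup E] [InnerProductSpace ℝ E]
      [FiniteDimensional ℝ E] [MeasurableSpace E] [BorelSpace E], Module.finrank ℝ E = 3 →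
      ∀ {e : E}, ‖e‖ ≤ 1 →
      ∀ {Φ χ θ Ψ : E → ℝ} {K L : ℝ}, Nice Φ → Nice χ → Nice Ψ →
      (∀ x t, |Φ (x + t • e) - Φ x - t * θ x - t ^ 2 / 2 * χ x| ≤ K * |t| ^ 3) →
      (∀ x y, |χ x - χ y| ≤ L * ‖x - y‖) →
      |∫ z : E × E, χ z.2 * Ψ z.1 / (2 * π * ‖z.2 - z.1‖)|
        ≤ C * ((∫ x, |Φ x| ^ p) + ∫ x, |Ψ x| ^ q) := by
  obtain ⟨C, hC0, hC⟩ := exists_abs_integral_heatPair_le hpq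
  refine ⟨C, hC0, ?_⟩
  intro E _ _ _ _ _ hE e he Φ χ θ Ψ K L hΦ hχ hΨ hT hL
  obtain ⟨-, h1, h2⟩ := newton_eq_integral_heatPair hE hχ hΨ
  rw [← h2]
  refine le_of_tendsto (intervalIntegral_tendsto_integral_Ioi 0 h1 Filter.tendsto_id).abs ?_
  filter_upwards [Filter.eventually_ge_atTop 0] with T hT0
  exact hC he hΦ hχ hΨ hT hL hT0

end Newton

section SmoothNewton

lemma abs_le_of_hasDerivAt_le {h h' : ℝ → ℝ} {M : ℝ} {n : ℕ} (hd : ∀ t, HasDerivAt h (h' t) t)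
    (h0 : h 0 = 0) (hM0 : 0 ≤ M) (hM : ∀ t, |h' t| ≤ M * |t| ^ n) (t : ℝ) :
    |h t| ≤ M * |t| ^ (n + 1) := by
  have := (convex_uIcc (0:ℝ) t).norm_image_sub_le_of_norm_hasDerivWithin_le (f := h) (f' := h')
    (C := M * |t| ^ n) (fun x _ => (hd x).hasDerivWithinAt) (fun x hx => by
      have hx' : |x| ≤ |t| := by simpa using abs_sub_left_of_mem_uIcc hx
      exact (hM x).trans (by gcongr)) left_mem_uIcc right_mem_uIcc
  rw [h0, sub_zero, sub_zero, norm_eq_abs, norm_eq_abs] at this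
  rwa [pow_succ, ← mul_assoc]

lemma HasLineDerivAt.hasDerivAt_add_smul {E F : Type*} [NormedAddCommGroup E] [NormedSpace ℝ E]
    [NormedAddCommGroup F] [NormedSpace ℝ F] {Φ θ : E → F} {e : E}
    (h : ∀ x, HasLineDerivAt ℝ Φ (θ x) x e) (x : E) (t : ℝ) :
    HasDerivAt (fun t : ℝ => Φ (x + t • e)) (θ (x + t • e)) t := by
  have h1 : HasDerivAt (fun s : ℝ => Φ (x + t • e + s • e)) (θ (x + t • e)) (t - t) := by
    rw [sub_self]; exact h (x + t • e)
  have h2 := h1.comp_sub_const t t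
  refine h2.congr_of_eventuallyEq (.of_forall fun s => ?_)
  simp only
  rw [add_assoc, ← add_smul]
  congr 3; ring

lemma abs_taylor_le {E : Type*} [NormedAddCommGroup E] [NormedSpace ℝ E] {e : E}
    {Φ θ χ ω : E → ℝ} {M : ℝ} (h1 : ∀ x, HasLineDerivAt ℝ Φ (θ x) x e)
    (h2 : ∀ x, HasLineDerivAt ℝ θ (χ x) x e) (h3 : ∀ x, HasLineDerivAt ℝ χ (ω x) x e)
    (hM : ∀ x, |ω x| ≤ M) (x : E) (t : ℝ) :
    |Φ (x + t • e) - Φ x - t * θ x - t ^ 2 / 2 * χ x| ≤ M * |t| ^ 3 := by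
  have hM0 : 0 ≤ M := (abs_nonneg _).trans (hM 0)
  have a1 := abs_le_of_hasDerivAt_le (n := 0) (h := fun t => χ (x + t • e) - χ x)
    (fun t => (HasLineDerivAt.hasDerivAt_add_smul h3 x t).sub_const _) (by simp) hM0
    (fun t => by simpa using hM _)
  have a2 := abs_le_of_hasDerivAt_le (n := 1) (h := fun t => θ (x + t • e) - θ x - t * χ x)
    (h' := fun t => χ (x + t • e) - χ x)
    (fun t => ((HasLineDerivAt.hasDerivAt_add_smul h2 x t).sub_const _).sub
      (by simpa using (hasDerivAt_id t).mul_const (χ x))) (by simp) hM0 a1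
  exact abs_le_of_hasDerivAt_le (n := 2)
    (h := fun t => Φ (x + t • e) - Φ x - t * θ x - t ^ 2 / 2 * χ x)
    (h' := fun t => θ (x + t • e) - θ x - t * χ x)
    (fun t => (((HasLineDerivAt.hasDerivAt_add_smul h1 x t).sub_const _).sub
      (by simpa using (hasDerivAt_id t).mul_const (θ x))).sub
      (by simpa using (((hasDerivAt_id t).pow 2).div_const 2).mul_const (χ x)))
    (by simp) hM0 a2 t

variable {E : Type*} [NormedAddCommGroup E] [InnerProductSpace ℝ E] [FiniteDimensional ℝ E]
  [MeasurableSpace E] [BorelSpace E]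

lemma Nice.of_contDiff {u : E → ℝ} (hu : Continuous u) (hc : HasCompactSupport u) : Nice u :=
  ⟨hu.measurable, hu.integrable_of_hasCompactSupport hc, hc.exists_bound_of_continuous hu⟩

/-- The bound of `exists_abs_newton_le` for smooth compactly supported functions. -/
lemma exists_abs_newton_le_of_contDiff {p q : ℝ} (hpq : p.HolderConjugate q) :
    ∃ C, 0 < C ∧ ∀ {E : Type} [NormedAddCommGroup E] [InnerProductSpace ℝ E]
      [FiniteDimensional ℝ E] [MeasurableSpace E] [BorelSpace E], Module.finrank ℝ E = 3 →
      ∀ {e : E}, ‖e‖ ≤ 1 → ∀ {Φ θ χ Ψ : E → ℝ}, ContDiff ℝ 1 Φ → HasCompactSupport Φ →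
      ContDiff ℝ 1 χ → HasCompactSupport χ → Nice Ψ →
      (∀ x, HasLineDerivAt ℝ Φ (θ x) x e) → (∀ x, HasLineDerivAt ℝ θ (χ x) x e) →
      |∫ z : E × E, χ z.2 * Ψ z.1 / (2 * π * ‖z.2 - z.1‖)|
        ≤ C * ((∫ x, |Φ x| ^ p) + ∫ x, |Ψ x| ^ q) := by
  obtain ⟨C, hC0, hC⟩ := exists_abs_newton_le hpq
  refine ⟨C, hC0, ?_⟩
  intro E _ _ _ _ _ hE e he Φ θ χ Ψ hΦ hΦc hχ hχc hΨ h1 h2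
  obtain ⟨L, hL⟩ := ContDiff.lipschitzWith_of_hasCompactSupport hχc hχ one_ne_zero
  have h3 : ∀ x, HasLineDerivAt ℝ χ (fderiv ℝ χ x e) x e := fun x =>
    ((hχ.differentiable one_ne_zero) x).hasFDerivAt.hasLineDerivAt e
  obtain ⟨M, hM⟩ := (hχc.fderiv_apply (𝕜 := ℝ) e).exists_bound_of_continuous
    ((hχ.continuous_fderiv one_ne_zero).clm_apply continuous_const)
  exact hC hE he (.of_contDiff hΦ.continuous hΦc) (.of_contDiff hχ.continuous hχc) hΨ
    (abs_taylor_le h1 h2 h3 hM) (L := L) fun x y => by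
      simpa [dist_eq_norm] using hL.dist_le_mul x y

end SmoothNewton

section Space

/-- The Euclidean distance on `ℂ × ℝ`. -/
def dist3 (x y : ℂ × ℝ) : ℝ := √(‖x.1 - y.1‖ ^ 2 + (x.2 - y.2) ^ 2)

/-- The pairing of the Newtonian potential of `χ` with `Ψ` on `ℂ × ℝ`, up to a factor. -/
def newtonPair (χ : ℂ × ℝ → ℂ) (Ψ : ℂ × ℝ → ℝ) : ℂ :=
  ∫ z : (ℂ × ℝ) × (ℂ × ℝ), χ z.2 * ((Ψ z.1 / (2 * π * dist3 z.2 z.1) : ℝ) : ℂ)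

lemma finrank_withLp : Module.finrank ℝ (WithLp 2 (ℂ × ℝ)) = 3 := by
  rw [(WithLp.linearEquiv 2 ℝ (ℂ × ℝ)).finrank_eq]; simp

lemma norm_sub_eq_dist3 (x y : WithLp 2 (ℂ × ℝ)) : ‖x - y‖ = dist3 x.ofLp y.ofLp := by
  rw [WithLp.prod_norm_eq_of_L2, dist3]
  simp

lemma nice_comp_ofLp {u : ℂ × ℝ → ℝ} (hm : Measurable u) (hi : Integrable u)
    (hb : ∃ M, ∀ x, |u x| ≤ M) : Nice fun x : WithLp 2 (ℂ × ℝ) => u x.ofLp := by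
  have hmp := WithLp.volume_preserving_ofLp ℂ ℝ
  exact ⟨hm.comp hmp.measurable, hmp.integrable_comp_of_integrable hi, hb.imp fun M h x => h _⟩

lemma integral_comp_ofLp {F : Type*} [NormedAddCommGroup F] [NormedSpace ℝ F] (u : ℂ × ℝ → F) :
    ∫ x : WithLp 2 (ℂ × ℝ), u x.ofLp = ∫ x, u x :=
  (WithLp.volume_preserving_ofLp ℂ ℝ).integral_comp
    (MeasurableEquiv.toLp 2 (ℂ × ℝ)).symm.measurableEmbedding u

lemma integral_prod_comp_ofLp {F : Type*} [NormedAddCommGroup F] [NormedSpace ℝ F]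
    (u : (ℂ × ℝ) × (ℂ × ℝ) → F) :
    ∫ z : WithLp 2 (ℂ × ℝ) × WithLp 2 (ℂ × ℝ), u (z.1.ofLp, z.2.ofLp) = ∫ x, u x :=
  ((WithLp.volume_preserving_ofLp ℂ ℝ).prod (WithLp.volume_preserving_ofLp ℂ ℝ)).integral_comp
    ((MeasurableEquiv.toLp 2 (ℂ × ℝ)).symm.prodCongr
      (MeasurableEquiv.toLp 2 (ℂ × ℝ)).symm).measurableEmbedding u

lemma integrable_newton_real {χ Ψ : ℂ × ℝ → ℝ} (hχ : Continuous χ) (hχc : HasCompactSupport χ)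
    (hm : Measurable Ψ) (hi : Integrable Ψ) (hb : ∃ M, ∀ x, |Ψ x| ≤ M) :
    Integrable fun z : (ℂ × ℝ) × (ℂ × ℝ) => χ z.2 * (Ψ z.1 / (2 * π * dist3 z.2 z.1)) := by
  have h1 := (newton_eq_integral_heatPair finrank_withLp
    (nice_comp_ofLp hχ.measurable (hχ.integrable_of_hasCompactSupport hχc)
      (hχc.exists_bound_of_continuous hχ)) (nice_comp_ofLp hm hi hb)).1
  simp_rw [norm_sub_eq_dist3, mul_div_assoc] at h1
  exact (((WithLp.volume_preserving_ofLp ℂ ℝ).prod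
    (WithLp.volume_preserving_ofLp ℂ ℝ)).integrable_comp_emb
    ((MeasurableEquiv.toLp 2 (ℂ × ℝ)).symm.prodCongr
      (MeasurableEquiv.toLp 2 (ℂ × ℝ)).symm).measurableEmbedding).1 h1

lemma integrable_newton {χ : ℂ × ℝ → ℂ} {Ψ : ℂ × ℝ → ℝ} (hχ : Continuous χ)
    (hχc : HasCompactSupport χ)
    (hm : Measurable Ψ) (hi : Integrable Ψ) (hb : ∃ M, ∀ x, |Ψ x| ≤ M) :
    Integrable fun z : (ℂ × ℝ) × (ℂ × ℝ) =>
      χ z.2 * ((Ψ z.1 / (2 * π * dist3 z.2 z.1) : ℝ) : ℂ) := by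
  have h1 := integrable_newton_real (χ := fun x => (χ x).re) (by fun_prop)
    (hχc.comp_left (g := Complex.re) rfl) hm hi hb
  have h2 := integrable_newton_real (χ := fun x => (χ x).im) (by fun_prop)
    (hχc.comp_left (g := Complex.im) rfl) hm hi hb
  refine (h1.ofReal.add (h2.ofReal.mul_const Complex.I)).congr (.of_forall fun z => ?_)
  apply Complex.ext <;> simp [sub_eq_add_neg]

lemma hasLineDerivAt_comp_ofLp {F : Type*} [NormedAddCommGroup F] [NormedSpace ℝ F]
    {Φ θ : ℂ × ℝ → ℂ} {v : ℂ × ℝ} (L : ℂ →L[ℝ] F) (h : ∀ x, HasLineDerivAt ℝ Φ (θ x) x v)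
    (x : WithLp 2 (ℂ × ℝ)) :
    HasLineDerivAt ℝ (fun x : WithLp 2 (ℂ × ℝ) => L (Φ x.ofLp)) (L (θ x.ofLp)) x
      (WithLp.toLp 2 v) :=
  L.hasFDerivAt.comp_hasDerivAt (0:ℝ) (h x.ofLp)

lemma exists_norm_newtonPair_le {p q : ℝ} (hpq : p.HolderConjugate q) :
    ∃ C, 0 < C ∧ ∀ {v : ℂ × ℝ}, ‖v.1‖ ^ 2 + v.2 ^ 2 ≤ 1 → ∀ {Φ θ χ : ℂ × ℝ → ℂ} {Ψ : ℂ × ℝ → ℝ},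
      ContDiff ℝ 1 Φ → HasCompactSupport Φ → ContDiff ℝ 1 χ → HasCompactSupport χ →
      Measurable Ψ → Integrable Ψ → (∃ M, ∀ x, |Ψ x| ≤ M) →
      (∀ x, HasLineDerivAt ℝ Φ (θ x) x v) → (∀ x, HasLineDerivAt ℝ θ (χ x) x v) →
      ‖newtonPair χ Ψ‖ ≤ C * ((∫ x, ‖Φ x‖ ^ p) + ∫ x, |Ψ x| ^ q) := by
  obtain ⟨C, hC0, hC⟩ := exists_abs_newton_le_of_contDiff hpq
  refine ⟨2 * C, by positivity, ?_⟩
  intro v hv Φ θ χ Ψ hΦ hΦc hχ hχc hm hi hb h1 h2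
  have hv' : ‖(WithLp.toLp 2 v : WithLp 2 (ℂ × ℝ))‖ ≤ 1 := by
    rw [WithLp.prod_norm_eq_of_L2, sqrt_le_left zero_le_one, one_pow]
    simpa using hv
  have hlin : ContDiff ℝ 1 fun x : WithLp 2 (ℂ × ℝ) => x.ofLp :=
    (WithLp.prodContinuousLinearEquiv 2 ℝ ℂ ℝ).contDiff
  have hcs : ∀ {u : ℂ × ℝ → ℂ}, HasCompactSupport u →
      HasCompactSupport fun x : WithLp 2 (ℂ × ℝ) => u x.ofLp := fun hu =>
    hu.comp_homeomorph (WithLp.prodContinuousLinearEquiv 2 ℝ ℂ ℝ).toHomeomorph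
  have hp0 := hpq.pos
  have key : ∀ L : ℂ →L[ℝ] ℝ, (∀ c, |L c| ≤ ‖c‖) →
      |L (newtonPair χ Ψ)| ≤ C * ((∫ x, ‖Φ x‖ ^ p) + ∫ x, |Ψ x| ^ q) := fun L hL => by
    have e1 : L (newtonPair χ Ψ) = ∫ z : (ℂ × ℝ) × (ℂ × ℝ),
        L (χ z.2) * Ψ z.1 / (2 * π * dist3 z.2 z.1) := by
      rw [newtonPair, ← L.integral_comp_comm (integrable_newton hχ.continuous hχc hm hi hb)]
      congr 1; ext z
      rw [mul_comm (χ z.2), ← Complex.real_smul, L.map_smul, smul_eq_mul]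
      ring
    have h3 := hC finrank_withLp hv' (L.contDiff.comp (hΦ.comp hlin))
      ((hcs hΦc).comp_left (map_zero L)) (L.contDiff.comp (hχ.comp hlin))
      ((hcs hχc).comp_left (map_zero L)) (nice_comp_ofLp hm hi hb)
      (hasLineDerivAt_comp_ofLp L h1) (hasLineDerivAt_comp_ofLp L h2)
    simp only [Function.comp_def, norm_sub_eq_dist3] at h3
    rw [integral_prod_comp_ofLp fun z => L (χ z.2) * Ψ z.1 / (2 * π * dist3 z.2 z.1),
      integral_comp_ofLp fun x => |L (Φ x)| ^ p, integral_comp_ofLp fun x => |Ψ x| ^ q, ← e1] at h3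
    refine h3.trans ?_
    gcongr
    · exact ((((L.continuous.comp hΦ.continuous).norm).rpow_const
        fun _ => Or.inr hp0.le)).integrable_of_hasCompactSupport (hΦc.comp_left (g := fun c => |L c| ^ p) (by simp [hp0.ne']))
    · exact ((hΦ.continuous.norm).rpow_const fun _ => Or.inr hp0.le).integrable_of_hasCompactSupport
        (hΦc.comp_left (g := fun c => ‖c‖ ^ p) (by simp [hp0.ne']))
    · intro x
      exact rpow_le_rpow (abs_nonneg _) (hL _) hp0.le
  have r1 := key Complex.reCLM fun c => by simpa using Complex.abs_re_le_norm c
  have r2 := key Complex.imCLM fun c => by simpa using Complex.abs_im_le_norm c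
  have r3 := Complex.norm_le_abs_re_add_abs_im (newtonPair χ Ψ)
  simp only [Complex.reCLM_apply, Complex.imCLM_apply] at r1 r2
  linarith

end Space

section Modes

open Topology ComplexConjugate

/-- The radial derivative. -/
def dR (f : ℝ → ℝ → ℝ) (r z : ℝ) : ℝ := fderiv ℝ (Function.uncurry f) (r, z) (1, 0)

/-- The axial derivative. -/
def dZ (f : ℝ → ℝ → ℝ) (r z : ℝ) : ℝ := fderiv ℝ (Function.uncurry f) (r, z) (0, 1)

/-- The function `∂_r f + c f / r`. -/
def dShift (c : ℝ) (f : ℝ → ℝ → ℝ) (r z : ℝ) : ℝ := dR f r z + c * (f r z / r)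

variable {f g : ℝ → ℝ → ℝ}

lemma TestFun.add (hf : TestFun f) (hg : TestFun g) : TestFun fun r z => f r z + g r z :=
  ⟨hf.1.add hg.1, hf.2.1.add hg.2.1, (tsupport_add _ _).trans (union_subset hf.2.2 hg.2.2)⟩

lemma TestFun.const_mul (hf : TestFun f) (c : ℝ) : TestFun fun r z => c * f r z :=
  ⟨contDiff_const.mul hf.1, hf.2.1.mul_left (f := fun _ => c),
    (tsupport_mul_subset_right (f := fun _ => c)).trans hf.2.2⟩

lemma TestFun.differentiableAt (hf : TestFun f) (x : ℝ × ℝ) :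
    DifferentiableAt ℝ (Function.uncurry f) x := hf.1.differentiable (by simp) x

lemma TestFun.fderiv_apply (hf : TestFun f) (v : ℝ × ℝ) :
    TestFun fun r z => fderiv ℝ (Function.uncurry f) (r, z) v :=
  ⟨(hf.1.fderiv_right (m := (⊤ : ℕ∞)) (by simp)).clm_apply contDiff_const,
    hf.2.1.fderiv_apply (𝕜 := ℝ) v, (tsupport_fderiv_apply_subset ℝ v).trans hf.2.2⟩

lemma TestFun.radial (hf : TestFun f) : TestFun (dR f) := hf.fderiv_apply _

lemma TestFun.axial (hf : TestFun f) : TestFun (dZ f) := hf.fderiv_apply _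

lemma TestFun.div_r (hf : TestFun f) : TestFun fun r z => f r z / r := by
  have hsub : tsupport (Function.uncurry fun r z => f r z / r) ⊆ tsupport (Function.uncurry f) := by
    refine closure_mono fun x hx => ?_
    simp only [Function.mem_support, Function.uncurry] at hx ⊢
    exact fun h => hx (by rw [h, zero_div])
  refine ⟨contDiff_iff_contDiffAt.2 fun x => ?_, ?_, hsub.trans hf.2.2⟩
  · by_cases hx : x ∈ tsupport (Function.uncurry f)
    · have hr : x.1 ≠ 0 := (mem_Ioi.1 (hf.2.2 hx).1).ne'
      exact hf.1.contDiffAt.div contDiffAt_fst hr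
    · have : (Function.uncurry fun r z => f r z / r) =ᶠ[𝓝 x] fun _ => 0 := by
        filter_upwards [notMem_tsupport_iff_eventuallyEq.1 hx] with y hy
        simp only [Function.uncurry] at hy ⊢
        rw [hy]; simp
      exact contDiffAt_const.congr_of_eventuallyEq this
  · exact hf.2.1.mono' ((subset_tsupport _).trans hsub)

lemma TestFun.shift (hf : TestFun f) (c : ℝ) : TestFun (dShift c f) :=
  hf.radial.add (hf.div_r.const_mul c)

lemma TestFun.hasDerivAt_fst (hf : TestFun f) (r z : ℝ) :
    HasDerivAt (fun s => f s z) (dR f r z) r := by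
  exact HasFDerivAt.comp_hasDerivAt (l := Function.uncurry f) (f := fun s => (s, z)) r
    (hf.differentiableAt (r, z)).hasFDerivAt
    ((hasDerivAt_id r).prodMk (hasDerivAt_const r z))

lemma TestFun.hasDerivAt_snd (hf : TestFun f) (r z : ℝ) :
    HasDerivAt (fun s => f r s) (dZ f r z) z := by
  exact HasFDerivAt.comp_hasDerivAt (l := Function.uncurry f) (f := fun s => (r, s)) z
    (hf.differentiableAt (r, z)).hasFDerivAt
    ((hasDerivAt_const z r).prodMk (hasDerivAt_id z))

lemma TestFun.dR_dZ_comm (hf : TestFun f) : dR (dZ f) = dZ (dR f) := by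
  ext r z
  have hs := (hf.1.contDiffAt (x := (r, z))).isSymmSndFDerivAt
    (by simpa using (WithTop.coe_le_coe.2 (le_top : (2:ℕ∞) ≤ ⊤)))
  have hd : DifferentiableAt ℝ (fderiv ℝ (Function.uncurry f)) (r, z) :=
    (hf.1.fderiv_right (m := (⊤ : ℕ∞)) (by simp)).differentiable (by simp) _
  have e : ∀ v w : ℝ × ℝ, fderiv ℝ (Function.uncurry fun r z =>
      fderiv ℝ (Function.uncurry f) (r, z) v) (r, z) w
        = fderiv ℝ (fderiv ℝ (Function.uncurry f)) (r, z) w v := fun v w => by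
    have := (hd.hasFDerivAt.clm_apply (hasFDerivAt_const v (r, z))).fderiv
    change fderiv ℝ (fun x => fderiv ℝ (Function.uncurry f) x v) (r, z) w = _
    rw [this]; simp
  change fderiv ℝ (Function.uncurry fun r z => fderiv ℝ (Function.uncurry f) (r, z) _) (r, z) _
    = fderiv ℝ (Function.uncurry fun r z => fderiv ℝ (Function.uncurry f) (r, z) _) (r, z) _
  rw [e, e]
  exact hs.eq _ _

lemma TestFun.dShift_eq (hf : TestFun f) (c r z : ℝ) :
    dZ (dShift c f) r z = dShift c (dZ f) r z := by
  refine ((hf.shift c).hasDerivAt_snd r z).unique ?_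
  rw [dShift, hf.dR_dZ_comm]
  exact (hf.radial.hasDerivAt_snd r z).add (((hf.hasDerivAt_snd r z).div_const r).const_mul c)

/-- For `r ≠ 0`, the composition of two shifted derivatives. -/
lemma TestFun.dShift_dShift (hf : TestFun f) (b c : ℝ) {r : ℝ} (hr : r ≠ 0) (z : ℝ) :
    dShift b (dShift c f) r z = dR (dR f) r z
      + (b + c) * (dR f r z / r) + c * (b - 1) * (f r z / r ^ 2) := by
  have h : dR (dShift c f) r z = dR (dR f) r z
      + c * ((dR f r z * r - f r z * 1) / r ^ 2) :=
    ((hf.shift c).hasDerivAt_fst r z).unique ((hf.radial.hasDerivAt_fst r z).add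
      (((hf.hasDerivAt_fst r z).div (hasDerivAt_id r) hr).const_mul c))
  rw [dShift, h, dShift]
  field_simp
  ring

lemma TestFun.eq_zero (hf : TestFun f) (z : ℝ) : f 0 z = 0 := by
  by_contra h
  exact lt_irrefl (0:ℝ) (hf.2.2 (subset_tsupport (Function.uncurry f) (a := (0, z)) h)).1

/-- The function `f(r,z) e^{ikθ}` in cylindrical coordinates `ζ = r e^{iθ}`. -/
def angMode (f : ℝ → ℝ → ℝ) (k : ℤ) (x : ℂ × ℝ) : ℂ := f ‖x.1‖ x.2 * (x.1 / ‖x.1‖) ^ k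

lemma angMode_eventuallyEq_zero (k : ℤ) {x : ℂ × ℝ}
    (hx : (‖x.1‖, x.2) ∉ tsupport (Function.uncurry f)) : angMode f k =ᶠ[𝓝 x] fun _ => 0 := by
  have hc : Filter.Tendsto (fun y : ℂ × ℝ => (‖y.1‖, y.2)) (𝓝 x) (𝓝 (‖x.1‖, x.2)) :=
    (Continuous.tendsto (by fun_prop) x)
  filter_upwards [hc.eventually (notMem_tsupport_iff_eventuallyEq.1 hx)] with y hy
  have hy : f ‖y.1‖ y.2 = 0 := hy
  rw [angMode, hy]; simp

lemma TestFun.notMem_tsupport (hf : TestFun f) {x : ℂ × ℝ} (hx : x.1 = 0) :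
    (‖x.1‖, x.2) ∉ tsupport (Function.uncurry f) := fun h => by
  have := (hf.2.2 h).1
  simp [hx] at this

lemma TestFun.contDiff_angMode (hf : TestFun f) (k : ℤ) : ContDiff ℝ 1 (angMode f k) := by
  refine contDiff_iff_contDiffAt.2 fun x => ?_
  by_cases hx : (‖x.1‖, x.2) ∈ tsupport (Function.uncurry f)
  · have hr : x.1 ≠ 0 := fun h => hf.notMem_tsupport h hx
    have hr' : ((‖x.1‖ : ℝ) : ℂ) ≠ 0 := by simpa using hr
    have hn : ContDiffAt ℝ 1 (fun x : ℂ × ℝ => ‖x.1‖) x := contDiffAt_fst.norm ℝ hr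
    have hu : ContDiffAt ℝ 1 (fun x : ℂ × ℝ => x.1 / ((‖x.1‖ : ℝ) : ℂ)) x :=
      contDiffAt_fst.mul ((Complex.ofRealCLM.contDiff.contDiffAt.comp x hn).inv hr')
    have hf1 : ContDiffAt ℝ 1 (fun x : ℂ × ℝ => f ‖x.1‖ x.2) x :=
      ContDiffAt.comp x (g := Function.uncurry f) (f := fun x : ℂ × ℝ => (‖x.1‖, x.2))
        ((hf.1.of_le (by simp)).contDiffAt) (hn.prodMk contDiffAt_snd)
    refine (Complex.ofRealCLM.contDiff.contDiffAt.comp x hf1).mul ?_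
    rcases k with n | n
    · simpa using hu.pow n
    · simp only [zpow_negSucc]
      exact (hu.pow (n + 1)).inv (pow_ne_zero _ (div_ne_zero hr hr'))
  · exact contDiffAt_const.congr_of_eventuallyEq (angMode_eventuallyEq_zero k hx)

lemma TestFun.hasCompactSupport_angMode (hf : TestFun f) (k : ℤ) :
    HasCompactSupport (angMode f k) := by
  obtain ⟨R, hR⟩ := hf.2.1.isBounded.subset_closedBall 0
  refine HasCompactSupport.intro (isCompact_closedBall (0 : ℂ × ℝ) R) fun x hx => ?_
  refine (angMode_eventuallyEq_zero k fun h => hx ?_).eq_of_nhds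
  have := hR h
  simpa [Prod.norm_def] using this

lemma hasDerivAt_norm_line {ζ e : ℂ} (h : ζ ≠ 0) :
    HasDerivAt (fun t : ℝ => ‖ζ + t • e‖) ((conj (ζ / ‖ζ‖) * e).re) 0 := by
  have h1 : HasDerivAt (fun t : ℝ => ζ + t • e) e 0 := by
    simpa using ((hasDerivAt_id (0:ℝ)).smul_const e).const_add ζ
  have h2 := h1.norm_sq.sqrt (by simpa using h)
  simp only [sqrt_sq (norm_nonneg _)] at h2
  refine h2.congr_deriv ?_
  have : ‖ζ‖ ≠ 0 := by simpa using h
  simp [Complex.inner, Complex.div_re, Complex.div_im]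
  field_simp
  ring

lemma TestFun.hasLineDerivAt_angMode (hf : TestFun f) (k : ℤ) (v : ℂ × ℝ) (x : ℂ × ℝ) :
    HasLineDerivAt ℝ (angMode f k)
      (v.1 / 2 * angMode (dShift k f) (k - 1) x
        + conj v.1 / 2 * angMode (dShift (-k) f) (k + 1) x
        + v.2 * angMode (dZ f) k x) x v := by
  obtain ⟨e, τ⟩ := v
  obtain ⟨ζ, z⟩ := x
  by_cases h : ζ = 0
  · have h0 := angMode_eventuallyEq_zero k (hf.notMem_tsupport (x := (ζ, z)) h)
    have hz : ∀ {g : ℝ → ℝ → ℝ} (hg : TestFun g) (j : ℤ), angMode g j (ζ, z) = 0 := fun hg j =>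
      (angMode_eventuallyEq_zero j (hg.notMem_tsupport (x := (ζ, z)) h)).eq_of_nhds
    rw [hz (hf.shift _), hz (hf.shift _), hz hf.axial]
    simp only [mul_zero, add_zero]
    have hc : Filter.Tendsto (fun t : ℝ => (ζ, z) + t • (e, τ)) (𝓝 0) (𝓝 (ζ, z)) := by
      have : Continuous fun t : ℝ => (ζ, z) + t • (e, τ) := by fun_prop
      simpa using this.tendsto 0
    exact (hasDerivAt_const (0:ℝ) (0:ℂ)).congr_of_eventuallyEq (hc.eventually h0)
  · have hr : ‖ζ‖ ≠ 0 := by simpa using h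
    have hr' : ((‖ζ‖ : ℝ) : ℂ) ≠ 0 := by simpa using h
    set u : ℂ := ζ / ‖ζ‖ with hu
    have hu0 : u ≠ 0 := div_ne_zero h hr'
    set ρ : ℝ := (conj u * e).re with hρ
    have hn : HasDerivAt (fun t : ℝ => ‖ζ + t • e‖) ρ 0 := hasDerivAt_norm_line h
    have h1 : HasDerivAt (fun t : ℝ => ζ + t • e) e 0 := by
      simpa using ((hasDerivAt_id (0:ℝ)).smul_const e).const_add ζ
    have h2 : HasDerivAt (fun t : ℝ => z + t * τ) τ 0 := by
      simpa using ((hasDerivAt_id (0:ℝ)).mul_const τ).const_add z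
    have h3 : HasDerivAt (fun t : ℝ => f ‖ζ + t • e‖ (z + t * τ))
        (ρ * dR f ‖ζ‖ z + τ * dZ f ‖ζ‖ z) 0 := by
      have hd := (hf.differentiableAt (‖ζ + (0:ℝ) • e‖, z + 0 * τ)).hasFDerivAt.comp_hasDerivAt
        (0:ℝ) (hn.prodMk h2)
      refine hd.congr_deriv ?_
      have : ((ρ, τ) : ℝ × ℝ) = ρ • (1, 0) + τ • (0, 1) := by simp
      rw [this, map_add, map_smul, map_smul]
      simp [dR, dZ]
    have h4 : HasDerivAt (fun t : ℝ => (ζ + t • e) / ((‖ζ + t • e‖ : ℝ) : ℂ))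
        ((e * ‖ζ‖ - ζ * ρ) / (‖ζ‖ : ℂ) ^ 2) 0 := by
      have := h1.fun_div hn.ofReal_comp (by simpa using hr')
      simpa using this
    have h5 : HasDerivAt (fun t : ℝ => ((ζ + t • e) / ((‖ζ + t • e‖ : ℝ) : ℂ)) ^ k)
        (k * u ^ (k - 1) * ((e * ‖ζ‖ - ζ * ρ) / (‖ζ‖ : ℂ) ^ 2)) 0 := by
      have h6 := hasDerivAt_zpow k u (Or.inl hu0)
      have h6' : HasDerivAt (fun x : ℂ => x ^ k) (k * u ^ (k - 1))
        ((fun t : ℝ => (ζ + t • e) / ((‖ζ + t • e‖ : ℝ) : ℂ)) 0) := by simpa [hu] using h6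
      exact h6'.comp (0:ℝ) h4
    refine (h3.ofReal_comp.mul h5).congr_deriv ?_
    have hζ : ζ = ‖ζ‖ * u := by rw [hu]; field_simp
    have huu : u * conj u = 1 := by
      rw [Complex.mul_conj, Complex.normSq_eq_norm_sq, hu, norm_div, Complex.norm_real, norm_norm,
        div_self hr]; simp
    have hρc : (ρ : ℂ) = (conj u * e + u * conj e) / 2 := by
      rw [hρ, Complex.re_eq_add_conj]; simp
    simp only [zero_smul, add_zero, zero_mul, angMode, dShift, ← hu]
    rw [zpow_sub_one₀ hu0, zpow_add_one₀ hu0]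
    have hinv : u⁻¹ = conj u := (eq_inv_of_mul_eq_one_right huu).symm ▸ rfl
    rw [hinv]
    have hq : (e * ‖ζ‖ - ζ * ρ) / (‖ζ‖ : ℂ) ^ 2 = (e - u * ρ) / ‖ζ‖ := by
      nth_rw 2 [hζ]
      field_simp
    rw [hq]
    push_cast
    rw [hρc]
    linear_combination (-(f ‖ζ‖ z * k * u ^ k / ‖ζ‖) * (conj u * e + u * conj e) / 2) * huu

end Modes

section ModeBounds

open Topology ComplexConjugate

/-- Continuously differentiable functions of compact support. -/
structure Reg (χ : ℂ × ℝ → ℂ) : Prop where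
  contDiff : ContDiff ℝ 1 χ
  hasCompactSupport : HasCompactSupport χ

/-- Bounded, measurable and integrable functions on `ℂ × ℝ`. -/
structure Tame (Ψ : ℂ × ℝ → ℝ) : Prop where
  meas : Measurable Ψ
  int : Integrable Ψ
  bdd : ∃ M, ∀ x, |Ψ x| ≤ M

variable {χ χ' : ℂ × ℝ → ℂ} {Ψ : ℂ × ℝ → ℝ} {f g : ℝ → ℝ → ℝ}

lemma Reg.add (h : Reg χ) (h' : Reg χ') : Reg fun x => χ x + χ' x :=
  ⟨h.1.add h'.1, h.2.add h'.2⟩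

lemma Reg.const_mul (h : Reg χ) (c : ℂ) : Reg fun x => c * χ x :=
  ⟨contDiff_const.mul h.1, h.2.mul_left (f := fun _ => c)⟩

lemma TestFun.reg (hf : TestFun f) (k : ℤ) : Reg (angMode f k) :=
  ⟨hf.contDiff_angMode k, hf.hasCompactSupport_angMode k⟩

lemma Reg.integrable (h : Reg χ) (hΨ : Tame Ψ) :
    Integrable fun z : (ℂ × ℝ) × (ℂ × ℝ) =>
      χ z.2 * ((Ψ z.1 / (2 * π * dist3 z.2 z.1) : ℝ) : ℂ) :=
  integrable_newton h.1.continuous h.2 hΨ.meas hΨ.int hΨ.bdd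

lemma newtonPair_add (h : Reg χ) (h' : Reg χ') (hΨ : Tame Ψ) :
    newtonPair (fun x => χ x + χ' x) Ψ = newtonPair χ Ψ + newtonPair χ' Ψ := by
  simp only [newtonPair, add_mul]
  exact integral_add (h.integrable hΨ) (h'.integrable hΨ)

lemma newtonPair_const_mul (c : ℂ) (χ : ℂ × ℝ → ℂ) (Ψ : ℂ × ℝ → ℝ) :
    newtonPair (fun x => c * χ x) Ψ = c * newtonPair χ Ψ := by
  simp only [newtonPair, mul_assoc]
  exact integral_const_mul _ _

lemma hasLineDerivAt_linear {θ θ' : ℂ × ℝ → ℂ} {v : ℂ × ℝ}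
    (h : ∀ x, HasLineDerivAt ℝ χ (θ x) x v) (h' : ∀ x, HasLineDerivAt ℝ χ' (θ' x) x v) (c d : ℂ)
    (x : ℂ × ℝ) : HasLineDerivAt ℝ (fun x => c * χ x + d * χ' x) (c * θ x + d * θ' x) x v := by
  have h1 := h x
  have h2 := h' x
  unfold HasLineDerivAt at *
  exact (h1.const_mul c).add (h2.const_mul d)

/-- The pairing of the Newtonian potential of a mode with `Ψ`. -/
def modePair (Ψ : ℂ × ℝ → ℝ) (f : ℝ → ℝ → ℝ) (k : ℤ) : ℂ := newtonPair (angMode f k) Ψ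

lemma modePair_linear (hf : TestFun f) (hg : TestFun g) (hΨ : Tame Ψ) (a b : ℝ) (k : ℤ) :
    modePair Ψ (fun r z => a * f r z + b * g r z) k = a * modePair Ψ f k + b * modePair Ψ g k := by
  have e : angMode (fun r z => a * f r z + b * g r z) k
      = fun x => (a : ℂ) * angMode f k x + b * angMode g k x := by
    ext x; simp only [angMode]; push_cast; ring
  rw [modePair, e, newtonPair_add ((hf.reg k).const_mul _) ((hg.reg k).const_mul _) hΨ,
    newtonPair_const_mul, newtonPair_const_mul, modePair, modePair]

lemma modePair_congr (h : ∀ r ≠ 0, ∀ z, f r z = g r z) (hf : TestFun f) (hg : TestFun g) (k : ℤ) :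
    modePair Ψ f k = modePair Ψ g k := by
  congr 1
  ext r z
  by_cases hr : r = 0
  · rw [hr, hf.eq_zero, hg.eq_zero]
  · exact h r hr z

lemma TestFun.norm_angMode (hf : TestFun f) (k : ℤ) (x : ℂ × ℝ) :
    ‖angMode f k x‖ = |f ‖x.1‖ x.2| := by
  by_cases h : x.1 = 0
  · simp [angMode, h, hf.eq_zero]
  · have : ‖x.1‖ ≠ 0 := by simpa using h
    simp [angMode, this]

/-- The weak bound for all second directional derivatives of a mode. -/
lemma exists_norm_second_le {p q : ℝ} (hpq : p.HolderConjugate q) :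
    ∃ C, 0 < C ∧ ∀ {f : ℝ → ℝ → ℝ}, TestFun f → ∀ {Ψ}, Tame Ψ → ∀ (k : ℤ) (e : ℂ) (τ : ℝ),
      ‖e‖ ^ 2 + τ ^ 2 ≤ 1 →
      ‖e ^ 2 / 4 * modePair Ψ (dShift (k - 1 : ℤ) (dShift k f)) (k - 2)
        + e * conj e / 4 * (modePair Ψ (dShift (-(k - 1 : ℤ)) (dShift k f)) k
          + modePair Ψ (dShift (k + 1 : ℤ) (dShift (-k) f)) k)
        + conj e ^ 2 / 4 * modePair Ψ (dShift (-(k + 1 : ℤ)) (dShift (-k) f)) (k + 2)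
        + τ * e * modePair Ψ (dShift k (dZ f)) (k - 1)
        + τ * conj e * modePair Ψ (dShift (-k) (dZ f)) (k + 1)
        + τ ^ 2 * modePair Ψ (dZ (dZ f)) k‖
      ≤ C * ((∫ x : ℂ × ℝ, |f ‖x.1‖ x.2| ^ p) + ∫ x, |Ψ x| ^ q) := by
  obtain ⟨C, hC0, hC⟩ := exists_norm_newtonPair_le hpq
  refine ⟨C, hC0, fun {f} hf {Ψ} hΨ k e τ hv => ?_⟩
  have hP := hf.shift k
  have hM := hf.shift (-k)
  have hZ := hf.axial
  have hev : dZ (dShift k f) = dShift k (dZ f) := by ext r z; exact hf.dShift_eq _ r z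
  have hev' : dZ (dShift (-k) f) = dShift (-k) (dZ f) := by ext r z; exact hf.dShift_eq _ r z
  have d1 := hP.hasLineDerivAt_angMode (k - 1) (e, τ)
  have d2 := hM.hasLineDerivAt_angMode (k + 1) (e, τ)
  have d3 := hZ.hasLineDerivAt_angMode k (e, τ)
  rw [hev] at d1
  rw [hev'] at d2
  rw [sub_add_cancel, sub_sub, one_add_one_eq_two] at d1
  rw [add_sub_cancel_right, add_assoc, one_add_one_eq_two] at d2
  have d12 := hasLineDerivAt_linear d1 d2 (e / 2) (conj e / 2)
  have d123 := hasLineDerivAt_linear d12 d3 1 τ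
  have g1 := (hP.shift (k - 1 : ℤ)).reg (k - 2)
  have g2 := (hP.shift (-(k - 1 : ℤ))).reg k
  have g3 := (hM.shift (k + 1 : ℤ)).reg k
  have g4 := (hM.shift (-(k + 1 : ℤ))).reg (k + 2)
  have g5 := (hZ.shift k).reg (k - 1)
  have g6 := (hZ.shift (-k)).reg (k + 1)
  have g7 := hZ.axial.reg k
  have r1 := ((g1.const_mul (e / 2)).add (g2.const_mul (conj e / 2))).add (g5.const_mul (τ : ℂ))
  have r2 := ((g3.const_mul (e / 2)).add (g4.const_mul (conj e / 2))).add (g6.const_mul (τ : ℂ))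
  have r3 := ((g5.const_mul (e / 2)).add (g6.const_mul (conj e / 2))).add (g7.const_mul (τ : ℂ))
  have r := (((r1.const_mul (e / 2)).add (r2.const_mul (conj e / 2))).const_mul 1).add
    (r3.const_mul (τ : ℂ))
  have key := hC (v := (e, τ)) hv (Φ := angMode f k) (hf.reg k).1 (hf.reg k).2 r.1 r.2
    hΨ.meas hΨ.int hΨ.bdd (fun x => by simpa using hf.hasLineDerivAt_angMode k (e, τ) x) (by
      intro x
      have := d123 x
      simp only [one_mul] at this ⊢
      exact this)
  simp only [hf.norm_angMode] at key
  refine le_of_eq_of_le ?_ key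
  congr 1
  rw [newtonPair_add (((r1.const_mul (e / 2)).add (r2.const_mul (conj e / 2))).const_mul 1)
      (r3.const_mul (τ : ℂ)) hΨ, newtonPair_const_mul,
    newtonPair_add (r1.const_mul (e / 2)) (r2.const_mul (conj e / 2)) hΨ,
    newtonPair_const_mul, newtonPair_const_mul, newtonPair_const_mul,
    newtonPair_add ((g1.const_mul (e / 2)).add (g2.const_mul (conj e / 2)))
      (g5.const_mul (τ : ℂ)) hΨ,
    newtonPair_add (g1.const_mul (e / 2)) (g2.const_mul (conj e / 2)) hΨ,
    newtonPair_add ((g3.const_mul (e / 2)).add (g4.const_mul (conj e / 2)))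
      (g6.const_mul (τ : ℂ)) hΨ,
    newtonPair_add (g3.const_mul (e / 2)) (g4.const_mul (conj e / 2)) hΨ,
    newtonPair_add ((g5.const_mul (e / 2)).add (g6.const_mul (conj e / 2)))
      (g7.const_mul (τ : ℂ)) hΨ,
    newtonPair_add (g5.const_mul (e / 2)) (g6.const_mul (conj e / 2)) hΨ]
  simp only [newtonPair_const_mul, modePair]
  ring

end ModeBounds

section ModeSecond

open Topology ComplexConjugate

variable {f : ℝ → ℝ → ℝ} {Ψ : ℂ × ℝ → ℝ}

lemma norm_add_I_mul_le {a b c d : ℂ} {B t : ℝ} (ha : ‖a‖ ≤ B) (hb : ‖b‖ ≤ B) (hc : ‖c‖ ≤ B)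
    (hd : ‖d‖ ≤ B) (ht : |t| ≤ 2) : ‖(a - b) + t * Complex.I * (c - d)‖ ≤ 6 * B := by
  have h1 := norm_add_le (a - b) (t * Complex.I * (c - d))
  have h2 := norm_sub_le a b
  have h3 := norm_sub_le c d
  have h4 : ‖t * Complex.I * (c - d)‖ = |t| * ‖c - d‖ := by simp
  have h5 : |t| * ‖c - d‖ ≤ 2 * ‖c - d‖ := by gcongr
  linarith

lemma exists_norm_modePair_le {p q : ℝ} (hpq : p.HolderConjugate q) :
    ∃ C, 0 < C ∧ ∀ {f : ℝ → ℝ → ℝ}, TestFun f → ∀ {Ψ}, Tame Ψ → ∀ (k : ℤ),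
      ∃ B, B = C * ((∫ x : ℂ × ℝ, |f ‖x.1‖ x.2| ^ p) + ∫ x, |Ψ x| ^ q) ∧
      ‖modePair Ψ (dZ (dZ f)) k‖ ≤ B ∧
      ‖modePair Ψ (dShift (-(k - 1 : ℤ)) (dShift k f)) k
          + modePair Ψ (dShift (k + 1 : ℤ) (dShift (-k) f)) k‖ ≤ B ∧
      ‖modePair Ψ (dShift (k - 1 : ℤ) (dShift k f)) (k - 2)‖ ≤ B ∧
      ‖modePair Ψ (dShift (-(k + 1 : ℤ)) (dShift (-k) f)) (k + 2)‖ ≤ B ∧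
      ‖modePair Ψ (dShift k (dZ f)) (k - 1)‖ ≤ B ∧
      ‖modePair Ψ (dShift (-k) (dZ f)) (k + 1)‖ ≤ B := by
  obtain ⟨C, hC0, hC⟩ := exists_norm_second_le hpq
  refine ⟨6 * C, by positivity, fun {f} hf {Ψ} hΨ k => ⟨_, rfl, ?_⟩⟩
  have h := hC hf hΨ k
  rw [mul_assoc]
  set B := C * ((∫ x : ℂ × ℝ, |f ‖x.1‖ x.2| ^ p) + ∫ x, |Ψ x| ^ q)
  set zz := modePair Ψ (dZ (dZ f)) k
  set mp := modePair Ψ (dShift (-(k - 1 : ℤ)) (dShift k f)) k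
  set pm := modePair Ψ (dShift (k + 1 : ℤ) (dShift (-k) f)) k
  set pp := modePair Ψ (dShift (k - 1 : ℤ) (dShift k f)) (k - 2)
  set mm := modePair Ψ (dShift (-(k + 1 : ℤ)) (dShift (-k) f)) (k + 2)
  set pz := modePair Ψ (dShift k (dZ f)) (k - 1)
  set mz := modePair Ψ (dShift (-k) (dZ f)) (k + 1)
  have hn : ‖(1 + Complex.I) / 2‖ ^ 2 = 1 / 2 := by
    rw [← Complex.normSq_eq_norm_sq, Complex.normSq_apply]; norm_num
  have hn' : ‖(1 - Complex.I) / 2‖ ^ 2 = 1 / 2 := by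
    rw [← Complex.normSq_eq_norm_sq, Complex.normSq_apply]; norm_num
  have hI := Complex.I_sq
  have z1 := h 0 1 (by simp)
  have x1 := h 1 0 (by simp)
  have xi := h Complex.I 0 (by simp)
  have y1 := h ((1 + Complex.I) / 2) 0 (by rw [hn]; norm_num)
  have y2 := h ((1 - Complex.I) / 2) 0 (by rw [hn']; norm_num)
  have w1 := h (1 / 2) (1 / 2) (by norm_num)
  have w2 := h (1 / 2) (-1 / 2) (by norm_num)
  have w3 := h (Complex.I / 2) (1 / 2) (by norm_num)
  have w4 := h (Complex.I / 2) (-1 / 2) (by norm_num)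
  have hB : 0 ≤ B := (norm_nonneg _).trans z1
  refine ⟨?_, ?_, ?_, ?_, ?_, ?_⟩
  · have : ‖zz‖ ≤ B := by simpa using z1
    linarith
  · have := (norm_add_le _ _).trans (add_le_add x1 xi)
    have e : mp + pm = 2 * (((1 : ℂ) ^ 2 / 4 * pp + 1 * conj 1 / 4 * (mp + pm)
        + conj 1 ^ 2 / 4 * mm + (0:ℝ) * 1 * pz + (0:ℝ) * conj 1 * mz + (0:ℝ) ^ 2 * zz)
      + (Complex.I ^ 2 / 4 * pp + Complex.I * conj Complex.I / 4 * (mp + pm)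
        + conj Complex.I ^ 2 / 4 * mm + (0:ℝ) * Complex.I * pz + (0:ℝ) * conj Complex.I * mz
        + (0:ℝ) ^ 2 * zz)) := by
      simp only [map_one, Complex.conj_I, Complex.ofReal_zero]
      linear_combination (-(pp + mm) / 2 + (mp + pm) / 2) * hI
    rw [e, norm_mul, Complex.norm_two]
    linarith
  · refine le_of_eq_of_le ?_ (norm_add_I_mul_le (t := -2) x1 xi y1 y2 (by norm_num))
    congr 1
    simp only [map_one, map_add, map_sub, map_div₀, map_ofNat, Complex.conj_I, Complex.ofReal_zero]
    push_cast
    ring_nf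
    simp only [hI]
    ring
  · refine le_of_eq_of_le ?_ (norm_add_I_mul_le (t := 2) x1 xi y1 y2 (by norm_num))
    congr 1
    simp only [map_one, map_add, map_sub, map_div₀, map_ofNat, Complex.conj_I, Complex.ofReal_zero]
    push_cast
    ring_nf
    simp only [hI]
    ring
  · refine le_of_eq_of_le ?_ (norm_add_I_mul_le (t := -1) w1 w2 w3 w4 (by norm_num))
    congr 1
    simp only [map_one, map_div₀, map_ofNat, Complex.conj_I]
    push_cast
    ring_nf
    simp only [hI]
    ring
  · refine le_of_eq_of_le ?_ (norm_add_I_mul_le (t := 1) w1 w2 w3 w4 (by norm_num))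
    congr 1
    simp only [map_one, map_div₀, map_ofNat, Complex.conj_I]
    push_cast
    ring_nf
    simp only [hI]
    ring

/-- The weak bound for the second derivatives of `f` in a fixed angular mode. -/
lemma exists_norm_modePair_second_le {p q : ℝ} (hpq : p.HolderConjugate q) :
    ∃ C, 0 < C ∧ ∀ m : ℕ, 3 ≤ m → ∀ {f : ℝ → ℝ → ℝ}, TestFun f → ∀ {Ψ}, Tame Ψ →
      ∀ g ∈ ({dR (dR f), dR (dZ f), dZ (dZ f)} : Set (ℝ → ℝ → ℝ)), ‖modePair Ψ g m‖
        ≤ C * ((∫ x : ℂ × ℝ, |f ‖x.1‖ x.2| ^ p) + ∫ x, |Ψ x| ^ q) := by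
  obtain ⟨C, hC0, hC⟩ := exists_norm_modePair_le hpq
  refine ⟨3 * C, by positivity, fun m hm {f} hf {Ψ} hΨ g hg => ?_⟩
  obtain ⟨B, hB, zz, lap, -, -, -, -⟩ := hC hf hΨ m
  obtain ⟨-, rfl, -, -, -, mm, -, -⟩ := hC hf hΨ (m - 2)
  obtain ⟨-, rfl, -, -, pp, -, -, -⟩ := hC hf hΨ (m + 2)
  obtain ⟨-, rfl, -, -, -, -, -, mz⟩ := hC hf hΨ (m - 1)
  obtain ⟨-, rfl, -, -, -, -, pz, -⟩ := hC hf hΨ (m + 1)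
  rw [← hB] at mm pp mz pz
  rw [mul_assoc, ← hB]
  have hB0 : 0 ≤ B := (norm_nonneg _).trans zz
  have hm3 : (3:ℝ) ≤ m := by exact_mod_cast hm
  have hm1 : (m:ℝ) - 1 ≠ 0 := by linarith
  have hm1' : (m:ℝ) + 1 ≠ 0 := by linarith
  have hm0 : (m:ℝ) ≠ 0 := by linarith
  rw [sub_add_cancel] at mm mz
  rw [add_sub_cancel_right] at pp pz
  have bound : ∀ {a : ℝ} {w : ℂ}, 0 ≤ a → a ≤ 1 → ‖w‖ ≤ B → ‖(a : ℂ) * w‖ ≤ B := by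
    intro a w h0 h1 hw
    rw [norm_mul, Complex.norm_real, norm_eq_abs, abs_of_nonneg h0]
    nlinarith [norm_nonneg w]
  simp only [mem_insert_iff, mem_singleton_iff] at hg
  rcases hg with rfl | rfl | rfl
  · set F1 := dShift (-(((m : ℤ) - 2 + 1 : ℤ) : ℝ)) (dShift (-(((m : ℤ) - 2 : ℤ) : ℝ)) f)
    set F2 := dShift ((((m : ℤ) + 2 - 1 : ℤ) : ℝ)) (dShift ((((m : ℤ) + 2 : ℤ) : ℝ)) f)
    set F3 := dShift (-(((m : ℤ) - 1 : ℤ) : ℝ)) (dShift ((m : ℤ) : ℝ) f)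
    set F4 := dShift ((((m : ℤ) + 1 : ℤ) : ℝ)) (dShift (-((m : ℤ) : ℝ)) f)
    have t1 : TestFun F1 := (hf.shift _).shift _
    have t2 : TestFun F2 := (hf.shift _).shift _
    have t3 : TestFun F3 := (hf.shift _).shift _
    have t4 : TestFun F4 := (hf.shift _).shift _
    set α : ℝ := (m + 1) / (4 * (m - 1))
    set β : ℝ := (m - 1) / (4 * (m + 1))
    set κ : ℝ := (m ^ 2 - 3) / (4 * ((m - 1) * (m + 1)))
    have e : modePair Ψ (dR (dR f)) m = α * modePair Ψ F1 m + β * modePair Ψ F2 m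
        + κ * (modePair Ψ F3 m + modePair Ψ F4 m) := by
      have s12 := modePair_linear t1 t2 hΨ α β m
      have s34 := modePair_linear t3 t4 hΨ κ κ m
      have s := modePair_linear ((t1.const_mul α).add (t2.const_mul β))
        ((t3.const_mul κ).add (t4.const_mul κ)) hΨ 1 1 m
      rw [s12, s34] at s
      rw [mul_add, modePair_congr _ hf.radial.radial
        (((((t1.const_mul α).add (t2.const_mul β))).const_mul 1).add
        (((t3.const_mul κ).add (t4.const_mul κ)).const_mul 1)), s]
      · push_cast; ring
      · intro r hr z
        simp only [F1, F2, F3, F4, hf.dShift_dShift _ _ hr]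
        push_cast
        simp only [α, β, κ]
        field_simp
        ring
    have i1 : ‖(α : ℂ) * modePair Ψ F1 m‖ ≤ B := bound
      (div_nonneg (by linarith) (by linarith)) ((div_le_one (by linarith)).2 (by linarith)) mm
    have i2 : ‖(β : ℂ) * modePair Ψ F2 m‖ ≤ B := bound
      (div_nonneg (by linarith) (by linarith)) ((div_le_one (by linarith)).2 (by linarith)) pp
    have i3 : ‖(κ : ℂ) * (modePair Ψ F3 m + modePair Ψ F4 m)‖ ≤ B := bound
      (div_nonneg (by nlinarith) (by nlinarith)) ((div_le_one (by nlinarith)).2 (by nlinarith)) lap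
    rw [e]
    refine (norm_add₃_le).trans ?_
    linarith
  · set F1 := dShift (-(((m : ℤ) - 1 : ℤ) : ℝ)) (dZ f)
    set F2 := dShift ((((m : ℤ) + 1 : ℤ) : ℝ)) (dZ f)
    have t1 : TestFun F1 := hf.axial.shift _
    have t2 : TestFun F2 := hf.axial.shift _
    set α : ℝ := (m + 1) / (2 * m)
    set β : ℝ := (m - 1) / (2 * m)
    have e : modePair Ψ (dR (dZ f)) m = α * modePair Ψ F1 m + β * modePair Ψ F2 m := by
      rw [← modePair_linear t1 t2 hΨ]
      refine modePair_congr (fun r hr z => ?_) hf.axial.radial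
        ((t1.const_mul α).add (t2.const_mul β)) _
      simp only [F1, F2, dShift, α, β]
      push_cast
      field_simp
      ring
    have i1 : ‖(α : ℂ) * modePair Ψ F1 m‖ ≤ B := bound
      (div_nonneg (by linarith) (by linarith)) ((div_le_one (by linarith)).2 (by linarith)) mz
    have i2 : ‖(β : ℂ) * modePair Ψ F2 m‖ ≤ B := bound
      (div_nonneg (by linarith) (by linarith)) ((div_le_one (by linarith)).2 (by linarith)) pz
    rw [e]
    refine (norm_add_le _ _).trans ?_
    linarith
  · linarith

end ModeSecond

section Cylindrical

/-- The measure `r dr dz` on the half plane. -/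
def cylMeas : Measure (ℝ × ℝ) :=
  ((volume.restrict (Ioi (0:ℝ))).withDensity fun r => ENNReal.ofReal r).prod volume

instance : SigmaFinite ((volume.restrict (Ioi (0:ℝ))).withDensity fun r => ENNReal.ofReal r) :=
  SigmaFinite.withDensity_ofReal _

instance : SigmaFinite cylMeas := by unfold cylMeas; infer_instance

/-- The measure `dθ` on the circle. -/
def angMeas : Measure ℝ := volume.restrict (Ioo (-π) π)

instance : IsFiniteMeasure angMeas := by unfold angMeas; infer_instance

/-- Cylindrical coordinates. -/
def cylMap (p : (ℝ × ℝ) × ℝ) : ℂ × ℝ := (p.1.1 * Complex.exp (p.2 * Complex.I), p.1.2)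

lemma measurePreserving_polar :
    MeasurePreserving (fun p : ℝ × ℝ => (p.1 : ℂ) * Complex.exp (p.2 * Complex.I))
      (((volume.restrict (Ioi (0:ℝ))).withDensity fun r => ENNReal.ofReal r).prod angMeas)
      volume := by
  have hm : Measurable fun p : ℝ × ℝ => (p.1 : ℂ) * Complex.exp (p.2 * Complex.I) :=
    (by fun_prop : Continuous _).measurable
  refine ⟨hm, Measure.ext_of_lintegral _ fun f hf => ?_⟩
  rw [lintegral_map hf hm, angMeas, prod_withDensity_left (by fun_prop), Measure.prod_restrict,
    lintegral_withDensity_eq_lintegral_mul _ (by fun_prop)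
      (g := fun p : ℝ × ℝ => f ((p.1 : ℂ) * Complex.exp (p.2 * Complex.I))) (hf.comp hm),
    ← Complex.lintegral_comp_polarCoord_symm]
  simp [Complex.exp_mul_I, Measure.volume_eq_prod, polarCoord]

lemma measurePreserving_cylMap : MeasurePreserving cylMap (cylMeas.prod angMeas) volume := by
  set ρ := (volume.restrict (Ioi (0:ℝ))).withDensity fun r => ENNReal.ofReal r
  have h1 := measurePreserving_prodAssoc ρ (volume : Measure ℝ) angMeas
  have h2 : MeasurePreserving (Prod.map id Prod.swap) (ρ.prod ((volume : Measure ℝ).prod angMeas))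
      (ρ.prod (angMeas.prod volume)) :=
    (MeasurePreserving.id ρ).prod Measure.measurePreserving_swap
  have h3 := (measurePreserving_prodAssoc ρ angMeas (volume : Measure ℝ)).symm
  have h4 := measurePreserving_polar.prod (MeasurePreserving.id (volume : Measure ℝ))
  exact h4.comp (h3.comp (h2.comp h1))

lemma ae_cylMeas : ∀ᵐ p ∂cylMeas, 0 < p.1 := by
  have h : ∀ᵐ r ∂((volume.restrict (Ioi (0:ℝ))).withDensity fun r => ENNReal.ofReal r), 0 < r :=
    (withDensity_absolutelyContinuous _ _).ae_le (ae_restrict_mem measurableSet_Ioi)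
  exact Measure.quasiMeasurePreserving_fst.ae h

lemma ae_cylMeas_prod : ∀ᵐ p ∂(cylMeas.prod angMeas), 0 < p.1.1 :=
  Measure.quasiMeasurePreserving_fst.ae ae_cylMeas

lemma integral_cylMeas {h : ℝ × ℝ → ℝ} (hh : Integrable h cylMeas) :
    ∫ p, h p ∂cylMeas = ∫ r in Ioi (0:ℝ), ∫ z, h (r, z) * r := by
  rw [cylMeas, integral_prod _ hh, integral_withDensity_eq_integral_toReal_smul (by fun_prop)
    (by simp)]
  refine setIntegral_congr_fun measurableSet_Ioi fun r hr => ?_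
  simp only [smul_eq_mul]
  rw [ENNReal.toReal_ofReal (le_of_lt hr), integral_mul_const, mul_comm]

lemma norm_cylMap_fst {p : (ℝ × ℝ) × ℝ} (hp : 0 < p.1.1) : ‖(cylMap p).1‖ = p.1.1 := by
  simp [cylMap, Complex.norm_exp_ofReal_mul_I, abs_of_pos hp]

lemma direction_cylMap {p : (ℝ × ℝ) × ℝ} (hp : 0 < p.1.1) :
    (cylMap p).1 / ‖(cylMap p).1‖ = Complex.exp (p.2 * Complex.I) := by
  rw [norm_cylMap_fst hp, cylMap]
  have : (p.1.1 : ℂ) ≠ 0 := by exact_mod_cast hp.ne'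
  field_simp

lemma angMeas_real_univ : angMeas.real univ = 2 * π := by
  simp [angMeas, Measure.real, pi_pos.le]
  ring

/-- The lift of an axisymmetric function. -/
def axi (h : ℝ × ℝ → ℝ) (x : ℂ × ℝ) : ℝ := h (‖x.1‖, x.2)

lemma measurable_axi {h : ℝ × ℝ → ℝ} (hh : Measurable h) : Measurable (axi h) := by
  unfold axi; fun_prop

lemma axi_cylMap (h : ℝ × ℝ → ℝ) :
    (fun p => axi h (cylMap p)) =ᵐ[cylMeas.prod angMeas] fun p => h p.1 := by
  filter_upwards [ae_cylMeas_prod] with p hp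
  rw [axi, norm_cylMap_fst hp]
  rfl

lemma integrable_axi {h : ℝ × ℝ → ℝ} (hh : Measurable h) (hi : Integrable h cylMeas) :
    Integrable (axi h) := by
  rw [← measurePreserving_cylMap.integrable_comp (measurable_axi hh).aestronglyMeasurable]
  exact (hi.comp_fst angMeas).congr (axi_cylMap h).symm

lemma integral_axi {h : ℝ × ℝ → ℝ} (hh : Measurable h) :
    ∫ x, axi h x = 2 * π * ∫ p, h p ∂cylMeas := by
  rw [← measurePreserving_cylMap.map_eq, integral_map measurePreserving_cylMap.aemeasurable
    (measurable_axi hh).aestronglyMeasurable, integral_congr_ae (axi_cylMap h)]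
  have := integral_prod_mul (μ := cylMeas) (ν := angMeas) h fun _ => (1:ℝ)
  simp only [mul_one] at this
  rw [this]
  simp [angMeas_real_univ, mul_comm]

end Cylindrical

section Kernel

open ComplexConjugate

lemma dist3_cylMap {r z : ℝ} (hr : 0 < r) {p : ℝ × ℝ} (hp : 0 < p.1) (θ : ℝ) :
    dist3 (cylMap (p, θ)) (r, z)
      = √(r * p.1) * √(xiSq r p.1 z p.2 + 2 * (1 - Real.cos θ)) := by
  rw [dist3, ← Real.sqrt_mul (by positivity)]
  congr 1
  have h : ‖(cylMap (p, θ)).1 - ((r : ℝ) : ℂ)‖ ^ 2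
      = (p.1 * Real.cos θ - r) ^ 2 + (p.1 * Real.sin θ) ^ 2 := by
    rw [← Complex.normSq_eq_norm_sq, Complex.normSq_apply, cylMap]
    simp [Complex.exp_ofReal_mul_I_re, Complex.exp_ofReal_mul_I_im]
    ring
  simp only [h, xiSq]
  simp only [cylMap]
  field_simp
  have := Real.sin_sq_add_cos_sq θ
  linear_combination p.1 ^ 2 * this

lemma angMode_cylMap (g : ℝ → ℝ → ℝ) (m : ℕ) {p : ℝ × ℝ} (hp : 0 < p.1) (θ : ℝ) :
    angMode g m (cylMap (p, θ)) = g p.1 p.2 * Complex.exp ((m * θ : ℝ) * Complex.I) := by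
  have hp' : 0 < (p, θ).1.1 := hp
  rw [angMode, direction_cylMap hp', norm_cylMap_fst hp', ← Complex.exp_int_mul]
  simp only [cylMap]
  congr 2
  push_cast
  ring

lemma integral_angMeas {h : ℝ → ℂ} (hh : Integrable h angMeas) :
    ∫ θ, h θ ∂angMeas = ∫ θ in (0:ℝ)..π, (h θ + h (-θ)) := by
  have hi : IntervalIntegrable h volume (-π) π := by
    rw [intervalIntegrable_iff_integrableOn_Ioo_of_le (by linarith [pi_pos])]
    exact hh
  have h1 : IntervalIntegrable h volume (-π) 0 :=
    hi.mono_set (by rw [uIcc_of_le, uIcc_of_le] <;> first | exact Icc_subset_Icc_right pi_pos.le | linarith [pi_pos])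
  have h2 : IntervalIntegrable h volume 0 π :=
    hi.mono_set (by rw [uIcc_of_le, uIcc_of_le] <;> first | exact Icc_subset_Icc_left (by linarith [pi_pos]) | linarith [pi_pos])
  have h3 : IntervalIntegrable (fun θ => h (-θ)) volume 0 π := by
    simpa using ((IntervalIntegrable.iff_comp_neg (f := h)).1 h1).symm
  rw [intervalIntegral.integral_add h2 h3, intervalIntegral.integral_comp_neg, neg_zero, add_comm,
    intervalIntegral.integral_add_adjacent_intervals h1 h2,
    intervalIntegral.integral_of_le (by linarith [pi_pos]), integral_Ioc_eq_integral_Ioo, angMeas]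

lemma exp_add_exp_neg (t : ℝ) :
    Complex.exp (t * Complex.I) + Complex.exp ((-t : ℝ) * Complex.I) = ((2 * Real.cos t : ℝ) : ℂ) := by
  push_cast
  rw [Complex.cos]
  ring

/-- The Newtonian potential of a mode, at points of the half plane. -/
lemma integral_angMode_div_dist3 (g : ℝ → ℝ → ℝ) (m : ℕ) {r z : ℝ} (hr : 0 < r)
    (hi : Integrable fun y => angMode g m y * ((1 / (2 * π * dist3 y (r, z)) : ℝ) : ℂ)) :
    ∫ y, angMode g m y * ((1 / (2 * π * dist3 y (r, z)) : ℝ) : ℂ)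
      = ((2 * Lminv m g r z : ℝ) : ℂ) := by
  set G : ℂ × ℝ → ℂ := fun y => angMode g m y * ((1 / (2 * π * dist3 y (r, z)) : ℝ) : ℂ) with hG
  have hGc : Integrable (fun p => G (cylMap p)) (cylMeas.prod angMeas) :=
    (measurePreserving_cylMap.integrable_comp hi.aestronglyMeasurable).2 hi
  have hGp : ∀ p : ℝ × ℝ, 0 < p.1 → ∀ θ, G (cylMap (p, θ))
      = Complex.exp ((m * θ : ℝ) * Complex.I) * ((g p.1 p.2 /
        (2 * π * (√(r * p.1) * √(xiSq r p.1 z p.2 + 2 * (1 - Real.cos θ)))) : ℝ) : ℂ) := by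
    intro p hp θ
    simp only [hG]
    rw [angMode_cylMap g m hp, dist3_cylMap hr hp]
    push_cast
    ring
  set h : ℝ × ℝ → ℝ := fun p =>
    Fm m (xiSq r p.1 z p.2) * g p.1 p.2 / (π * √(r * p.1)) with hh
  have hae : (fun p => ∫ θ, G (cylMap (p, θ)) ∂angMeas) =ᵐ[cylMeas] fun p => (h p : ℂ) := by
    filter_upwards [hGc.prod_right_ae, ae_cylMeas] with p hint hp
    rw [integral_angMeas hint]
    have e : ∀ θ, G (cylMap (p, θ)) + G (cylMap (p, -θ))
        = (((g p.1 p.2 / (π * √(r * p.1))) * (Real.cos (m * θ) /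
          √(xiSq r p.1 z p.2 + 2 * (1 - Real.cos θ))) : ℝ) : ℂ) := by
      intro θ
      rw [hGp p hp, hGp p hp, Real.cos_neg, mul_neg, ← add_mul, exp_add_exp_neg, ← Complex.ofReal_mul]
      congr 1
      simp only [div_eq_mul_inv, mul_inv]
      ring
    simp only [e]
    rw [intervalIntegral.integral_ofReal, intervalIntegral.integral_const_mul]
    simp only [hh]
    rw [Fm]
    congr 1
    ring
  have hhi : Integrable h cylMeas := by
    have := (hGc.integral_prod_left.congr hae).re
    simpa using this
  rw [← measurePreserving_cylMap.map_eq, integral_map measurePreserving_cylMap.aemeasurable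
    (by rw [measurePreserving_cylMap.map_eq]; exact hi.aestronglyMeasurable), integral_prod _ hGc,
    integral_congr_ae hae, integral_complex_ofReal, integral_cylMeas hhi, Lminv]
  congr 1
  rw [← mul_assoc, ← integral_const_mul]
  refine setIntegral_congr_fun measurableSet_Ioi fun s (hs : 0 < s) => ?_
  rw [← integral_const_mul]
  congr 1
  ext t
  simp only [hh]
  have e1 : √(s / r) = s / √(r * s) := by
    rw [eq_div_iff (by positivity), ← Real.sqrt_mul (by positivity),
      show s / r * (r * s) = s ^ 2 by field_simp, Real.sqrt_sq hs.le]
  rw [e1]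
  field_simp

/-- Rotation of the first factor. -/
def rotEquiv (u : Circle) : ℂ × ℝ ≃ᵐ ℂ × ℝ :=
  (rotation u).toMeasurableEquiv.prodCongr (MeasurableEquiv.refl ℝ)

lemma measurePreserving_rotEquiv (u : Circle) : MeasurePreserving (rotEquiv u) volume volume :=
  (rotation u).measurePreserving.prod (MeasurePreserving.id volume)

lemma rotEquiv_apply (u : Circle) (y : ℂ × ℝ) : rotEquiv u y = (u * y.1, y.2) := rfl

lemma integral_angMode_div_dist3_general (g : ℝ → ℝ → ℝ) (m : ℕ) {x : ℂ × ℝ} (hx : x.1 ≠ 0)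
    (hi : Integrable fun y => angMode g m y * ((1 / (2 * π * dist3 y x) : ℝ) : ℂ)) :
    ∫ y, angMode g m y * ((1 / (2 * π * dist3 y x) : ℝ) : ℂ)
      = (x.1 / ‖x.1‖) ^ m * ((2 * Lminv m g ‖x.1‖ x.2 : ℝ) : ℂ) := by
  have hn : (‖x.1‖ : ℂ) ≠ 0 := by simpa using hx
  obtain ⟨u, hu⟩ : ∃ u : Circle, (u : ℂ) = x.1 / ‖x.1‖ :=
    ⟨⟨x.1 / ‖x.1‖, by simp [Submonoid.unitSphere, hx]⟩, rfl⟩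
  have hu0 : (u : ℂ) ≠ 0 := u.coe_ne_zero
  have e : ∀ y, angMode g m (rotEquiv u y) * ((1 / (2 * π * dist3 (rotEquiv u y) x) : ℝ) : ℂ)
      = (u : ℂ) ^ m * (angMode g m y * ((1 / (2 * π * dist3 y (‖x.1‖, x.2)) : ℝ) : ℂ)) := by
    intro y
    have e1 : dist3 (rotEquiv u y) x = dist3 y ((‖x.1‖ : ℂ), x.2) := by
      rw [dist3, dist3, rotEquiv_apply]
      have : (u : ℂ) * y.1 - x.1 = u * (y.1 - ‖x.1‖) := by
        rw [mul_sub, hu]; field_simp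
      simp only [this, norm_mul, Circle.norm_coe, one_mul]
    rw [e1, angMode, angMode, rotEquiv_apply]
    simp only [norm_mul, Circle.norm_coe, one_mul, zpow_natCast]
    rw [mul_div_assoc, mul_pow]
    ring
  have hi' := (measurePreserving_rotEquiv u).integrable_comp_emb
    (rotEquiv u).measurableEmbedding |>.2 hi
  rw [← (measurePreserving_rotEquiv u).integral_comp (rotEquiv u).measurableEmbedding]
  simp only [Function.comp_def, e] at hi' ⊢
  rw [integral_const_mul, integral_angMode_div_dist3 g m (norm_pos_iff.2 hx), hu]
  exact ((integrable_const_mul_iff (IsUnit.mk0 _ (pow_ne_zero _ hu0)) _).1 hi')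

end Kernel

section AxiPairing

/-- The real part of the `m`-th mode of a function on the half plane. -/
def axiCos (ψ : ℝ × ℝ → ℝ) (m : ℕ) (x : ℂ × ℝ) : ℝ := axi ψ x * ((x.1 / ‖x.1‖) ^ m).re

variable {ψ : ℝ × ℝ → ℝ} {m : ℕ} {g : ℝ → ℝ → ℝ}

lemma abs_axiCos_le (ψ : ℝ × ℝ → ℝ) (m : ℕ) (x : ℂ × ℝ) : |axiCos ψ m x| ≤ |axi ψ x| := by
  rw [axiCos, abs_mul]
  refine mul_le_of_le_one_right (abs_nonneg _) ((Complex.abs_re_le_norm _).trans ?_)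
  rw [norm_pow]
  refine pow_le_one₀ (norm_nonneg _) ?_
  by_cases h : x.1 = 0 <;> simp [h]

lemma tame_axiCos (hm : Measurable ψ) (hi : Integrable ψ cylMeas) (hb : ∃ M, ∀ p, |ψ p| ≤ M) :
    Tame (axiCos ψ m) := by
  have h1 : Measurable (axiCos ψ m) := by
    have := measurable_axi hm
    unfold axiCos
    fun_prop
  obtain ⟨M, hM⟩ := hb
  exact ⟨h1, (integrable_axi hm hi).mono h1.aestronglyMeasurable
    (.of_forall fun x => abs_axiCos_le ψ m x), M, fun x => (abs_axiCos_le ψ m x).trans (hM _)⟩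

lemma integral_cos_mul_exp_re (hm : m ≠ 0) :
    (∫ θ, ((Real.cos (m * θ) : ℝ) : ℂ) * Complex.exp ((m * θ : ℝ) * Complex.I) ∂angMeas).re
      = π := by
  have hc : Continuous fun θ : ℝ =>
    ((Real.cos (m * θ) : ℝ) : ℂ) * Complex.exp ((m * θ : ℝ) * Complex.I) := by fun_prop
  have hi : Integrable (fun θ : ℝ =>
      ((Real.cos (m * θ) : ℝ) : ℂ) * Complex.exp ((m * θ : ℝ) * Complex.I)) angMeas :=
    (hc.integrableOn_Icc (a := -π) (b := π)).mono_set Ioo_subset_Icc_self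
  rw [← RCLike.re_eq_complex_re, ← integral_re hi]
  have e : ∀ θ : ℝ, RCLike.re (((Real.cos (m * θ) : ℝ) : ℂ) *
      Complex.exp ((m * θ : ℝ) * Complex.I)) = Real.cos (m * θ) ^ 2 := by
    intro θ
    rw [RCLike.re_eq_complex_re, Complex.re_ofReal_mul, Complex.exp_ofReal_mul_I_re, sq]
  simp only [e]
  rw [angMeas, ← integral_Ioc_eq_integral_Ioo, ← intervalIntegral.integral_of_le
    (by linarith [pi_pos]), intervalIntegral.integral_comp_mul_left (fun t => Real.cos t ^ 2)
    (Nat.cast_ne_zero.2 hm), integral_cos_sq, mul_neg, Real.sin_neg, Real.sin_nat_mul_pi,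
    smul_eq_mul]
  have : (m : ℝ) ≠ 0 := Nat.cast_ne_zero.2 hm
  field_simp
  ring

lemma re_modePair_axiCos (hg : TestFun g) (hm : m ≠ 0) (hΨ : Tame (axiCos ψ m)) :
    (modePair (axiCos ψ m) g m).re
      = 2 * π * ∫ p : ℝ × ℝ, ψ p * Lminv m g p.1 p.2 ∂cylMeas := by
  have hI := (hg.reg m).integrable hΨ
  have hI' := hI.integral_prod_left
  have hae : ∀ᵐ x : ℂ × ℝ, x.1 ≠ 0 →
      ∫ y, angMode g m y * ((axiCos ψ m x / (2 * π * dist3 y x) : ℝ) : ℂ)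
      = axiCos ψ m x * ((x.1 / ‖x.1‖) ^ m * ((2 * Lminv m g ‖x.1‖ x.2 : ℝ) : ℂ)) := by
    filter_upwards [hI.prod_right_ae] with x hx hx0
    by_cases h0 : axiCos ψ m x = 0
    · simp [h0]
    have e : ∀ y, angMode g m y * ((axiCos ψ m x / (2 * π * dist3 y x) : ℝ) : ℂ)
        = axiCos ψ m x * (angMode g m y * ((1 / (2 * π * dist3 y x) : ℝ) : ℂ)) := by
      intro y; push_cast; ring
    simp only [e] at hx ⊢
    rw [integral_const_mul, integral_angMode_div_dist3_general g m hx0]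
    exact (integrable_const_mul_iff (IsUnit.mk0 _ (by exact_mod_cast h0)) _).1 hx
  have hae2 : (fun q => ∫ y, angMode g m y *
        ((axiCos ψ m (cylMap q) / (2 * π * dist3 y (cylMap q)) : ℝ) : ℂ))
      =ᵐ[cylMeas.prod angMeas] fun q => ((2 * (ψ q.1 * Lminv m g q.1.1 q.1.2) : ℝ) : ℂ) *
        (((Real.cos (m * q.2) : ℝ) : ℂ) * Complex.exp ((m * q.2 : ℝ) * Complex.I)) := by
    filter_upwards [measurePreserving_cylMap.quasiMeasurePreserving.ae hae, ae_cylMeas_prod]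
      with q hq hq0
    have hd : ((cylMap q).1 / ‖(cylMap q).1‖) ^ m = Complex.exp ((m * q.2 : ℝ) * Complex.I) := by
      rw [direction_cylMap hq0, ← Complex.exp_nat_mul]
      congr 1; push_cast; ring
    rw [hq (by rw [← norm_pos_iff, norm_cylMap_fst hq0]; exact hq0), axiCos, hd,
      Complex.exp_ofReal_mul_I_re, axi, norm_cylMap_fst hq0]
    simp only [cylMap]
    push_cast
    ring
  have hmp : modePair (axiCos ψ m) g m = ∫ x, ∫ y, angMode g m y *
      ((axiCos ψ m x / (2 * π * dist3 y x) : ℝ) : ℂ) := integral_prod _ hI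
  rw [hmp]
  rw [← measurePreserving_cylMap.map_eq] at hI'
  have := integral_map measurePreserving_cylMap.aemeasurable hI'.aestronglyMeasurable
  rw [measurePreserving_cylMap.map_eq] at this
  rw [this, integral_congr_ae hae2, integral_prod_mul
    (fun p : ℝ × ℝ => ((2 * (ψ p * Lminv m g p.1 p.2) : ℝ) : ℂ))
    (fun θ : ℝ => ((Real.cos (m * θ) : ℝ) : ℂ) * Complex.exp ((m * θ : ℝ) * Complex.I)),
    integral_complex_ofReal, Complex.re_ofReal_mul, integral_cos_mul_exp_re hm, integral_const_mul]
  ring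

/-- The `L^p` bound for second derivatives in weak form on the half plane. -/
lemma exists_abs_integral_mul_Lminv_le {p q : ℝ} (hpq : p.HolderConjugate q) :
    ∃ C, 0 < C ∧ ∀ m : ℕ, 3 ≤ m → ∀ {f : ℝ → ℝ → ℝ}, TestFun f →
      ∀ {ψ : ℝ × ℝ → ℝ}, Measurable ψ → Integrable ψ cylMeas → (∃ M, ∀ p, |ψ p| ≤ M) →
      Integrable (fun x => |ψ x| ^ q) cylMeas →
      ∀ g ∈ ({dR (dR f), dR (dZ f), dZ (dZ f)} : Set (ℝ → ℝ → ℝ)),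
      |∫ x, ψ x * Lminv m g x.1 x.2 ∂cylMeas|
        ≤ C * ((∫ x, |f x.1 x.2| ^ p ∂cylMeas) + ∫ x, |ψ x| ^ q ∂cylMeas) := by
  obtain ⟨C, hC0, hC⟩ := exists_norm_modePair_second_le hpq
  refine ⟨C, hC0, fun m hm {f} hf {ψ} hψ hi hb hq g hgm => ?_⟩
  have hΨ := tame_axiCos (m := m) hψ hi hb
  have hg : TestFun g := by
    rcases hgm with rfl | rfl | rfl
    exacts [hf.radial.radial, hf.axial.radial, hf.axial.axial]
  have key := (Complex.abs_re_le_norm _).trans (hC m hm hf hΨ g hgm)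
  rw [re_modePair_axiCos hg (by omega) hΨ] at key
  have hfm : Measurable fun x : ℝ × ℝ => |f x.1 x.2| ^ p := by
    have : Measurable (Function.uncurry f) := hf.1.continuous.measurable
    exact (this.norm).pow_const p
  have h1 : ∫ x : ℂ × ℝ, |f ‖x.1‖ x.2| ^ p = 2 * π * ∫ x, |f x.1 x.2| ^ p ∂cylMeas :=
    integral_axi hfm
  have hqm : Measurable fun x => |ψ x| ^ q := hψ.norm.pow_const q
  have h2 : ∫ x, |axiCos ψ m x| ^ q ≤ 2 * π * ∫ x, |ψ x| ^ q ∂cylMeas := by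
    rw [← integral_axi hqm]
    exact integral_mono_of_nonneg (.of_forall fun x => by positivity) (integrable_axi hqm hq)
      (.of_forall fun x => rpow_le_rpow (abs_nonneg _) (abs_axiCos_le ψ m x) hpq.symm.nonneg)
  rw [abs_mul, abs_of_pos (by positivity : 0 < 2 * π), h1] at key
  have h3 := key.trans (mul_le_mul_of_nonneg_left (add_le_add_right h2 _) hC0.le)
  rw [← mul_add, mul_left_comm] at h3
  exact le_of_mul_le_mul_left h3 (by positivity)

end AxiPairing

section Duality

open Filter

/-- A weak bound against bounded test functions yields an `L^p` bound. -/
lemma integrable_rpow_of_weak_bound {α : Type*} [MeasurableSpace α] {μ : Measure α} [SigmaFinite μ]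
    {p q C A : ℝ} (hpq : p.HolderConjugate q) (hC : 0 < C) {w : α → ℝ} (hw : Measurable w)
    (h : ∀ {ψ : α → ℝ}, Measurable ψ → Integrable ψ μ → (∃ M, ∀ x, |ψ x| ≤ M) →
      Integrable (fun x => |ψ x| ^ q) μ → |∫ x, ψ x * w x ∂μ| ≤ C * (A + ∫ x, |ψ x| ^ q ∂μ)) :
    Integrable (fun x => |w x| ^ p) μ ∧
      ∫ x, |w x| ^ p ∂μ ≤ 2 * C * (2 * C) ^ (1 / (q - 1)) * A := by
  have hp0 := hpq.pos
  have hq0 := hpq.symm.pos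
  have hq1 : 0 < q - 1 := hpq.symm.sub_one_pos
  have hp1 : 0 < p - 1 := hpq.sub_one_pos
  set τ : ℝ := ((2 * C) ^ (1 / (q - 1)))⁻¹ with hτ
  have hτ0 : 0 < τ := by positivity
  have hτq : C * τ ^ q = τ / 2 := by
    have : τ ^ (q - 1) = (2 * C)⁻¹ := by
      rw [hτ, Real.inv_rpow (by positivity), ← Real.rpow_mul (by positivity),
        one_div_mul_cancel hq1.ne', Real.rpow_one]
    rw [show q = (q - 1) + 1 by ring, Real.rpow_add hτ0, this, Real.rpow_one]
    field_simp
  set S : ℕ → Set α := fun n => {x | |w x| ≤ n} ∩ spanningSets μ n with hS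
  have hSm : ∀ n, MeasurableSet (S n) := fun n =>
    (measurableSet_le hw.norm measurable_const).inter (measurableSet_spanningSets μ n)
  have hcov : AECover μ atTop S := by
    refine ⟨.of_forall fun x => ?_, hSm⟩
    obtain ⟨k, hk⟩ := exists_nat_ge |w x|
    filter_upwards [eventually_ge_atTop (max k (spanningSetsIndex μ x))] with n hn
    refine ⟨hk.trans (by exact_mod_cast (le_max_left _ _).trans hn), ?_⟩
    exact monotone_spanningSets μ ((le_max_right _ _).trans hn) (mem_spanningSetsIndex μ x)
  have hfin : ∀ n, μ (S n) < ⊤ := fun n =>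
    (measure_mono inter_subset_right).trans_lt (measure_spanningSets_lt_top μ n)
  have hint : ∀ n, IntegrableOn (fun x => |w x| ^ p) (S n) μ := by
    intro n
    refine Measure.integrableOn_of_bounded (M := (n : ℝ) ^ p) (hfin n).ne
      (hw.norm.pow_const p).aestronglyMeasurable ?_
    filter_upwards [ae_restrict_mem (hSm n)] with x hx
    rw [norm_of_nonneg (by positivity)]
    exact rpow_le_rpow (abs_nonneg _) hx.1 hp0.le
  have hbound : ∀ n, ∫ x in S n, |w x| ^ p ∂μ ≤ 2 * C * (2 * C) ^ (1 / (q - 1)) * A := by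
    intro n
    set φ : α → ℝ := fun x => τ * (w x * |w x| ^ (p - 2))
    have habs : ∀ x, |φ x| = τ * |w x| ^ (p - 1) := by
      intro x
      simp only [φ]
      rw [abs_mul, abs_mul, abs_of_pos hτ0, abs_of_nonneg (by positivity : 0 ≤ |w x| ^ (p - 2))]
      congr 1
      rcases eq_or_ne (w x) 0 with h0 | h0
      · simp [h0, Real.zero_rpow hp1.ne']
      · rw [← Real.rpow_one_add' (abs_nonneg _) (by linarith)]
        congr 1; ring
    have hmul : ∀ x, φ x * w x = τ * |w x| ^ p := by
      intro x
      simp only [φ]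
      rw [mul_assoc]
      congr 1
      rw [mul_right_comm, ← sq, ← sq_abs]
      rcases eq_or_ne (w x) 0 with h0 | h0
      · simp [h0, Real.zero_rpow hp0.ne']
      · rw [← Real.rpow_natCast, ← Real.rpow_add (abs_pos.2 h0)]
        congr 1; push_cast; ring
    have hpow : ∀ x, |φ x| ^ q = τ ^ q * |w x| ^ p := by
      intro x
      rw [habs, Real.mul_rpow hτ0.le (by positivity), ← Real.rpow_mul (abs_nonneg _),
        hpq.sub_one_mul_conj]
    have hφm : Measurable φ := measurable_const.mul (hw.mul (hw.norm.pow_const _))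
    set ψ := (S n).indicator φ
    have hψm : Measurable ψ := hφm.indicator (hSm n)
    have hψb : ∀ x ∈ S n, ‖φ x‖ ≤ τ * (n : ℝ) ^ (p - 1) := fun x hx => by
      rw [norm_eq_abs, habs]
      exact mul_le_mul_of_nonneg_left (rpow_le_rpow (abs_nonneg _) hx.1 hp1.le) hτ0.le
    have hψi : Integrable ψ μ := by
      rw [integrable_indicator_iff (hSm n)]
      refine Measure.integrableOn_of_bounded (hfin n).ne hφm.aestronglyMeasurable
        ((ae_restrict_mem (hSm n)).mono hψb)
    have e1 : (fun x => |ψ x| ^ q) = (S n).indicator fun x => τ ^ q * |w x| ^ p := by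
      ext x
      by_cases hx : x ∈ S n
      · simp [ψ, hx, hpow]
      · simp [ψ, hx, Real.zero_rpow hq0.ne']
    have e2 : (fun x => ψ x * w x) = (S n).indicator fun x => τ * |w x| ^ p := by
      ext x
      by_cases hx : x ∈ S n
      · simp [ψ, hx, hmul]
      · simp [ψ, hx]
    have key := h hψm hψi ⟨τ * (n : ℝ) ^ (p - 1), fun x => by
        by_cases hx : x ∈ S n
        · simpa [ψ, hx] using hψb x hx
        · simp only [ψ, hx, not_false_eq_true, indicator_of_notMem, abs_zero]; positivity⟩ (by
      rw [e1, integrable_indicator_iff (hSm n)]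
      exact (hint n).const_mul _)
    rw [e1, e2, integral_indicator (hSm n), integral_indicator (hSm n), integral_const_mul,
      integral_const_mul] at key
    have k1 := (le_abs_self _).trans key
    rw [mul_add, ← mul_assoc, hτq] at k1
    have k2 : τ * ∫ x in S n, |w x| ^ p ∂μ ≤ 2 * C * A := by linarith
    rw [show (2 * C) ^ (1 / (q - 1)) = τ⁻¹ by rw [hτ, inv_inv]]
    calc _ = τ⁻¹ * (τ * ∫ x in S n, |w x| ^ p ∂μ) := by rw [inv_mul_cancel_left₀ hτ0.ne']
      _ ≤ τ⁻¹ * (2 * C * A) := by gcongr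
      _ = _ := by ring
  have hi := hcov.integrable_of_integral_bounded_of_nonneg_ae _ hint
    (.of_forall fun x => by positivity) (.of_forall hbound)
  exact ⟨hi, le_of_tendsto' (hcov.integral_tendsto_of_countably_generated hi) hbound⟩

end Duality

section Measurability

lemma measurable_Lminv (m : ℕ) {g : ℝ → ℝ → ℝ} (hg : Measurable (Function.uncurry g)) :
    Measurable fun x : ℝ × ℝ => Lminv m g x.1 x.2 := by
  have hF : Measurable (Fm m) := by
    have : Measurable (Function.uncurry fun (s θ : ℝ) =>
        Real.cos (m * θ) / √(s + 2 * (1 - Real.cos θ))) := by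
      unfold Function.uncurry; fun_prop
    unfold Fm
    simp only [intervalIntegral.integral_of_le pi_pos.le]
    exact this.stronglyMeasurable.integral_prod_right.measurable
  have hK : Measurable fun y : ((ℝ × ℝ) × ℝ) × ℝ =>
      Fm m (xiSq y.1.1.1 y.1.2 y.1.1.2 y.2) * g y.1.2 y.2 * √(y.1.2 / y.1.1.1) := by
    have h1 : Measurable fun y : ((ℝ × ℝ) × ℝ) × ℝ => g y.1.2 y.2 :=
      hg.comp (measurable_fst.snd.prodMk measurable_snd)
    have h2 : Measurable fun y : ((ℝ × ℝ) × ℝ) × ℝ => xiSq y.1.1.1 y.1.2 y.1.1.2 y.2 := by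
      unfold xiSq; fun_prop
    exact ((hF.comp h2).mul h1).mul (by fun_prop)
  have h1 : StronglyMeasurable fun y : (ℝ × ℝ) × ℝ => ∫ z' : ℝ,
      Fm m (xiSq y.1.1 y.2 y.1.2 z') * g y.2 z' * √(y.2 / y.1.1) :=
    hK.stronglyMeasurable.integral_prod_right'
  have h2 : StronglyMeasurable fun x : ℝ × ℝ => ∫ r' in Ioi (0:ℝ), ∫ z' : ℝ,
      Fm m (xiSq x.1 r' x.2 z') * g r' z' * √(r' / x.1) :=
    h1.integral_prod_right'
  exact measurable_const.mul h2.measurable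

end Measurability

section Conclusion

instance : IsFiniteMeasureOnCompacts cylMeas := by
  have : IsLocallyFiniteMeasure
      ((volume.restrict (Ioi (0:ℝ))).withDensity fun r => ENNReal.ofReal r) :=
    IsLocallyFiniteMeasure.withDensity_ofReal continuous_id
  unfold cylMeas
  infer_instance

lemma cylLp_nonneg (p : ℝ) (f : ℝ → ℝ → ℝ) : 0 ≤ cylLp p f :=
  rpow_nonneg (mul_nonneg (by positivity) (setIntegral_nonneg measurableSet_Ioi
    fun r (hr : 0 < r) => integral_nonneg fun z => by positivity)) _

lemma cylLp_eq {p : ℝ} {f : ℝ → ℝ → ℝ}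
    (hf : Integrable (fun x : ℝ × ℝ => |f x.1 x.2| ^ p) cylMeas) :
    cylLp p f = (2 * π * ∫ x, |f x.1 x.2| ^ p ∂cylMeas) ^ (1 / p) := by
  rw [cylLp, integral_cylMeas hf]

lemma TestFun.integrable_rpow {f : ℝ → ℝ → ℝ} (hf : TestFun f) {p : ℝ} (hp : 0 < p) :
    Integrable (fun x : ℝ × ℝ => |f x.1 x.2| ^ p) cylMeas := by
  refine Continuous.integrable_of_hasCompactSupport ?_ ?_
  · exact (hf.1.continuous.abs).rpow_const fun _ => .inr hp.le
  · exact hf.2.1.comp_left (g := fun t : ℝ => |t| ^ p) (by simp [Real.zero_rpow hp.ne'])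

/-- `L_m^{-1}` of a second derivative is bounded on `L^p`, uniformly in `m`. -/
lemma exists_cylLp_Lminv_le {p : ℝ} (hp : 1 < p) :
    ∃ C, 0 < C ∧ ∀ m : ℕ, 3 ≤ m → ∀ {f : ℝ → ℝ → ℝ}, TestFun f →
      ∀ g ∈ ({dR (dR f), dR (dZ f), dZ (dZ f)} : Set (ℝ → ℝ → ℝ)),
      cylLp p (Lminv m g) ≤ C * cylLp p f := by
  have hpq : p.HolderConjugate (p.conjExponent) := .conjExponent hp
  obtain ⟨C, hC0, hC⟩ := exists_abs_integral_mul_Lminv_le hpq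
  set K := 2 * C * (2 * C) ^ (1 / (p.conjExponent - 1))
  have hK : 0 < K := by positivity
  refine ⟨K ^ (1 / p), by positivity, fun m hm {f} hf g hgm => ?_⟩
  have hg : TestFun g := by
    rcases hgm with rfl | rfl | rfl
    exacts [hf.radial.radial, hf.axial.radial, hf.axial.axial]
  obtain ⟨hi, hle⟩ := integrable_rpow_of_weak_bound hpq hC0
    (measurable_Lminv m hg.1.continuous.measurable)
    fun hψ h1 h2 h3 => hC m hm hf hψ h1 h2 h3 g hgm
  have hf0 : 0 ≤ ∫ x, |f x.1 x.2| ^ p ∂cylMeas := integral_nonneg fun x => by positivity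
  have hw0 : 0 ≤ ∫ x, |Lminv m g x.1 x.2| ^ p ∂cylMeas := integral_nonneg fun x => by positivity
  rw [cylLp_eq hi, cylLp_eq (hf.integrable_rpow hpq.pos),
    ← Real.mul_rpow hK.le (by positivity)]
  refine Real.rpow_le_rpow (by positivity) ?_ (by have := hpq.pos; positivity)
  rw [mul_left_comm]
  exact mul_le_mul_of_nonneg_left hle (by positivity)

end Conclusion

/-- Proposition 2.7 (lemLmRiesz): `L^p` bounds for `L_m^{-1} ∇̃∇̃`, for each of the three
second derivatives `∂_r²`, `∂_r∂_z`, `∂_z²` separately. -/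
theorem Lminv_double_Riesz (p : ℝ) (hp1 : 1 < p) :
    ∃ C : ℝ, 0 < C ∧ ∀ m : ℕ, 3 ≤ m → ∀ f : ℝ → ℝ → ℝ, TestFun f →
      (cylLp p (Lminv m (fun r z => deriv (fun s => deriv (fun s' => f s' z) s) r))
          ≤ C * (cylLp p f
            + cylLp p (Lminv m (fun r z => (1/r) * deriv (fun s => f s z) r))
            + cylLp p (Lminv m (fun r z => (1/r) * deriv (fun s => f r s) z)))) ∧
      (cylLp p (Lminv m (fun r z => deriv (fun s => deriv (fun s' => f s s') z) r))
          ≤ C * (cylLp p f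
            + cylLp p (Lminv m (fun r z => (1/r) * deriv (fun s => f s z) r))
            + cylLp p (Lminv m (fun r z => (1/r) * deriv (fun s => f r s) z)))) ∧
      (cylLp p (Lminv m (fun r z => deriv (fun s => deriv (fun s' => f r s') s) z))
          ≤ C * (cylLp p f
            + cylLp p (Lminv m (fun r z => (1/r) * deriv (fun s => f s z) r))
            + cylLp p (Lminv m (fun r z => (1/r) * deriv (fun s => f r s) z)))) := by
  obtain ⟨C, hC0, hC⟩ := exists_cylLp_Lminv_le hp1
  refine ⟨C, hC0, fun m hm f hf => ?_⟩
  have e1 : (fun r z => deriv (fun s => deriv (fun s' => f s' z) s) r) = dR (dR f) := by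
    ext r z
    simp only [(hf.hasDerivAt_fst _ z).deriv, (hf.radial.hasDerivAt_fst r z).deriv]
  have e2 : (fun r z => deriv (fun s => deriv (fun s' => f s s') z) r) = dR (dZ f) := by
    ext r z
    simp only [(hf.hasDerivAt_snd _ z).deriv, (hf.axial.hasDerivAt_fst r z).deriv]
  have e3 : (fun r z => deriv (fun s => deriv (fun s' => f r s') s) z) = dZ (dZ f) := by
    ext r z
    simp only [(hf.hasDerivAt_snd r _).deriv, (hf.axial.hasDerivAt_snd r z).deriv]
  rw [e1, e2, e3]
  have h : ∀ g ∈ ({dR (dR f), dR (dZ f), dZ (dZ f)} : Set (ℝ → ℝ → ℝ)),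
      cylLp p (Lminv m g) ≤ C * (cylLp p f
        + cylLp p (Lminv m (fun r z => (1/r) * deriv (fun s => f s z) r))
        + cylLp p (Lminv m (fun r z => (1/r) * deriv (fun s => f r s) z))) := fun g hg =>
    (hC m hm hf g hg).trans (mul_le_mul_of_nonneg_left
      (by linarith [cylLp_nonneg p (Lminv m (fun r z => (1/r) * deriv (fun s => f s z) r)),
        cylLp_nonneg p (Lminv m (fun r z => (1/r) * deriv (fun s => f r s) z))]) hC0.le)
  exact ⟨h _ (by simp), h _ (by simp), h _ (by simp)⟩

end
end

section
/- For every integer m ≥ 0 and every s > 4, one has s^{m + 1/2} |F_m(s)| ≤ 4^m π. -/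
open Real MeasureTheory

noncomputable section

theorem integral_cos_nat_mul_eq_zero {m : ℕ} (hm : 0 < m) :
    ∫ θ in (0:ℝ)..Real.pi, Real.cos (m * θ) = 0 := by
  have hm' : (m : ℝ) ≠ 0 := by positivity
  rw [intervalIntegral.integral_comp_mul_left (fun x => Real.cos x) hm']
  simp

/-- `cos (mθ)` is orthogonal on `[0, π]` to the powers of `cos θ + 1` of degree less than `m`. -/
theorem integral_cos_mul_cos_add_one_pow (k : ℕ) : ∀ {m : ℕ}, k < m →
    ∫ θ in (0:ℝ)..Real.pi, Real.cos (m * θ) * (Real.cos θ + 1) ^ k = 0 := by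
  induction k with
  | zero =>
    intro m hm
    simpa using integral_cos_nat_mul_eq_zero hm
  | succ k ih =>
    intro m hm
    obtain ⟨n, rfl⟩ : ∃ n, m = n + 1 := ⟨m - 1, by omega⟩
    have key : ∀ θ : ℝ, Real.cos ((n + 1 : ℕ) * θ) * (Real.cos θ + 1) ^ (k + 1) =
        Real.cos ((n + 1 : ℕ) * θ) * (Real.cos θ + 1) ^ k +
          (1 / 2) * (Real.cos ((n + 2 : ℕ) * θ) * (Real.cos θ + 1) ^ k) +
          (1 / 2) * (Real.cos (n * θ) * (Real.cos θ + 1) ^ k) := by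
      intro θ
      have h1 : Real.cos ((n + 2 : ℕ) * θ) = Real.cos ((n + 1 : ℕ) * θ + θ) := by
        congr 1; push_cast; ring
      have h2 : Real.cos (n * θ) = Real.cos ((n + 1 : ℕ) * θ - θ) := by
        congr 1; push_cast; ring
      rw [h1, h2, Real.cos_add, Real.cos_sub]
      ring
    have hi : ∀ j : ℕ, IntervalIntegrable
        (fun θ : ℝ => Real.cos (j * θ) * (Real.cos θ + 1) ^ k) volume 0 Real.pi := fun j =>
      Continuous.intervalIntegrable (by fun_prop) _ _
    simp_rw [key]
    rw [intervalIntegral.integral_add ((hi _).add ((hi _).const_mul _)) ((hi _).const_mul _),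
      intervalIntegral.integral_add (hi _) ((hi _).const_mul _),
      intervalIntegral.integral_const_mul, intervalIntegral.integral_const_mul,
      ih (by omega), ih (by omega), ih (by omega)]
    simp

theorem iteratedDerivWithin_rpow_neg_half {s b : ℝ} (hs : 0 < s) (hb : -1 < b) (hb1 : b ≤ 1) (n : ℕ) :
    Set.EqOn
      (iteratedDerivWithin n (fun x : ℝ => (s + 2 * (1 - x)) ^ (-(1 / 2) : ℝ)) (Set.Icc (-1) b))
      (fun x => (∏ j ∈ Finset.range n, (2 * (j : ℝ) + 1)) *
        (s + 2 * (1 - x)) ^ (-((n : ℝ) + 1 / 2)))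
      (Set.Icc (-1) b) := by
  induction n with
  | zero => intro x _; simp
  | succ n ih =>
    intro x hx
    have hpos : 0 < s + 2 * (1 - x) := by linarith [hx.2]
    rw [iteratedDerivWithin_succ, derivWithin_congr ih (ih hx)]
    have h1 : HasDerivAt (fun x : ℝ => s + 2 * (1 - x)) (-2) x := by
      simpa using (((hasDerivAt_id x).const_sub 1).const_mul 2).const_add s
    have h2 := (h1.rpow_const (p := -((n : ℝ) + 1 / 2)) (Or.inl hpos.ne')).const_mul
      (∏ j ∈ Finset.range n, (2 * (j : ℝ) + 1))
    rw [h2.hasDerivWithinAt.derivWithin (uniqueDiffOn_Icc hb x hx),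
      Finset.prod_range_succ]
    have h3 : -((n : ℝ) + 1 / 2) - 1 = -(((n + 1 : ℕ) : ℝ) + 1 / 2) := by push_cast; ring
    rw [h3]
    ring

theorem prod_odd_le_two_pow_mul_factorial (n : ℕ) :
    ∏ j ∈ Finset.range n, (2 * (j : ℝ) + 1) ≤ 2 ^ n * (n.factorial : ℝ) := by
  induction n with
  | zero => simp
  | succ n ih =>
    rw [Finset.prod_range_succ, Nat.factorial_succ]
    calc _ ≤ 2 ^ n * (n.factorial : ℝ) * (2 * (n : ℝ) + 2) := by gcongr; norm_num
      _ = _ := by push_cast; ring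

/-- Error bound for the Taylor polynomial of `(s + 2(1 - x))^(-1/2)` at `-1`. -/
theorem abs_rpow_neg_half_sub_taylor_le {s : ℝ} (hs : 0 < s) (n : ℕ) {x : ℝ}
    (hx : x ∈ Set.Icc (-1 : ℝ) 1) :
    |(s + 2 * (1 - x)) ^ (-(1 / 2) : ℝ) -
      taylorWithinEval (fun x : ℝ => (s + 2 * (1 - x)) ^ (-(1 / 2) : ℝ)) n (Set.Icc (-1) 1) (-1) x|
      ≤ 4 ^ (n + 1) * s ^ (-(((n + 1 : ℕ) : ℝ) + 1 / 2)) := by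
  set f : ℝ → ℝ := fun x : ℝ => (s + 2 * (1 - x)) ^ (-(1 / 2) : ℝ) with hf
  have hcd : ContDiffOn ℝ (n + 1 : ℕ) f (Set.Icc (-1) 1) := by
    intro y hy
    refine ContDiffWithinAt.rpow_const_of_ne (by fun_prop) ?_
    have := hy.2
    linarith
  rcases hx.1.eq_or_lt with rfl | hlt
  · have h0 : f (-1) - taylorWithinEval f n (Set.Icc (-1) 1) (-1) (-1) = 0 := by simp
    change |f (-1) - _| ≤ _
    rw [h0, abs_zero]
    positivity
  have hlag : ∃ y ∈ Set.Icc (-1 : ℝ) 1, f x - taylorWithinEval f n (Set.Icc (-1) 1) (-1) x =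
      iteratedDerivWithin (n + 1) f (Set.Icc (-1) 1) y * (x - -1) ^ (n + 1) /
        ((n + 1).factorial : ℝ) := by
    have hsub : Set.Icc (-1) x ⊆ Set.Icc (-1 : ℝ) 1 := Set.Icc_subset_Icc_right hx.2
    have hu : UniqueDiffOn ℝ (Set.Icc (-1) x) := uniqueDiffOn_Icc hlt
    have heq : taylorWithinEval f n (Set.Icc (-1) 1) (-1) x =
        taylorWithinEval f n (Set.Icc (-1) x) (-1) x := by
      rw [taylor_within_apply, taylor_within_apply]
      refine Finset.sum_congr rfl fun k _ => ?_
      rw [iteratedDerivWithin_rpow_neg_half hs (by norm_num) le_rfl k (by simp),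
        iteratedDerivWithin_rpow_neg_half hs hlt hx.2 k (by simpa using hx.1)]
    have hlag := taylor_mean_remainder_lagrange (f := f) (n := n) hlt.ne
    rw [Set.uIcc_of_le hx.1, Set.uIoo_of_le hx.1] at hlag
    have hcdx := hcd.mono hsub
    obtain ⟨y, hy, he⟩ := hlag (hcdx.of_le (by exact_mod_cast n.le_succ))
      ((hcdx.differentiableOn_iteratedDerivWithin (by exact_mod_cast n.lt_succ_self) hu).mono
        Set.Ioo_subset_Icc_self)
    have hy' := Set.Ioo_subset_Icc_self hy
    refine ⟨y, hsub hy', ?_⟩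
    rw [heq, he, iteratedDerivWithin_rpow_neg_half hs hlt hx.2 (n + 1) hy',
      iteratedDerivWithin_rpow_neg_half hs (by norm_num) le_rfl (n + 1) (hsub hy')]
  obtain ⟨y, hy, he⟩ := hlag
  change |f x - _| ≤ _
  rw [he, iteratedDerivWithin_rpow_neg_half hs (by norm_num) le_rfl (n + 1) hy]
  beta_reduce
  have hy2 := hy.2
  have hx1 := hx.1
  have hx2 := hx.2
  have hr : (s + 2 * (1 - y)) ^ (-(((n + 1 : ℕ) : ℝ) + 1 / 2)) ≤
      s ^ (-(((n + 1 : ℕ) : ℝ) + 1 / 2)) :=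
    Real.rpow_le_rpow_of_nonpos hs (by linarith) (by rw [neg_nonpos]; positivity)
  have hp : (x - -1) ^ (n + 1) ≤ 2 ^ (n + 1) := pow_le_pow_left₀ (by linarith) (by linarith) _
  have hxn : 0 ≤ (x - -1) ^ (n + 1) := pow_nonneg (by linarith) _
  have hb : 0 ≤ s + 2 * (1 - y) := by linarith
  have hprod : 0 ≤ ∏ j ∈ Finset.range (n + 1), (2 * (j : ℝ) + 1) :=
    Finset.prod_nonneg fun j _ => by positivity
  rw [abs_of_nonneg (by positivity), div_le_iff₀ (by positivity)]
  calc _ ≤ 2 ^ (n + 1) * ((n + 1).factorial : ℝ) * s ^ (-(((n + 1 : ℕ) : ℝ) + 1 / 2)) *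
        2 ^ (n + 1) := by
        gcongr
        exact prod_odd_le_two_pow_mul_factorial _
    _ = _ := by
      rw [show (4 : ℝ) = 2 * 2 by norm_num, mul_pow]
      ring

theorem integral_cos_mul_taylor_eq_zero (f : ℝ → ℝ) (n : ℕ) :
    ∫ θ in (0:ℝ)..Real.pi, Real.cos ((n + 1 : ℕ) * θ) *
      taylorWithinEval f n (Set.Icc (-1) 1) (-1) (Real.cos θ) = 0 := by
  simp_rw [taylor_within_apply, Finset.mul_sum, sub_neg_eq_add, smul_eq_mul]
  rw [intervalIntegral.integral_finsetSum fun k _ =>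
    Continuous.intervalIntegrable (by fun_prop) _ _]
  refine Finset.sum_eq_zero fun k hk => ?_
  have h : ∀ θ : ℝ, Real.cos ((n + 1 : ℕ) * θ) * (((k.factorial : ℝ)⁻¹ * (Real.cos θ + 1) ^ k) *
      iteratedDerivWithin k f (Set.Icc (-1) 1) (-1)) =
      ((k.factorial : ℝ)⁻¹ * iteratedDerivWithin k f (Set.Icc (-1) 1) (-1)) *
        (Real.cos ((n + 1 : ℕ) * θ) * (Real.cos θ + 1) ^ k) := fun θ => by ring
  simp_rw [h]
  rw [intervalIntegral.integral_const_mul,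
    integral_cos_mul_cos_add_one_pow k (Finset.mem_range.mp hk), mul_zero]

theorem abs_Fm_le {s : ℝ} (hs : 0 < s) (m : ℕ) :
    |Fm m s| ≤ 4 ^ m * s ^ (-((m : ℝ) + 1 / 2)) * Real.pi := by
  have hpos : ∀ θ : ℝ, 0 < s + 2 * (1 - Real.cos θ) := fun θ => by
    linarith [Real.cos_le_one θ]
  set f : ℝ → ℝ := fun x : ℝ => (s + 2 * (1 - x)) ^ (-(1 / 2) : ℝ) with hf
  have hF : Fm m s = ∫ θ in (0:ℝ)..Real.pi, Real.cos (m * θ) * f (Real.cos θ) := by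
    unfold Fm
    congr 1
    ext θ
    rw [hf, Real.sqrt_eq_rpow, div_eq_mul_inv, ← Real.rpow_neg (hpos θ).le]
  suffices h : ∃ P : ℝ → ℝ, Continuous P ∧
      (∫ θ in (0:ℝ)..Real.pi, Real.cos (m * θ) * P (Real.cos θ)) = 0 ∧
      ∀ x ∈ Set.Icc (-1 : ℝ) 1, |f x - P x| ≤ 4 ^ m * s ^ (-((m : ℝ) + 1 / 2)) by
    obtain ⟨P, hPc, hP0, hPb⟩ := h
    have hfc : Continuous fun θ : ℝ => f (Real.cos θ) :=
      Continuous.rpow_const (by fun_prop) fun θ => Or.inl (hpos θ).ne'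
    have hf_int : Continuous fun θ : ℝ => Real.cos (m * θ) * f (Real.cos θ) :=
      Continuous.mul (by fun_prop) hfc
    have hFs : Fm m s = ∫ θ in (0:ℝ)..Real.pi,
        Real.cos (m * θ) * (f (Real.cos θ) - P (Real.cos θ)) := by
      simp_rw [mul_sub]
      rw [intervalIntegral.integral_sub (hf_int.intervalIntegrable _ _)
        (Continuous.intervalIntegrable (by fun_prop) _ _), hP0, sub_zero, hF]
    have hbound := intervalIntegral.norm_integral_le_of_norm_le_const (a := 0) (b := Real.pi)
      (f := fun θ => Real.cos (m * θ) * (f (Real.cos θ) - P (Real.cos θ)))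
      (C := 4 ^ m * s ^ (-((m : ℝ) + 1 / 2))) fun θ _ => by
        rw [norm_mul, Real.norm_eq_abs, Real.norm_eq_abs]
        exact (mul_le_of_le_one_left (abs_nonneg _) (Real.abs_cos_le_one _)).trans
          (hPb _ (Real.cos_mem_Icc θ))
    rwa [← hFs, Real.norm_eq_abs, sub_zero, abs_of_pos Real.pi_pos] at hbound
  cases m with
  | zero =>
    refine ⟨fun _ => 0, continuous_const, by simp, fun x hx => ?_⟩
    have hx2 := hx.2
    have hx0 : 0 ≤ f x := Real.rpow_nonneg (by linarith) _
    rw [sub_zero, abs_of_nonneg hx0]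
    simpa [hf] using Real.rpow_le_rpow_of_nonpos (z := (-(1 / 2) : ℝ)) hs
      (by linarith : s ≤ s + 2 * (1 - x)) (by norm_num)
  | succ n =>
    refine ⟨taylorWithinEval f n (Set.Icc (-1) 1) (-1), ?_,
      integral_cos_mul_taylor_eq_zero f n,
      fun x hx => abs_rpow_neg_half_sub_taylor_le hs n hx⟩
    simp_rw [funext (taylor_within_apply f n (Set.Icc (-1) 1) (-1))]
    fun_prop

/-- Estimate (A.5): for `s > 4`, `s^{m+1/2} |F_m(s)| ≤ 4^m π`. -/
theorem Fm_large_s_bound (m : ℕ) (s : ℝ) (hs : 4 < s) :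
    s ^ ((m : ℝ) + 1/2) * |Fm m s| ≤ 4 ^ m * Real.pi := by
  have hs0 : 0 < s := by linarith
  calc s ^ ((m : ℝ) + 1/2) * |Fm m s|
      ≤ s ^ ((m : ℝ) + 1/2) * (4 ^ m * s ^ (-((m : ℝ) + 1 / 2)) * Real.pi) := by
        gcongr
        exact abs_Fm_le hs0 m
    _ = (s ^ ((m : ℝ) + 1/2) * s ^ (-((m : ℝ) + 1 / 2))) * (4 ^ m * Real.pi) := by ring
    _ = 4 ^ m * Real.pi := by
        rw [← Real.rpow_add hs0, add_neg_cancel, Real.rpow_zero, one_mul]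

end
end
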